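/- Let Σ and Γ be finite alphabets and f : Σ* ⇀ Γ* a partial function. The following are equivalent: (1) f is a first-order transduction, i.e. f is computed by some two-way deterministic finite transducer whose behaviour monoid is aperiodic; (2) f is computed by some planar deterministic two-way finite transducer; (3) f is computed by some planar reversible two-way finite transducer. -/

import Mathlib

namespace Planar2DFT

/-- Tape alphabet: input letters plus the two endmarkers `▷` and `◁`. -/
inductive Tape (A : Type) where
  | lend : Tape A
  | rend : Tape A
  | sym  : A → Tape A

/-- Edges of the transition profile `G(ρ, f)` on vertices `Q × Bool`
(`true` codes direction `+1`, `false` codes `-1`): an edge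
`(q, -ρ q) → (r, ρ r)` for every `(q, r) ∈ f`. -/
def ProfileEdge {Q : Type} (ρ : Q → Bool) (f : Set (Q × Q)) :
    Q × Bool → Q × Bool → Prop :=
  fun u v => ∃ p ∈ f, u = (p.1, !ρ p.1) ∧ v = (p.2, ρ p.2)

/-- The extension of a strict order on `Q` to `Q × Bool`:
`(q,i) < (r,j)` iff (`i = -1` and `j = 1`), or (`q < r` and `i = j = 1`),
or (`q > r` and `i = j = -1`). -/
def ExtLt {Q : Type} (lt : Q → Q → Prop) : Q × Bool → Q × Bool → Prop :=
  fun x y =>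
    (x.2 = false ∧ y.2 = true) ∨
    (lt x.1 y.1 ∧ x.2 = true ∧ y.2 = true) ∨
    (lt y.1 x.1 ∧ x.2 = false ∧ y.2 = false)

/-- Planarity of a transition w.r.t. a direction map `ρ` and a strict total
order `lt`: no vertices `u < r < v < s` with an edge between `u` and `v`
(in either direction) and an edge between `r` and `s` (in either direction). -/
def IsPlanar {Q : Type} (ρ : Q → Bool) (lt : Q → Q → Prop) (f : Set (Q × Q)) : Prop :=
  ¬ ∃ u r v s : Q × Bool, ExtLt lt u r ∧ ExtLt lt r v ∧ ExtLt lt v s ∧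
      (ProfileEdge ρ f u v ∨ ProfileEdge ρ f v u) ∧
      (ProfileEdge ρ f r s ∨ ProfileEdge ρ f s r)

/-- Deterministic transition: a partial function. -/
def IsDet {Q : Type} (f : Set (Q × Q)) : Prop :=
  ∀ q r r', (q, r) ∈ f → (q, r') ∈ f → r = r'

/-- Reversible transition: a partial injection. -/
def IsRev {Q : Type} (f : Set (Q × Q)) : Prop :=
  IsDet f ∧ ∀ q q' r, (q, r) ∈ f → (q', r) ∈ f → q = q'

/-- Edges of the glued graph `C(ρ, f, g)` on `Q × Fin 3`, levels `0, 1, 2`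
coding `-1, 0, 1`: the copy of `G(ρ,f)` lives on levels `{0,1}` (side `+1`
corresponding to level `1`) and the copy of `G(ρ,g)` on levels `{1,2}`
(side `+1` corresponding to level `2`). -/
def GlueEdge {Q : Type} (ρ : Q → Bool) (f g : Set (Q × Q)) :
    Q × Fin 3 → Q × Fin 3 → Prop :=
  fun x y =>
    (x.2 ≠ 2 ∧ y.2 ≠ 2 ∧
      ProfileEdge ρ f (x.1, decide (x.2 = 1)) (y.1, decide (y.2 = 1))) ∨
    (x.2 ≠ 0 ∧ y.2 ≠ 0 ∧
      ProfileEdge ρ g (x.1, decide (x.2 = 2)) (y.1, decide (y.2 = 2)))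

/-- Gluing composition `f * g` of transitions: `(q, r) ∈ f * g` iff there is a
directed path from `(q, -ρ q)` to `(r, ρ r)` in the glued graph `C(ρ, f, g)`. -/
def glue {Q : Type} (ρ : Q → Bool) (f g : Set (Q × Q)) : Set (Q × Q) :=
  {p | Relation.ReflTransGen (GlueEdge ρ f g)
        (p.1, if ρ p.1 then (0 : Fin 3) else 2)
        (p.2, if ρ p.2 then (2 : Fin 3) else 0)}

/-- The identity transition, unit of the gluing composition. -/
def idRel (Q : Type) : Set (Q × Q) := {p | p.1 = p.2}

/-- Iterated gluing powers of a transition, with `glpow ρ f 0 = idRel Q`. -/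
def glpow {Q : Type} (ρ : Q → Bool) (f : Set (Q × Q)) : ℕ → Set (Q × Q)
  | 0 => idRel Q
  | n + 1 => glue ρ (glpow ρ f n) f

/-- A configuration of a two-way machine: the tape content to the left of the
head, the current state, and the tape content to the right of the head. -/
abbrev Config (Q A : Type) := List (Tape A) × Q × List (Tape A)

/-- The tape encoding `▷ u ◁` of an input word `u`. -/
def tapeOf {A : Type} (u : List A) : List (Tape A) :=
  Tape.lend :: (u.map Tape.sym ++ [Tape.rend])

/-- A two-way (nondeterministic) finite transducer. -/
structure TwoWayTransducer (Q A B : Type) where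
  ρ : Q → Bool
  init : Q
  init_fwd : ρ init = true
  final : Set Q
  δ : Tape A → Set (Q × List B × Q)

namespace TwoWayTransducer

variable {Q A B : Type}

/-- The transitions `⌊δ⌋(a)` of the underlying automaton. -/
def rel (T : TwoWayTransducer Q A B) (a : Tape A) : Set (Q × Q) :=
  {p | ∃ w, (p.1, w, p.2) ∈ T.δ a}

def Deterministic (T : TwoWayTransducer Q A B) : Prop :=
  ∀ a, IsDet (T.rel a)

def Reversible (T : TwoWayTransducer Q A B) : Prop :=
  ∀ a, IsRev (T.rel a)

def Planar (T : TwoWayTransducer Q A B) : Prop :=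
  ∃ lt : Q → Q → Prop, IsStrictTotalOrder Q lt ∧
    ∀ a : A, IsPlanar T.ρ lt (T.rel (Tape.sym a))

/-- One step of the two-way transducer, labelled by the output word. -/
def Step (T : TwoWayTransducer Q A B) (c : Config Q A) (w : List B)
    (c' : Config Q A) : Prop :=
  ∃ a u v q r, (q, w, r) ∈ T.δ a ∧
    ((T.ρ q = true ∧ T.ρ r = true ∧ c = (u, q, a :: v) ∧ c' = (u ++ [a], r, v)) ∨
     (T.ρ q = true ∧ T.ρ r = false ∧ c = (u, q, a :: v) ∧ c' = (u, r, a :: v)) ∨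
     (T.ρ q = false ∧ T.ρ r = false ∧ c = (u ++ [a], q, v) ∧ c' = (u, r, a :: v)) ∨
     (T.ρ q = false ∧ T.ρ r = true ∧ c = (u ++ [a], q, v) ∧ c' = (u ++ [a], r, v)))

/-- Multi-step runs, accumulating the concatenated output. -/
inductive Run (T : TwoWayTransducer Q A B) : Config Q A → List B → Config Q A → Prop
  | refl (c : Config Q A) : Run T c [] c
  | step {c₁ w₁ c₂ w₂ c₃} : Run T c₁ w₁ c₂ → T.Step c₂ w₂ c₃ → Run T c₁ (w₁ ++ w₂) c₃

/-- The pair `(u, v)` is realized by `T`. -/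
def Realizes (T : TwoWayTransducer Q A B) (u : List A) (v : List B) : Prop :=
  ∃ qf ∈ T.final, T.Run ([], T.init, tapeOf u) v (tapeOf u, qf, [])

/-- `T` computes the partial function `f`. -/
def Computes (T : TwoWayTransducer Q A B) (f : List A → Option (List B)) : Prop :=
  ∀ u v, f u = some v ↔ T.Realizes u v

end TwoWayTransducer

/-- Membership in the least submonoid of `B(Q,ρ)` containing the transitions
`⌊δ⌋(a)` for the input letters `a`. -/
inductive InBehav {Q A B : Type} (T : TwoWayTransducer Q A B) : Set (Q × Q) → Prop
  | one : InBehav T (idRel Q)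
  | gen (a : A) : InBehav T (T.rel (Tape.sym a))
  | mul {f g} : InBehav T f → InBehav T g → InBehav T (glue T.ρ f g)

/-- The behaviour monoid `B(T)` is aperiodic. -/
def ApBehav {Q A B : Type} (T : TwoWayTransducer Q A B) : Prop :=
  ∃ n : ℕ, ∀ f, InBehav T f → glpow T.ρ f (n + 1) = glpow T.ρ f n

/-- A first-order transduction: a partial function computed by some
deterministic two-way transducer whose behaviour monoid is aperiodic. -/
def IsFOTransduction {A B : Type} (f : List A → Option (List B)) : Prop :=
  ∃ (n : ℕ) (T : TwoWayTransducer (Fin n) A B),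
    T.Deterministic ∧ ApBehav T ∧ T.Computes f

/-- A two-way (nondeterministic) finite automaton. -/
structure TwoWayAutomaton (Q A : Type) where
  ρ : Q → Bool
  init : Q
  init_fwd : ρ init = true
  final : Set Q
  δ : Tape A → Set (Q × Q)

namespace TwoWayAutomaton

variable {Q A : Type}

def Deterministic (M : TwoWayAutomaton Q A) : Prop := ∀ a, IsDet (M.δ a)

def Reversible (M : TwoWayAutomaton Q A) : Prop := ∀ a, IsRev (M.δ a)

def Planar (M : TwoWayAutomaton Q A) : Prop :=
  ∃ lt : Q → Q → Prop, IsStrictTotalOrder Q lt ∧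
    ∀ a : A, IsPlanar M.ρ lt (M.δ (Tape.sym a))

/-- One step of the two-way automaton. -/
def Step (M : TwoWayAutomaton Q A) (c c' : Config Q A) : Prop :=
  ∃ a u v q r, (q, r) ∈ M.δ a ∧
    ((M.ρ q = true ∧ M.ρ r = true ∧ c = (u, q, a :: v) ∧ c' = (u ++ [a], r, v)) ∨
     (M.ρ q = true ∧ M.ρ r = false ∧ c = (u, q, a :: v) ∧ c' = (u, r, a :: v)) ∨
     (M.ρ q = false ∧ M.ρ r = false ∧ c = (u ++ [a], q, v) ∧ c' = (u, r, a :: v)) ∨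
     (M.ρ q = false ∧ M.ρ r = true ∧ c = (u ++ [a], q, v) ∧ c' = (u ++ [a], r, v)))

def Accepts (M : TwoWayAutomaton Q A) (u : List A) : Prop :=
  ∃ qf ∈ M.final, Relation.ReflTransGen M.Step
    ([], M.init, tapeOf u) (tapeOf u, qf, [])

def Language (M : TwoWayAutomaton Q A) : Set (List A) := {u | M.Accepts u}

end TwoWayAutomaton

/-- The underlying automaton `⌊T⌋` of a transducer `T`. -/
def forget {Q A B : Type} (T : TwoWayTransducer Q A B) : TwoWayAutomaton Q A :=
  { ρ := T.ρ, init := T.init, init_fwd := T.init_fwd, final := T.final,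
    δ := fun a => T.rel a }

/-- Star-free languages: the smallest class containing all finite languages
and closed under finite union, complement and concatenation. -/
inductive StarFree {A : Type} : Set (List A) → Prop
  | of_finite (L : Set (List A)) : L.Finite → StarFree L
  | union {L M : Set (List A)} : StarFree L → StarFree M → StarFree (L ∪ M)
  | compl {L : Set (List A)} : StarFree L → StarFree Lᶜ
  | concat {L M : Set (List A)} : StarFree L → StarFree M →
      StarFree {w | ∃ u ∈ L, ∃ v ∈ M, w = u ++ v}

/-- A (total, deterministic) sequential transducer. -/
structure SeqTransducer (Q A B : Type) where
  init : Q
  next : A → Q → Q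
  out : A → Q → List B
  fin : Q → List B

namespace SeqTransducer

variable {Q A B : Type}

/-- Running a sequential transducer on a word from a state: final state and
produced output. -/
def run (T : SeqTransducer Q A B) : List A → Q → Q × List B
  | [], q => (q, [])
  | a :: w, q =>
      let p := run T w (T.next a q)
      (p.1, T.out a q ++ p.2)

/-- The (total) sequential function computed by a sequential transducer. -/
def fn (T : SeqTransducer Q A B) (w : List A) : List B :=
  (T.run w T.init).2 ++ T.fin (T.run w T.init).1

end SeqTransducer

/-- Membership in the transition monoid of a sequential transducer, i.e. the
monoid of functions `Q → Q` generated by the `∂₁(a)`. -/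
inductive SeqGen {Q A B : Type} (T : SeqTransducer Q A B) : (Q → Q) → Prop
  | id : SeqGen T id
  | gen (a : A) : SeqGen T (T.next a)
  | comp {h h'} : SeqGen T h → SeqGen T h' → SeqGen T (h ∘ h')

/-- A sequential transducer is aperiodic when its transition monoid is. -/
def SeqTransducer.Aperiodic {Q A B : Type} (T : SeqTransducer Q A B) : Prop :=
  ∃ n : ℕ, ∀ h, SeqGen T h → h^[n + 1] = h^[n]


end Planar2DFT

namespace Planar2DFT
open Relation

section Core
variable {Q C : Type}

/-- Boundary through which state `q` enters cell `j`. -/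
def entp (ρ : Q → Bool) (j : ℕ) (q : Q) : ℕ := if ρ q then j else j + 1
/-- Boundary through which state `q` leaves cell `j`. -/
def extp (ρ : Q → Bool) (j : ℕ) (q : Q) : ℕ := if ρ q then j + 1 else j

/-- Position-based step relation on a raw tape `t`. -/
def St (ρ : Q → Bool) (R : C → Set (Q × Q)) (t : List C) (x y : ℕ × Q) : Prop :=
  ∃ j a, t[j]? = some a ∧ (x.2, y.2) ∈ R a ∧ x.1 = entp ρ j x.2 ∧ y.1 = extp ρ j y.2

/-- Reachability. -/
abbrev Rch (ρ : Q → Bool) (R : C → Set (Q × Q)) (t : List C) :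
    ℕ × Q → ℕ × Q → Prop := ReflTransGen (St ρ R t)

/-- The behaviour of a raw tape. -/
def beh (ρ : Q → Bool) (R : C → Set (Q × Q)) (t : List C) : Set (Q × Q) :=
  {p | Rch ρ R t ((if ρ p.1 then 0 else t.length), p.1) ((if ρ p.2 then t.length else 0), p.2)}

theorem glueEdge_iff (ρ : Q → Bool) (f g : Set (Q × Q)) (x y : Q × Fin 3) :
    GlueEdge ρ f g x y ↔
      ((x.1, y.1) ∈ f ∧ x.2 = (if ρ x.1 then 0 else 1) ∧ y.2 = (if ρ y.1 then 1 else 0)) ∨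
      ((x.1, y.1) ∈ g ∧ x.2 = (if ρ x.1 then 1 else 2) ∧ y.2 = (if ρ y.1 then 2 else 1)) := by
  obtain ⟨q, i⟩ := x
  obtain ⟨r, j⟩ := y
  constructor
  · rintro (⟨h1, h2, ⟨p1, p2⟩, hp, e1, e2⟩ | ⟨h1, h2, ⟨p1, p2⟩, hp, e1, e2⟩)
    · left
      simp only [Prod.mk.injEq] at e1 e2
      obtain ⟨rfl, e1⟩ := e1
      obtain ⟨rfl, e2⟩ := e2
      refine ⟨hp, ?_, ?_⟩
      · fin_cases i <;> cases h : ρ q <;> simp_all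
      · fin_cases j <;> cases h : ρ r <;> simp_all
    · right
      simp only [Prod.mk.injEq] at e1 e2
      obtain ⟨rfl, e1⟩ := e1
      obtain ⟨rfl, e2⟩ := e2
      refine ⟨hp, ?_, ?_⟩
      · fin_cases i <;> cases h : ρ q <;> simp_all
      · fin_cases j <;> cases h : ρ r <;> simp_all
  · rintro (⟨hp, e1, e2⟩ | ⟨hp, e1, e2⟩)
    · left
      refine ⟨?_, ?_, (q, r), hp, ?_, ?_⟩ <;> dsimp only at e1 e2 ⊢ <;>
        cases h : ρ q <;> cases h' : ρ r <;> simp_all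
    · right
      refine ⟨?_, ?_, (q, r), hp, ?_, ?_⟩ <;> dsimp only at e1 e2 ⊢ <;>
        cases h : ρ q <;> cases h' : ρ r <;> simp_all

variable {ρ : Q → Bool} {R : C → Set (Q × Q)}

theorem St.le {t : List C} {x y : ℕ × Q} (h : St ρ R t x y) : y.1 ≤ t.length := by
  obtain ⟨j, a, hj, -, -, h2⟩ := h
  have := (List.getElem?_eq_some_iff.1 hj).1
  rw [h2, extp]; split <;> omega

theorem Rch.le {t : List C} {x y : ℕ × Q} (h : Rch ρ R t x y) (hx : x.1 ≤ t.length) :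
    y.1 ≤ t.length := by
  induction h with
  | refl => exact hx
  | tail _ h _ => exact h.le

theorem St.append_left {u : List C} (v : List C) {x y : ℕ × Q} (h : St ρ R u x y) :
    St ρ R (u ++ v) x y := by
  obtain ⟨j, a, hj, h⟩ := h
  refine ⟨j, a, ?_, h⟩
  have := (List.getElem?_eq_some_iff.1 hj).1
  rw [List.getElem?_append_left this, hj]

theorem St.append_right (u : List C) {v : List C} {x y : ℕ × Q} (h : St ρ R v x y) :
    St ρ R (u ++ v) (u.length + x.1, x.2) (u.length + y.1, y.2) := by
  obtain ⟨j, a, hj, h1, h2, h3⟩ := h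
  refine ⟨u.length + j, a, ?_, h1, ?_, ?_⟩
  · rw [List.getElem?_append_right (by omega)]; simpa using hj
  · simp only [h2, entp]; split <;> omega
  · simp only [h3, extp]; split <;> omega

theorem Rch.append_left {u : List C} (v : List C) {x y : ℕ × Q} (h : Rch ρ R u x y) :
    Rch ρ R (u ++ v) x y := by
  induction h with
  | refl => exact .refl
  | tail _ h ih => exact ih.tail (h.append_left v)

theorem Rch.append_right (u : List C) {v : List C} {x y : ℕ × Q} (h : Rch ρ R v x y) :
    Rch ρ R (u ++ v) (u.length + x.1, x.2) (u.length + y.1, y.2) := by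
  induction h with
  | refl => exact .refl
  | tail _ h ih => exact ih.tail (h.append_right u)

/-- Positions of the three levels. -/
def gp (u v : List C) (l : Fin 3) : ℕ :=
  if l = 0 then 0 else if l = 1 then u.length else u.length + v.length

theorem glue_to_rch (u v : List C) {x y : Q × Fin 3}
    (h : ReflTransGen (GlueEdge ρ (beh ρ R u) (beh ρ R v)) x y) :
    Rch ρ R (u ++ v) (gp u v x.2, x.1) (gp u v y.2, y.1) := by
  induction h with
  | refl => exact .refl
  | tail _ h ih =>
    refine ih.trans ?_
    rw [glueEdge_iff] at h
    rcases h with ⟨h, h1, h2⟩ | ⟨h, h1, h2⟩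
    · have := Rch.append_left v h
      rw [h1, h2]
      convert this using 2
      · dsimp only; split <;> simp [gp]
      · dsimp only; split <;> simp [gp]
    · have := Rch.append_right u h
      rw [h1, h2]
      convert this using 2
      · dsimp only; split <;> simp [gp]
      · dsimp only; split <;> simp [gp]

theorem rch_to_glue_aux (u v : List C) {x : Q × Fin 3}
    (hx0 : x.2 = 0 → ρ x.1 = true) (hx2 : x.2 = 2 → ρ x.1 = false) {y : ℕ × Q}
    (h : Rch ρ R (u ++ v) (gp u v x.2, x.1) y) :
    ∃ W : Q × Fin 3, ReflTransGen (GlueEdge ρ (beh ρ R u) (beh ρ R v)) x W ∧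
      ((W.2 = (if ρ W.1 then 0 else 1) ∧
          Rch ρ R u ((if ρ W.1 then 0 else u.length), W.1) y) ∨
       (W.2 = (if ρ W.1 then 1 else 2) ∧ ∃ i, y.1 = u.length + i ∧
          Rch ρ R v ((if ρ W.1 then 0 else v.length), W.1) (i, y.2))) := by
  induction h with
  | refl =>
    refine ⟨x, .refl, ?_⟩
    obtain ⟨q, l⟩ := x
    dsimp only at *
    fin_cases l
    · left; simp at hx0; simp [hx0, gp]; exact .refl
    · cases h : ρ q
      · left; simp [gp]; exact .refl
      · right; simp [gp]; exact .refl
    · right; simp at hx2; simp [hx2, gp]; exact .refl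
  | @tail y z _ h ih =>
    obtain ⟨W, hW, hc⟩ := ih
    obtain ⟨j, a, hj, hR, hy, hz⟩ := h
    by_cases hju : j < u.length
    · rw [List.getElem?_append_left hju] at hj
      have hst : St ρ R u y z := ⟨j, a, hj, hR, hy, hz⟩
      rcases hc with ⟨h1, h2⟩ | ⟨h1, i, h2, h3⟩
      · exact ⟨W, hW, .inl ⟨h1, h2.tail hst⟩⟩
      · have hρ : ρ y.2 = false := by
          by_contra hc
          simp only [Bool.not_eq_false] at hc
          simp only [entp, hc, if_true] at hy
          omega
        simp only [entp, hρ] at hy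
        have hi : i = 0 := by simp at hy; omega
        subst hi
        refine ⟨(y.2, 1), hW.tail ?_, .inl ⟨by simp [hρ], ?_⟩⟩
        · rw [glueEdge_iff]; right
          refine ⟨?_, h1, by simp [hρ]⟩
          simp only [beh, Set.mem_ofPred_eq, hρ]; simpa using h3
        · refine .head ?_ .refl
          convert hst using 1
          ext <;> simp [hρ]; omega
    · have hju' : u.length ≤ j := by omega
      rw [List.getElem?_append_right hju'] at hj
      have hlt := (List.getElem?_eq_some_iff.1 hj).1
      have hst : St ρ R v (y.1 - u.length, y.2) (z.1 - u.length, z.2) := by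
        refine ⟨j - u.length, a, hj, hR, ?_, ?_⟩
        · clear hz; simp only [entp] at hy ⊢; split at hy <;> rename_i hh <;> simp only [hh] <;> simp <;> omega
        · clear hy; simp only [extp] at hz ⊢; split at hz <;> rename_i hh <;> simp only [hh] <;> simp <;> omega
      have hz' : z.1 = u.length + (z.1 - u.length) := by
        simp only [extp] at hz; split at hz <;> omega
      rcases hc with ⟨h1, h2⟩ | ⟨h1, i, h2, h3⟩
      · have hle := Rch.le h2 (by dsimp only; split <;> omega)
        have hρ : ρ y.2 = true := by
          by_contra hc
          simp only [Bool.not_eq_true] at hc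
          simp only [entp, hc] at hy
          simp at hy
          omega
        simp only [entp, hρ, if_true] at hy
        refine ⟨(y.2, 1), hW.tail ?_, .inr ⟨by simp [hρ], z.1 - u.length, hz', ?_⟩⟩
        · rw [glueEdge_iff]; left
          refine ⟨?_, h1, by simp [hρ]⟩
          simp only [beh, Set.mem_ofPred_eq, hρ, if_true]
          have : (u.length, y.2) = y := by ext <;> simp; omega
          rw [this]; exact h2
        · refine .head ?_ .refl
          convert hst using 1
          ext <;> simp [hρ]; omega
      · refine ⟨W, hW, .inr ⟨h1, _, hz', h3.tail ?_⟩⟩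
        have : i = y.1 - u.length := by omega
        rw [this]; exact hst

theorem rch_to_glue (u v : List C) {x y : Q × Fin 3}
    (hx0 : x.2 = 0 → ρ x.1 = true) (hx2 : x.2 = 2 → ρ x.1 = false)
    (hy0 : y.2 = 0 → ρ y.1 = false) (hy2 : y.2 = 2 → ρ y.1 = true)
    (h : Rch ρ R (u ++ v) (gp u v x.2, x.1) (gp u v y.2, y.1)) :
    ReflTransGen (GlueEdge ρ (beh ρ R u) (beh ρ R v)) x y := by
  obtain ⟨W, hW, hc⟩ := rch_to_glue_aux u v hx0 hx2 h
  refine hW.trans ?_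
  obtain ⟨q, l⟩ := y
  obtain ⟨w, m⟩ := W
  have hidl : ∀ (hu : u.length = 0), (q, q) ∈ beh ρ R u := by
    intro hu; simp only [beh, Set.mem_ofPred_eq, hu]; simp; exact .refl
  have hidr : ∀ (hu : v.length = 0), (q, q) ∈ beh ρ R v := by
    intro hu; simp only [beh, Set.mem_ofPred_eq, hu]; simp; exact .refl
  dsimp only at *
  rcases hc with ⟨h1, h2⟩ | ⟨h1, i, h2, h3⟩
  · have hle := Rch.le h2 (by dsimp only; split <;> omega)
    dsimp only at hle
    fin_cases l
    · simp at hy0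
      refine .single ?_
      rw [glueEdge_iff]; left
      refine ⟨?_, h1, by simp [hy0]⟩
      simp only [beh, Set.mem_ofPred_eq, hy0]; simpa [gp] using h2
    · cases hq : ρ q
      · rcases ReflTransGen.cases_tail h2 with h2 | ⟨z, _, hz⟩
        · simp [gp] at h2
          obtain ⟨h2, rfl⟩ := h2
          simp [hq] at h1; subst h1; exact .refl
        · obtain ⟨j, a, hj, -, -, hz⟩ := hz
          have := (List.getElem?_eq_some_iff.1 hj).1
          simp [gp, extp, hq] at hz
          omega
      · refine .single ?_
        rw [glueEdge_iff]; left
        refine ⟨?_, h1, by simp [hq]⟩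
        simp only [beh, Set.mem_ofPred_eq, hq]; simpa [gp] using h2
    · simp at hy2
      simp [gp] at hle
      have hv : v.length = 0 := by simp [hle]
      refine .head (b := (q, 1)) ?_ (.single ?_)
      · rw [glueEdge_iff]; left
        refine ⟨?_, h1, by simp [hy2]⟩
        simp only [beh, Set.mem_ofPred_eq, hy2]; simpa [gp, hle] using h2
      · rw [glueEdge_iff]; right
        exact ⟨hidr hv, by simp [hy2], by simp [hy2]⟩
  · have hle := Rch.le h3 (by dsimp only; split <;> omega)
    dsimp only at hle
    fin_cases l
    · simp at hy0
      have h2' : 0 = u.length + i := h2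
      have hu : u.length = 0 := by omega
      have hi : i = 0 := by omega
      subst hi
      refine .head (b := (q, 1)) ?_ (.single ?_)
      · rw [glueEdge_iff]; right
        refine ⟨?_, h1, by simp [hy0]⟩
        simp only [beh, Set.mem_ofPred_eq, hy0]; simpa using h3
      · rw [glueEdge_iff]; left
        exact ⟨hidl hu, by simp [hy0], by simp [hy0]⟩
    · simp [gp] at h2
      subst h2
      cases hq : ρ q
      · refine .single ?_
        rw [glueEdge_iff]; right
        refine ⟨?_, h1, by simp [hq]⟩
        simp only [beh, Set.mem_ofPred_eq, hq]; simpa [gp] using h3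
      · rcases ReflTransGen.cases_tail h3 with h2 | ⟨z, _, hz⟩
        · simp at h2
          obtain ⟨h2, rfl⟩ := h2
          simp [hq] at h1; subst h1; exact .refl
        · obtain ⟨j, a, hj, -, -, hz⟩ := hz
          simp [extp, hq] at hz
    · simp at hy2
      simp [gp] at h2
      subst h2
      refine .single ?_
      rw [glueEdge_iff]; right
      refine ⟨?_, h1, by simp [hy2]⟩
      simp only [beh, Set.mem_ofPred_eq, hy2]; simpa [gp] using h3

theorem beh_append (u v : List C) :
    beh ρ R (u ++ v) = glue ρ (beh ρ R u) (beh ρ R v) := by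
  ext ⟨q, r⟩
  have e1 : (if ρ q then 0 else (u ++ v).length) =
      gp u v (if ρ q then (0 : Fin 3) else 2) := by split <;> simp [gp]
  have e2 : (if ρ r then (u ++ v).length else 0) =
      gp u v (if ρ r then (2 : Fin 3) else 0) := by split <;> simp [gp]
  simp only [beh, glue, Set.mem_ofPred_eq]
  rw [e1, e2]
  constructor
  · intro h
    refine rch_to_glue (x := (q, if ρ q then (0 : Fin 3) else 2))
      (y := (r, if ρ r then (2 : Fin 3) else 0)) u v ?_ ?_ ?_ ?_ h <;> dsimp only <;>
      split <;> simp_all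
  · intro h
    exact glue_to_rch u v h

theorem beh_nil : beh ρ R ([] : List C) = idRel Q := by
  ext ⟨q, r⟩
  simp only [beh, idRel, Set.mem_ofPred_eq, List.length_nil, ite_self]
  constructor
  · intro h
    rcases ReflTransGen.cases_head h with h | ⟨z, ⟨j, a, hj, -⟩, _⟩
    · simpa using h
    · simp at hj
  · rintro rfl; exact .refl

theorem beh_single (a : C) : beh ρ R [a] = R a := by
  ext ⟨q, r⟩
  simp only [beh, Set.mem_ofPred_eq, List.length_singleton]
  constructor
  · intro h
    rcases ReflTransGen.cases_head h with h | ⟨z, ⟨j, b, hj, hR, h1, h2⟩, hz⟩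
    · simp at h
      obtain ⟨h, rfl⟩ := h
      split at h <;> simp at h
    · have hj0 : j = 0 := by
        have := (List.getElem?_eq_some_iff.1 hj).1; simpa using this
      subst hj0
      simp at hj; subst hj
      rcases ReflTransGen.cases_head hz with h | ⟨z', ⟨j, b, hj, hR', h1', h2'⟩, hz⟩
      · rw [h] at hR; exact hR
      · have hj0 : j = 0 := by
          have := (List.getElem?_eq_some_iff.1 hj).1; simpa using this
        subst hj0
        rw [h1'] at h2
        simp only [entp, extp] at h2
        split at h2 <;> simp at h2
  · intro h
    exact .single ⟨0, a, rfl, h, by simp [entp], by simp [extp]⟩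

theorem beh_replicate (w : List C) (n : ℕ) :
    beh ρ R (List.replicate n w).flatten = glpow ρ (beh ρ R w) n := by
  induction n with
  | zero => simp [glpow, beh_nil]
  | succ n ih =>
    rw [List.replicate_succ', List.flatten_append, beh_append, ih, glpow]
    simp

end Core
end Planar2DFT

namespace Planar2DFT
open Relation

section Heights
variable {Q : Type}

/-- Planarity with respect to a height function. -/
def HPlanar (ρ : Q → Bool) (h : Q → ℕ) (f : Set (Q × Q)) : Prop :=
  IsPlanar ρ (fun a b => h a < h b) f

/-- Signed position of a vertex. -/
def vpos (h : Q → ℕ) (x : Q × Bool) : ℤ := if x.2 then (h x.1 : ℤ) + 1 else -((h x.1 : ℤ) + 1)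

theorem extLt_iff (h : Q → ℕ) (x y : Q × Bool) :
    ExtLt (fun a b => h a < h b) x y ↔ vpos h x < vpos h y := by
  obtain ⟨q, i⟩ := x
  obtain ⟨r, j⟩ := y
  cases i <;> cases j <;> simp [ExtLt, vpos] <;> omega

/-- Undirected profile edge. -/
def UEdge (ρ : Q → Bool) (f : Set (Q × Q)) (u v : Q × Bool) : Prop :=
  ProfileEdge ρ f u v ∨ ProfileEdge ρ f v u

theorem UEdge.symm {ρ : Q → Bool} {f : Set (Q × Q)} {u v : Q × Bool} (h : UEdge ρ f u v) :
    UEdge ρ f v u := Or.symm h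

theorem hplanar_iff {ρ : Q → Bool} {h : Q → ℕ} {f : Set (Q × Q)} :
    HPlanar ρ h f ↔ ∀ u r v s, UEdge ρ f u v → UEdge ρ f r s →
      vpos h u < vpos h r → vpos h r < vpos h v → vpos h v < vpos h s → False := by
  unfold HPlanar IsPlanar
  simp only [extLt_iff]
  constructor
  · intro H u r v s h1 h2 h3 h4 h5
    exact H ⟨u, r, v, s, h3, h4, h5, h1, h2⟩
  · rintro H ⟨u, r, v, s, h3, h4, h5, h1, h2⟩
    exact H u r v s h1 h2 h3 h4 h5

theorem exists_height [Finite Q] (lt : Q → Q → Prop) (hlt : IsStrictTotalOrder Q lt) :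
    ∃ h : Q → ℕ, Function.Injective h ∧ ∀ a b, lt a b ↔ h a < h b := by
  have hmono : ∀ a b, lt a b → Set.ncard {p | lt p a} < Set.ncard {p | lt p b} := by
    intro a b hab
    refine Set.ncard_lt_ncard ?_ (Set.toFinite _)
    refine ⟨fun p hp => _root_.trans (r := lt) hp hab, fun hh => ?_⟩
    exact irrefl (r := lt) a (hh hab)
  have hiff : ∀ a b, lt a b ↔ Set.ncard {p | lt p a} < Set.ncard {p | lt p b} := by
    intro a b
    refine ⟨hmono a b, fun hh => ?_⟩
    rcases trichotomous_of lt a b with h | h | h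
    · exact h
    · subst h; omega
    · have := hmono _ _ h; omega
  refine ⟨fun q => Set.ncard {p | lt p q}, ?_, hiff⟩
  intro a b hab
  rcases trichotomous_of lt a b with h | h | h
  · have := hmono _ _ h; simp only at hab; omega
  · exact h
  · have := hmono _ _ h; simp only at hab; omega

theorem hplanar_mirror {ρ : Q → Bool} {h : Q → ℕ} {f : Set (Q × Q)} (H : HPlanar ρ h f) :
    HPlanar (fun q => !ρ q) h f := by
  rw [hplanar_iff] at H ⊢
  have key : ∀ u v, UEdge (fun q => !ρ q) f u v → UEdge ρ f (u.1, !u.2) (v.1, !v.2) := by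
    rintro u v (⟨p, hp, rfl, rfl⟩ | ⟨p, hp, rfl, rfl⟩)
    · exact .inl ⟨p, hp, by simp, by simp⟩
    · exact .inr ⟨p, hp, by simp, by simp⟩
  have hp : ∀ u : Q × Bool, vpos h (u.1, !u.2) = - vpos h u := by
    rintro ⟨q, b⟩; cases b <;> simp [vpos]
  intro u r v s h1 h2 h3 h4 h5
  have h1' := key _ _ h1
  have h2' := key _ _ h2
  refine H _ _ _ _ h2'.symm h1'.symm ?_ ?_ ?_ <;> rw [hp, hp] <;> omega

end Heights

section Paths
/-- Paths with explicit vertex list. -/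
inductive PathL {α : Type} (r : α → α → Prop) : α → α → List α → Prop
  | nil (x : α) : PathL r x x [x]
  | cons {x y z L} : r x y → PathL r y z L → PathL r x z (x :: L)

variable {α : Type} {r : α → α → Prop}

theorem exists_pathL {x z : α} (h : ReflTransGen r x z) : ∃ L, PathL r x z L := by
  induction h using ReflTransGen.head_induction_on with
  | refl => exact ⟨_, .nil _⟩
  | head h _ ih => obtain ⟨L, hL⟩ := ih; exact ⟨_, .cons h hL⟩

theorem PathL.reach {x z : α} {L : List α} (h : PathL r x z L) :
    ∀ w ∈ L, ReflTransGen r x w ∧ ReflTransGen r w z := by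
  induction h with
  | nil x => intro w hw; simp at hw; subst hw; exact ⟨.refl, .refl⟩
  | cons h _ ih =>
    rename_i hp
    intro w hw
    rcases List.mem_cons.1 hw with rfl | hw
    · refine ⟨.refl, .head h ?_⟩
      cases hp with
      | nil => exact .refl
      | cons h' _ => exact (ih _ (by simp)).2
    · exact ⟨.head h (ih w hw).1, (ih w hw).2⟩

theorem PathL.start {x z : α} {L : List α} (h : PathL r x z L) :
    ∃ L1, L = x :: L1 ∧ ∀ w ∈ L1, ∃ v, r v w := by
  induction h with
  | nil x => exact ⟨[], rfl, by simp⟩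
  | @cons x y z L h _ ih =>
    obtain ⟨L1, rfl, h1⟩ := ih
    refine ⟨_, rfl, ?_⟩
    intro w hw
    rcases List.mem_cons.1 hw with rfl | hw
    · exact ⟨_, h⟩
    · exact h1 w hw

theorem PathL.ending {x z : α} {L : List α} (h : PathL r x z L) :
    ∃ L1, L = L1 ++ [z] ∧ ∀ w ∈ L1, ∃ v, r w v := by
  induction h with
  | nil x => exact ⟨[], rfl, by simp⟩
  | @cons x y z L h _ ih =>
    obtain ⟨L1, rfl, h1⟩ := ih
    refine ⟨x :: L1, rfl, ?_⟩
    intro w hw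
    rcases List.mem_cons.1 hw with rfl | hw
    · exact ⟨_, h⟩
    · exact h1 w hw

end Paths

section Mono
variable {Q C : Type} {ρ : Q → Bool} {R : C → Set (Q × Q)}

theorem St.det {t : List C} (hd : ∀ a ∈ t, IsDet (R a)) {x y z : ℕ × Q}
    (h1 : St ρ R t x y) (h2 : St ρ R t x z) : y = z := by
  obtain ⟨j, a, hj, hR, hx, hy⟩ := h1
  obtain ⟨j', a', hj', hR', hx', hz⟩ := h2
  have : j = j' := by
    rw [hx] at hx'; simp only [entp] at hx'; split at hx' <;> omega
  subst this
  rw [hj] at hj'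
  obtain rfl : a = a' := by simpa using hj'
  have := hd a (List.mem_of_getElem? hj) _ _ _ hR hR'
  ext
  · rw [hy, hz, this]
  · exact this

theorem St.not_end {t : List C} {q : Q} (hq : ρ q = true) {y : ℕ × Q} :
    ¬ St ρ R t (t.length, q) y := by
  rintro ⟨j, a, hj, -, hx, -⟩
  have := (List.getElem?_eq_some_iff.1 hj).1
  simp [entp, hq] at hx
  omega

theorem St.not_start {t : List C} {q : Q} (hq : ρ q = false) {y : ℕ × Q} :
    ¬ St ρ R t (0, q) y := by
  rintro ⟨j, a, hj, -, hx, -⟩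
  simp [entp, hq] at hx

theorem beh_det {t : List C} (hd : ∀ a ∈ t, IsDet (R a)) : IsDet (beh ρ R t) := by
  intro q r r' h1 h2
  simp only [beh, Set.mem_ofPred_eq] at h1 h2
  have nost : ∀ r y, ¬ St ρ R t ((if ρ r then t.length else 0), r) y := by
    intro r y
    cases hr : ρ r
    · simpa using St.not_start hr
    · simpa using St.not_end hr
  have hU : Relator.RightUnique (St ρ R t) := fun _ _ _ h1 h2 => St.det hd h1 h2
  rcases ReflTransGen.total_of_right_unique hU h1 h2 with h | h
  · rcases ReflTransGen.cases_head h with h | ⟨z, h, _⟩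
    · exact (Prod.ext_iff.1 h).2
    · exact absurd h (nost _ _)
  · rcases ReflTransGen.cases_head h with h | ⟨z, h, _⟩
    · exact (Prod.ext_iff.1 h).2.symm
    · exact absurd h (nost _ _)

theorem path_sum {t : List C} {x : ℕ × Q} {e : ℕ × Q} {L : List (ℕ × Q)}
    (hL : PathL (St ρ R t) x e L) (he : e.1 = t.length) (hρ : ρ e.2 = true)
    (φ : ℕ × Q → ZMod 2) (j : ℕ) (hj : j < t.length)
    (hφ : ∀ a b, a ∈ L → b ∈ L → (∃ c, t[j]? = some c ∧ (a.2, b.2) ∈ R c) →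
      a.1 = entp ρ j a.2 → b.1 = extp ρ j b.2 → φ a + φ b = 0) :
    (L.map (fun z => if z.1 = j ∨ z.1 = j + 1 then φ z else 0)).sum =
      if x.1 = extp ρ j x.2 then φ x else 0 := by
  induction hL with
  | nil x =>
    simp only [List.map_cons, List.map_nil, List.sum_cons, List.sum_nil, add_zero]
    rw [he, extp, hρ]
    congr 1
    simp; omega
  | @cons x y e L h hp ih =>
    have ih := ih he hρ (fun a b ha hb => hφ a b (by simp [ha]) (by simp [hb]))
    rw [List.map_cons, List.sum_cons, ih]
    have hyL : y ∈ L := by cases hp <;> simp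
    obtain ⟨j0, a, hj0, hR, hx, hy⟩ := h
    by_cases hjj : j0 = j
    · subst hjj
      have h1 : x.1 = j0 ∨ x.1 = j0 + 1 := by rw [hx, entp]; split <;> simp
      have h2 : ¬ x.1 = extp ρ j0 x.2 := by rw [hx, entp, extp]; split <;> simp
      rw [if_pos h1, if_pos hy, if_neg h2]
      exact hφ x y (by simp) (by simp [hyL]) ⟨a, hj0, hR⟩ hx hy
    · have h2 : ¬ y.1 = extp ρ j y.2 := by
        rw [hy, extp, extp]; split <;> omega
      rw [if_neg h2, add_zero]
      congr 1
      rw [hx, entp, extp]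
      split <;> simp <;> omega

/-- Purely arithmetical core of the parity argument. -/
theorem parity_core (sa sb sy sz : Bool) (a b y z : ℕ)
    (P : Bool → ℕ → ℤ) (hP : P = fun s n => if s then (n : ℤ) + 1 else -((n : ℤ) + 1))
    (h1 : P sa a < P sy y → P sy y < P sb b → P sb b < P sz z → False)
    (h2 : P sa a < P sz z → P sz z < P sb b → P sb b < P sy y → False)
    (h3 : P sb b < P sy y → P sy y < P sa a → P sa a < P sz z → False)
    (h4 : P sb b < P sz z → P sz z < P sa a → P sa a < P sy y → False)
    (h5 : P sy y < P sa a → P sa a < P sz z → P sz z < P sb b → False)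
    (h6 : P sy y < P sb b → P sb b < P sz z → P sz z < P sa a → False)
    (h7 : P sz z < P sa a → P sa a < P sy y → P sy y < P sb b → False)
    (h8 : P sz z < P sb b → P sb b < P sy y → P sy y < P sa a → False)
    (d1 : sa = sy → a ≠ y) (d2 : sa = sz → a ≠ z) (d3 : sb = sy → b ≠ y) (d4 : sb = sz → b ≠ z) :
    ((if sa = sy ∧ a < y then 1 else 0) + (if sa = sz ∧ a < z then 1 else 0)) +
    ((if sb = sy ∧ b < y then 1 else 0) + (if sb = sz ∧ b < z then 1 else 0)) = (0 : ZMod 2) := by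
  subst hP
  have two : (1 : ZMod 2) + 1 = 0 := rfl
  have cv : ∀ {x y z : Prop}, (x → y → z → False) → ¬ (x ∧ y ∧ z) :=
    fun h ⟨a, b, c⟩ => h a b c
  replace h1 := cv h1
  replace h2 := cv h2
  replace h3 := cv h3
  replace h4 := cv h4
  replace h5 := cv h5
  replace h6 := cv h6
  replace h7 := cv h7
  replace h8 := cv h8
  cases sa <;> cases sb <;> cases sy <;> cases sz <;>
  simp only [Bool.false_eq_true, Bool.true_eq_false, if_true, if_false, true_and, false_and,
    forall_const, false_imp_iff]
    at h1 h2 h3 h4 h5 h6 h7 h8 d1 d2 d3 d4 ⊢ <;>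
  (try split_ifs) <;> first | rfl | (exfalso; grind)

theorem mono_trav {h : Q → ℕ} (hinj : Function.Injective h) {t : List C}
    (hd : ∀ a ∈ t, IsDet (R a)) (hpl : ∀ a ∈ t, HPlanar ρ h (R a)) {q r q' r' : Q}
    (hq : ρ q = true) (hr : ρ r = true) (hq' : ρ q' = true) (hr' : ρ r' = true)
    (h1 : (q, r) ∈ beh ρ R t) (h2 : (q', r') ∈ beh ρ R t) (hlt : h q < h q') : h r ≤ h r' := by
  simp only [beh, Set.mem_ofPred_eq, hq, hr, hq', hr', if_true] at h1 h2
  obtain ⟨L, hL⟩ := exists_pathL h1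
  obtain ⟨L', hL'⟩ := exists_pathL h2
  by_cases hdis : ∃ z, z ∈ L ∧ z ∈ L'
  · obtain ⟨z, hz, hz'⟩ := hdis
    have e1 := (hL.reach z hz).2
    have e2 := (hL'.reach z hz').2
    have hU : Relator.RightUnique (St ρ R t) := fun _ _ _ h1 h2 => St.det hd h1 h2
    rcases ReflTransGen.total_of_right_unique hU e1 e2 with h | h
    · rcases ReflTransGen.cases_head h with h | ⟨z, h, _⟩
      · obtain rfl := (Prod.ext_iff.1 h).2
        exact le_rfl
      · exact absurd h (St.not_end hr)
    · rcases ReflTransGen.cases_head h with h | ⟨z, h, _⟩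
      · obtain rfl := (Prod.ext_iff.1 h).2
        exact le_rfl
      · exact absurd h (St.not_end hr')
  · push Not at hdis
    set side : ℕ × Q → ZMod 2 := fun y =>
      (L.map (fun z => if z.1 = y.1 ∧ h z.2 < h y.2 then (1 : ZMod 2) else 0)).sum with hside
    have hstep : ∀ y y', y ∉ L → y' ∉ L → St ρ R t y y' → side y = side y' := by
      rintro y y' hy hy' ⟨j, c, hj, hR, e1, e2⟩
      have hjlt := (List.getElem?_eq_some_iff.1 hj).1
      have hb1 : y.1 = j ∨ y.1 = j + 1 := by rw [e1, entp]; split <;> simp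
      have hb2 : y'.1 = j ∨ y'.1 = j + 1 := by rw [e2, extp]; split <;> simp
      have key := path_sum hL rfl hr
        (fun z => (if z.1 = y.1 ∧ h z.2 < h y.2 then (1 : ZMod 2) else 0) +
          (if z.1 = y'.1 ∧ h z.2 < h y'.2 then (1 : ZMod 2) else 0)) j hjlt ?_
      · have : side y + side y' = 0 := by
          rw [hside]
          simp only
          rw [← List.sum_map_add]
          simp only [extp, hq, if_true] at key
          rw [if_neg (by simp)] at key
          refine Eq.trans ?_ key
          congr 1
          apply List.map_congr_left
          intro z _
          by_cases hz : z.1 = j ∨ z.1 = j + 1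
          · rw [if_pos hz]
          · rw [if_neg hz, if_neg (by rintro ⟨h, -⟩; rw [h] at hz; exact hz hb1),
              if_neg (by rintro ⟨h, -⟩; rw [h] at hz; exact hz hb2), add_zero]
        exact CharTwo.add_eq_zero.1 this
      · rintro a b ha hb ⟨c', hc', hRab⟩ e3 e4
        rw [hj] at hc'
        obtain rfl : c = c' := by simpa using hc'
        have hP := hpl c (List.mem_of_getElem? hj)
        rw [hplanar_iff] at hP
        have ue1 : UEdge ρ (R c) (a.2, !ρ a.2) (b.2, ρ b.2) := .inl ⟨(a.2, b.2), hRab, rfl, rfl⟩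
        have ue2 : UEdge ρ (R c) (y.2, !ρ y.2) (y'.2, ρ y'.2) := .inl ⟨(y.2, y'.2), hR, rfl, rfl⟩
        have core := parity_core (!ρ a.2) (ρ b.2) (!ρ y.2) (ρ y'.2) (h a.2) (h b.2) (h y.2) (h y'.2)
          _ rfl (hP _ _ _ _ ue1 ue2) (hP _ _ _ _ ue1 ue2.symm) (hP _ _ _ _ ue1.symm ue2)
          (hP _ _ _ _ ue1.symm ue2.symm) (hP _ _ _ _ ue2 ue1) (hP _ _ _ _ ue2 ue1.symm)
          (hP _ _ _ _ ue2.symm ue1) (hP _ _ _ _ ue2.symm ue1.symm) ?_ ?_ ?_ ?_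
        · have c1 : a.1 = y.1 ↔ (!ρ a.2) = (!ρ y.2) := by
            rw [e1, e3, entp, entp]; cases ρ a.2 <;> cases ρ y.2 <;> simp
          have c2 : a.1 = y'.1 ↔ (!ρ a.2) = (ρ y'.2) := by
            rw [e2, e3, entp, extp]; cases ρ a.2 <;> cases ρ y'.2 <;> simp
          have c3 : b.1 = y.1 ↔ (ρ b.2) = (!ρ y.2) := by
            rw [e1, e4, entp, extp]; cases ρ b.2 <;> cases ρ y.2 <;> simp
          have c4 : b.1 = y'.1 ↔ (ρ b.2) = (ρ y'.2) := by
            rw [e2, e4, extp, extp]; cases ρ b.2 <;> cases ρ y'.2 <;> simp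
          simp only [c1, c2, c3, c4]
          exact core
        · intro hs hh
          refine hy ?_
          have : a = y := by
            refine Prod.ext ?_ (hinj hh)
            rw [e1, e3, hinj hh]
          rwa [← this]
        · intro hs hh
          refine hy' ?_
          have h0 := hinj hh
          rw [h0] at hs; simp at hs
        · intro hs hh
          have h0 := hinj hh
          rw [h0] at hs; simp at hs
        · intro hs hh
          refine hy' ?_
          have : b = y' := by
            refine Prod.ext ?_ (hinj hh)
            rw [e2, e4, hinj hh]
          rwa [← this]
    have hinv : ∀ x e L1, PathL (St ρ R t) x e L1 → (∀ z ∈ L1, z ∉ L) → side x = side e := by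
      intro x e L1 hp
      induction hp with
      | nil => intro _; rfl
      | @cons x y e L1 hs hp ih =>
        intro hL1
        have hyL : y ∈ L1 := by cases hp <;> simp
        rw [← ih (fun z hz => hL1 z (by simp [hz]))]
        exact hstep _ _ (hL1 x (by simp)) (hL1 y (by simp [hyL])) hs
    have hfin := hinv _ _ _ hL' (fun z hz hzL => hdis z hzL hz)
    have hs0 : side (0, q') = 1 := by
      obtain ⟨L1, rfl, hL1⟩ := hL.start
      obtain ⟨L2, hL2e, hL2⟩ := hL.ending
      rw [hside]
      simp only [List.map_cons, List.sum_cons]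
      rw [if_pos ⟨trivial, hlt⟩]
      rw [List.sum_eq_zero, add_zero]
      intro v hv
      obtain ⟨w, hw, rfl⟩ := List.mem_map.1 hv
      rw [if_neg]
      rintro ⟨hw0, -⟩
      obtain ⟨v, j, a, hj, -, -, hv⟩ := hL1 w hw
      have hρw : ρ w.2 = false := by
        by_contra hc
        simp only [Bool.not_eq_false] at hc
        simp only [extp, hc, if_true] at hv
        omega
      have hw' : w ∈ (0, q) :: L1 := by simp [hw]
      rw [hL2e] at hw'
      rcases List.mem_append.1 hw' with hw' | hw'
      · obtain ⟨v, j, a, hj, -, hv, -⟩ := hL2 w hw'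
        simp [entp, hρw] at hv
        omega
      · simp at hw'; subst hw'; simp [hr] at hρw
    have hs1 : side (t.length, r') = if h r < h r' then 1 else 0 := by
      obtain ⟨L1, hL1e, hL1⟩ := hL.start
      obtain ⟨L2, rfl, hL2⟩ := hL.ending
      rw [hside]
      simp only [List.map_append, List.sum_append, List.map_cons, List.map_nil, List.sum_cons,
        List.sum_nil, add_zero]
      rw [List.sum_eq_zero, zero_add]
      · simp
      intro v hv
      obtain ⟨w, hw, rfl⟩ := List.mem_map.1 hv
      rw [if_neg]
      rintro ⟨hw0, -⟩
      obtain ⟨v, j, a, hj, -, hv, -⟩ := hL2 w hw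
      have hjlt := (List.getElem?_eq_some_iff.1 hj).1
      have hρw : ρ w.2 = false := by
        by_contra hc
        simp only [Bool.not_eq_false] at hc
        simp only [entp, hc, if_true] at hv
        omega
      have hw' : w ∈ L2 ++ [(t.length, r)] := by simp [hw]
      rw [hL1e] at hw'
      rcases List.mem_cons.1 hw' with hw' | hw'
      · subst hw'; simp [hq] at hρw
      · obtain ⟨v, j, a, hj, -, -, hv⟩ := hL1 w hw'
        have hjlt := (List.getElem?_eq_some_iff.1 hj).1
        simp [extp, hρw] at hv
        omega
    rw [hs0, hs1] at hfin
    by_contra hcon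
    rw [if_neg (by omega)] at hfin
    exact absurd hfin (by decide)

end Mono
end Planar2DFT

namespace Planar2DFT
open Relation

section Cross
variable {Q : Type} {ρ : Q → Bool} {f f' g : Set (Q × Q)}

theorem glue_dead0 {y z : Q × Fin 3} (hy : y.2 = 0) (hρ : ρ y.1 = false) :
    ¬ GlueEdge ρ f g y z := by
  rw [glueEdge_iff]
  rintro (⟨-, h, -⟩ | ⟨-, h, -⟩) <;> rw [hy] at h <;> simp [hρ] at h

theorem first_cross {q r : Q} (hq : ρ q = true) (hr : ρ r = true) (h : (q, r) ∈ glue ρ f g) :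
    ∃ z, ρ z = true ∧ (q, z) ∈ f ∧ ReflTransGen (GlueEdge ρ f g) (z, 1) (r, 2) := by
  simp only [glue, Set.mem_ofPred_eq, hq, hr, if_true] at h
  rcases ReflTransGen.cases_head h with h | ⟨⟨z, l⟩, h1, h2⟩
  · simp at h
  · have h1' := h1
    rw [glueEdge_iff] at h1
    rcases h1 with ⟨hf, -, hl⟩ | ⟨-, hl, -⟩
    · cases hz : ρ z
      · simp only [hz] at hl
        rcases ReflTransGen.cases_head h2 with h | ⟨_, h1, -⟩
        · simp at h; simp [h.1, hr] at hz
        · exact absurd h1 (glue_dead0 hl hz)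
      · simp only [hz, if_true] at hl
        subst hl
        exact ⟨z, hz, hf, h2⟩
    · simp [hq] at hl

theorem last_cross {q r : Q} (hq : ρ q = true) (hr : ρ r = true) (h : (q, r) ∈ glue ρ f g) :
    ∃ y, ρ y = true ∧ (y, r) ∈ g := by
  simp only [glue, Set.mem_ofPred_eq, hq, hr, if_true] at h
  rcases ReflTransGen.cases_tail h with h | ⟨⟨z, l⟩, h1, h2⟩
  · simp at h
  · rw [glueEdge_iff] at h2
    rcases h2 with ⟨-, -, hl⟩ | ⟨hg, hl, -⟩
    · simp [hr] at hl
    · cases hz : ρ z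
      · simp only [hz] at hl
        rcases ReflTransGen.cases_tail h1 with h | ⟨_, -, h1⟩
        · simp at h; simp [h.1, hq] at hz
        · rw [glueEdge_iff] at h1
          rcases h1 with ⟨-, -, h⟩ | ⟨-, -, h⟩ <;> simp [hl, hz] at h
      · exact ⟨z, hz, hg⟩

theorem glue_transfer (H : ∀ a b, ρ a = false → ρ b = true → (a, b) ∈ f → (a, b) ∈ f')
    {x : Q × Fin 3} {r : Q} (hx : x.2 ≠ 0)
    (h : ReflTransGen (GlueEdge ρ f g) x (r, 2)) : ReflTransGen (GlueEdge ρ f' g) x (r, 2) := by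
  induction h using ReflTransGen.head_induction_on with
  | refl => exact .refl
  | @head x y h1 h2 ih =>
    have hy : y.2 ≠ 0 := by
      intro hy
      have hρ : ρ y.1 = false := by
        rw [glueEdge_iff] at h1
        rcases h1 with ⟨-, -, h⟩ | ⟨-, -, h⟩ <;> rw [hy] at h <;>
          cases hh : ρ y.1 <;> first | rfl | (rw [hh] at h; simp at h)
      rcases ReflTransGen.cases_head h2 with h | ⟨_, h1, -⟩
      · rw [h] at hy; simp at hy
      · exact absurd h1 (glue_dead0 hy hρ)
    refine .head ?_ (ih hy)
    rw [glueEdge_iff] at h1 ⊢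
    rcases h1 with ⟨h, e1, e2⟩ | h
    · left
      refine ⟨H _ _ ?_ ?_ h, e1, e2⟩
      · cases hh : ρ x.1 <;> simp_all
      · cases hh : ρ y.1 <;> simp_all
    · right; exact h

end Cross

section Mirror
variable {Q C : Type} {ρ : Q → Bool} {R : C → Set (Q × Q)}

theorem St.mirror {t : List C} {x y : ℕ × Q} (h : St ρ R t x y) :
    St (fun q => !ρ q) R t.reverse (t.length - x.1, x.2) (t.length - y.1, y.2) := by
  obtain ⟨j, a, hj, hR, hx, hy⟩ := h
  have hlt := (List.getElem?_eq_some_iff.1 hj).1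
  refine ⟨t.length - 1 - j, a, ?_, hR, ?_, ?_⟩
  · rw [List.getElem?_reverse (by omega), ← hj]; congr 1; omega
  · simp only [hx, entp]; rcases Bool.eq_false_or_eq_true (ρ x.2) with hh | hh <;> simp [hh] <;> omega
  · simp only [hy, extp]; rcases Bool.eq_false_or_eq_true (ρ y.2) with hh | hh <;> simp [hh] <;> omega

theorem beh_mirror_le (t : List C) :
    beh ρ R t ⊆ beh (fun q => !ρ q) R t.reverse := by
  rintro ⟨q, r⟩ h
  simp only [beh, Set.mem_ofPred_eq] at h ⊢
  have : ∀ x y, Rch ρ R t x y → Rch (fun q => !ρ q) R t.reverse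
      (t.length - x.1, x.2) (t.length - y.1, y.2) := by
    intro x y h
    induction h with
    | refl => exact .refl
    | tail _ h ih => exact ih.tail h.mirror
  have := this _ _ h
  convert this using 2
  · dsimp only; rcases Bool.eq_false_or_eq_true (ρ q) with hh | hh <;> simp [hh]
  · dsimp only; rcases Bool.eq_false_or_eq_true (ρ r) with hh | hh <;> simp [hh]

theorem beh_mirror (t : List C) :
    beh (fun q => !ρ q) R t.reverse = beh ρ R t := by
  refine Set.Subset.antisymm ?_ (beh_mirror_le t)
  have := beh_mirror_le (ρ := fun q => !ρ q) (R := R) t.reverse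
  simpa using this

end Mirror

section Stab
variable {Q C : Type} {ρ : Q → Bool} {R : C → Set (Q × Q)}

/-- `n`-fold repetition of a word. -/
def rep (n : ℕ) (w : List C) : List C := (List.replicate n w).flatten

theorem rep_add (m n : ℕ) (w : List C) : rep (m + n) w = rep m w ++ rep n w := by
  rw [rep, List.replicate_add, List.flatten_append]; rfl

theorem mem_rep {n : ℕ} {w : List C} {a : C} (h : a ∈ rep n w) : a ∈ w := by
  simp only [rep, List.mem_flatten, List.mem_replicate] at h
  obtain ⟨l, ⟨-, rfl⟩, h⟩ := h
  exact h

theorem rep_reverse (n : ℕ) (w : List C) : (rep n w).reverse = rep n w.reverse := by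
  simp [rep, List.reverse_flatten]

/-- Behaviour of the `n`-th power of `w`. -/
def bp (ρ : Q → Bool) (R : C → Set (Q × Q)) (w : List C) (n : ℕ) : Set (Q × Q) :=
  beh ρ R (rep n w)

theorem bp_add (w : List C) (m n : ℕ) : bp ρ R w (m + n) = glue ρ (bp ρ R w m) (bp ρ R w n) := by
  rw [bp, rep_add, beh_append]; rfl

theorem bp_mirror (w : List C) (n : ℕ) : bp (fun q => !ρ q) R w.reverse n = bp ρ R w n := by
  rw [bp, ← rep_reverse, beh_mirror]; rfl

theorem bp_periodic [Finite Q] (ρ : Q → Bool) (R : C → Set (Q × Q)) (w : List C) :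
    ∃ N p, 0 < p ∧ ∀ n, N ≤ n → bp ρ R w (n + p) = bp ρ R w n := by
  obtain ⟨i, j, hij, h⟩ := Finite.exists_ne_map_eq_of_infinite (bp ρ R w)
  wlog hlt : i < j generalizing i j
  · exact this j i hij.symm h.symm (by omega)
  refine ⟨i, j - i, by omega, fun n hn => ?_⟩
  obtain ⟨k, rfl⟩ := Nat.exists_eq_add_of_le hn
  have : i + k + (j - i) = j + k := by omega
  rw [this, bp_add, bp_add, h]

theorem bp_ur {w : List C} {n i : ℕ} {a b : Q} (ha : ρ a = false) (hb : ρ b = true)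
    (h : (a, b) ∈ bp ρ R w n) : (a, b) ∈ bp ρ R w (n + i) := by
  rw [Nat.add_comm, bp, rep_add]
  simp only [bp, beh, Set.mem_ofPred_eq, ha, hb, if_true] at h ⊢
  have := Rch.append_right (rep i w) h
  simpa using this

theorem bp_ul {w : List C} {n i : ℕ} {a b : Q} (ha : ρ a = true) (hb : ρ b = false)
    (h : (a, b) ∈ bp ρ R w n) : (a, b) ∈ bp ρ R w (n + i) := by
  rw [bp, rep_add]
  simp only [bp, beh, Set.mem_ofPred_eq, ha, hb, if_true] at h ⊢
  have := Rch.append_left (rep i w) h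
  simpa using this

theorem bp_per_mul {w : List C} {N p : ℕ} (hper : ∀ n, N ≤ n → bp ρ R w (n + p) = bp ρ R w n)
    {n : ℕ} (hn : N ≤ n) (i : ℕ) : bp ρ R w (n + i * p) = bp ρ R w n := by
  induction i with
  | zero => simp
  | succ i ih =>
    rw [Nat.add_mul, one_mul, ← Nat.add_assoc, hper _ (by omega), ih]

theorem bp_pp {h : Q → ℕ} (hinj : Function.Injective h) {w : List C}
    (hd : ∀ a ∈ w, IsDet (R a)) (hpl : ∀ a ∈ w, HPlanar ρ h (R a))
    {N p : ℕ} (hp : 0 < p) (hper : ∀ n, N ≤ n → bp ρ R w (n + p) = bp ρ R w n)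
    {k : ℕ} (hk : N ≤ k) {q r : Q} (hq : ρ q = true) (hr : ρ r = true)
    (hqr : (q, r) ∈ bp ρ R w k) : (q, r) ∈ bp ρ R w (k + 1) := by
  have hdet : ∀ n, IsDet (bp ρ R w n) := fun n => beh_det (fun a ha => hd a (mem_rep ha))
  have hmono : ∀ n {q r q' r' : Q}, ρ q = true → ρ r = true → ρ q' = true → ρ r' = true →
      (q, r) ∈ bp ρ R w n → (q', r') ∈ bp ρ R w n → h q < h q' → h r ≤ h r' :=
    fun n => mono_trav hinj (fun a ha => hd a (mem_rep ha)) (fun a ha => hpl a (mem_rep ha))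
  have hex : ∀ i, ∃ r', ρ r' = true ∧ (q, r') ∈ bp ρ R w (k + i) := by
    intro i
    have h1 : (q, r) ∈ bp ρ R w ((k + i) + (i * p - i)) := by
      have : k + i + (i * p - i) = k + i * p := by
        have := Nat.le_mul_of_pos_right i hp; omega
      rw [this, bp_per_mul hper hk]; exact hqr
    rw [bp_add] at h1
    obtain ⟨z, hz, hz1, -⟩ := first_cross hq hr h1
    exact ⟨z, hz, hz1⟩
  choose s hs hqs using hex
  have hs0 : s 0 = r := hdet k _ _ _ (hqs 0) hqr
  have hU : ∀ i a b, ρ a = false → ρ b = true → (a, b) ∈ bp ρ R w (k + i) →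
      (a, b) ∈ bp ρ R w k := by
    intro i a b ha hb hab
    have := bp_ur (i := i * p - i) ha hb hab
    have e : k + i + (i * p - i) = k + i * p := by
      have := Nat.le_mul_of_pos_right i hp; omega
    rwa [e, bp_per_mul hper hk] at this
  have hS : ∀ i y, ρ y = true → (y, s i) ∈ bp ρ R w k → (y, s (i + 1)) ∈ bp ρ R w (k + 1) := by
    intro i y hy hys
    have h1 := hqs (i + 1)
    rw [← Nat.add_assoc, bp_add] at h1
    obtain ⟨z, hz, hz1, hz2⟩ := first_cross hq (hs _) h1
    obtain rfl := hdet _ _ _ _ hz1 (hqs i)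
    have h2 := glue_transfer (hU i) (by simp) hz2
    rw [bp_add]
    simp only [glue, Set.mem_ofPred_eq, hy, hs, if_true]
    refine .head ?_ h2
    rw [glueEdge_iff]
    left
    exact ⟨hys, by simp [hy], by simp [hs]⟩
  have hY : ∀ i, ∃ y, ρ y = true ∧ (y, s i) ∈ bp ρ R w k := by
    intro i
    have h1 := hqs i
    rw [Nat.add_comm, bp_add] at h1
    exact last_cross hq (hs _) h1
  have hM : ∀ i j, h (s i) ≤ h (s j) → h (s (i + 1)) ≤ h (s (j + 1)) := by
    intro i j hij
    obtain ⟨yi, hyi, hyi'⟩ := hY i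
    obtain ⟨yj, hyj, hyj'⟩ := hY j
    by_cases heq : s i = s j
    · have h1 := hS i yi hyi hyi'
      have h2 := hS j yi hyi (heq ▸ hyi')
      rw [hdet _ _ _ _ h1 h2]
    · rcases lt_trichotomy (h yi) (h yj) with hlt | he | hlt
      · exact hmono _ hyi (hs _) hyj (hs _) (hS i yi hyi hyi') (hS j yj hyj hyj') hlt
      · obtain rfl := hinj he
        exact absurd (hdet _ _ _ _ hyi' hyj') heq
      · have := hmono _ hyj (hs _) hyi (hs _) hyj' hyi' hlt
        exact absurd (hinj (le_antisymm hij this)) heq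
  have hP : s p = s 0 := by
    have h1 := hqs p
    rw [hper _ hk] at h1
    exact hdet _ _ _ _ h1 (hqs 0)
  have key : s 1 = s 0 := by
    apply hinj
    rcases le_total (h (s 0)) (h (s 1)) with hle | hle
    · have h1 : ∀ i, h (s i) ≤ h (s (i + 1)) := by
        intro i
        induction i with
        | zero => exact hle
        | succ i ih => exact hM _ _ ih
      have h2 : h (s (Nat.succ 0)) ≤ h (s p) :=
        monotone_nat_of_le_succ (f := fun i => h (s i)) h1 hp
      rw [Nat.succ_eq_add_one, zero_add, hP] at h2
      omega
    · have h1 : ∀ i, h (s (i + 1)) ≤ h (s i) := by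
        intro i
        induction i with
        | zero => exact hle
        | succ i ih => exact hM _ _ ih
      have h2 : h (s p) ≤ h (s (Nat.succ 0)) :=
        antitone_nat_of_succ_le (f := fun i => h (s i)) h1 hp
      rw [Nat.succ_eq_add_one, zero_add, hP] at h2
      omega
  have := hqs 1
  rwa [key, hs0] at this

theorem bp_stable [Finite Q] {h : Q → ℕ} (hinj : Function.Injective h) {w : List C}
    (hd : ∀ a ∈ w, IsDet (R a)) (hpl : ∀ a ∈ w, HPlanar ρ h (R a)) :
    ∃ N, ∀ k, N ≤ k → bp ρ R w (k + 1) = bp ρ R w k := by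
  obtain ⟨N, p, hp, hper⟩ := bp_periodic ρ R w
  have hsub : ∀ k, N ≤ k → bp ρ R w k ⊆ bp ρ R w (k + 1) := by
    rintro k hk ⟨q, r⟩ hqr
    cases hq : ρ q <;> cases hr : ρ r
    · have := bp_pp (ρ := fun q => !ρ q) (R := R) (w := w.reverse) hinj
        (fun a ha => hd a (by simpa using ha))
        (fun a ha => hplanar_mirror (hpl a (by simpa using ha))) (N := N) hp
        (by simpa only [bp_mirror] using hper) hk (q := q) (r := r) (by simp [hq]) (by simp [hr])
        (by rwa [bp_mirror])
      rwa [bp_mirror] at this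
    · exact bp_ur hq hr hqr
    · exact bp_ul hq hr hqr
    · exact bp_pp hinj hd hpl hp hper hk hq hr hqr
  refine ⟨N, fun k hk => Set.Subset.antisymm ?_ (hsub k hk)⟩
  have hch : ∀ i, bp ρ R w (k + 1) ⊆ bp ρ R w (k + 1 + i) := by
    intro i
    induction i with
    | zero => exact subset_rfl
    | succ i ih => exact ih.trans (hsub _ (by omega))
  have := hch (p - 1)
  rwa [show k + 1 + (p - 1) = k + p by omega, hper k hk] at this

end Stab

theorem inBehav_word {Q A B : Type} {T : TwoWayTransducer Q A B} {f : Set (Q × Q)}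
    (h : InBehav T f) : ∃ w : List A, f = beh T.ρ T.rel (w.map Tape.sym) := by
  induction h with
  | one => exact ⟨[], by simp [beh_nil]⟩
  | gen a => exact ⟨[a], by simp [beh_single]⟩
  | mul _ _ ih1 ih2 =>
    obtain ⟨w1, rfl⟩ := ih1
    obtain ⟨w2, rfl⟩ := ih2
    exact ⟨w1 ++ w2, by simp [beh_append]⟩

theorem planar_det_ap {n : ℕ} {A B : Type} (T : TwoWayTransducer (Fin n) A B)
    (hp : T.Planar) (hd : T.Deterministic) : ApBehav T := by
  obtain ⟨lt, hlt, hpl⟩ := hp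
  obtain ⟨h, hinj, hh⟩ := exists_height lt hlt
  have hpl' : ∀ a : A, HPlanar T.ρ h (T.rel (Tape.sym a)) := by
    intro a
    have := hpl a
    have e : lt = fun a b => h a < h b := by
      funext a b; exact propext (hh a b)
    rwa [e] at this
  have H : ∀ f, ∃ N, InBehav T f → ∀ k, N ≤ k → glpow T.ρ f (k + 1) = glpow T.ρ f k := by
    intro f
    by_cases hf : InBehav T f
    · obtain ⟨w, rfl⟩ := inBehav_word hf
      obtain ⟨N, hN⟩ := bp_stable (ρ := T.ρ) (R := T.rel) (w := w.map Tape.sym) hinj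
        (fun a _ => hd a) (by
          intro a ha
          obtain ⟨b, -, rfl⟩ := List.mem_map.1 ha
          exact hpl' b)
      refine ⟨N, fun _ k hk => ?_⟩
      rw [← beh_replicate, ← beh_replicate]
      exact hN k hk
    · exact ⟨0, fun h => absurd h hf⟩
  choose N hN using H
  obtain ⟨M, hM⟩ := (Set.finite_range N).bddAbove
  exact ⟨M, fun f hf => hN f hf M (hM ⟨f, rfl⟩)⟩

end Planar2DFT

namespace Planar2DFT
open Relation

section LRuns
variable {α B : Type}

/-- Labelled runs, built from the front. -/
inductive LRun (r : α → List B → α → Prop) : α → List B → α → Prop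
  | refl (x : α) : LRun r x [] x
  | head {x y z u v} : r x u y → LRun r y v z → LRun r x (u ++ v) z

/-- Labelled runs, built from the back. -/
inductive LRunT (r : α → List B → α → Prop) : α → List B → α → Prop
  | refl (x : α) : LRunT r x [] x
  | tail {x y z u v} : LRunT r x u y → r y v z → LRunT r x (u ++ v) z

variable {r : α → List B → α → Prop}

theorem LRun.trans {x y z : α} {u v : List B} (h1 : LRun r x u y) (h2 : LRun r y v z) :
    LRun r x (u ++ v) z := by
  induction h1 with
  | refl => exact h2
  | head h _ ih => rw [List.append_assoc]; exact .head h (ih h2)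

theorem LRun.single {x y : α} {u : List B} (h : r x u y) : LRun r x u y := by
  simpa using LRun.head h (.refl y)

theorem LRunT.trans {x y z : α} {u v : List B} (h1 : LRunT r x u y) (h2 : LRunT r y v z) :
    LRunT r x (u ++ v) z := by
  induction h2 with
  | refl => simpa using h1
  | tail _ h ih => rw [← List.append_assoc]; exact .tail ih h

theorem LRunT.single {x y : α} {u : List B} (h : r x u y) : LRunT r x u y := by
  simpa using LRunT.tail (.refl x) h

theorem lrun_iff {x y : α} {u : List B} : LRun r x u y ↔ LRunT r x u y := by
  constructor
  · intro h
    induction h with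
    | refl => exact .refl _
    | head h _ ih => exact (LRunT.single h).trans ih
  · intro h
    induction h with
    | refl => exact .refl _
    | tail _ h ih => exact ih.trans (LRun.single h)

theorem LRun.cases_tail {x z : α} {u : List B} (h : LRun r x u z) :
    (x = z ∧ u = []) ∨ ∃ y v w, LRun r x v y ∧ r y w z ∧ u = v ++ w := by
  rw [lrun_iff] at h
  cases h with
  | refl => exact .inl ⟨rfl, rfl⟩
  | tail h h' => exact .inr ⟨_, _, _, lrun_iff.2 h, h', rfl⟩

theorem LRun.cases_head {x z : α} {u : List B} (h : LRun r x u z) :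
    (x = z ∧ u = []) ∨ ∃ y v w, r x v y ∧ LRun r y w z ∧ u = v ++ w := by
  cases h with
  | refl => exact .inl ⟨rfl, rfl⟩
  | head h h' => exact .inr ⟨_, _, _, h, h', rfl⟩

end LRuns

section Raw

/-- Labelled position-based step; `E` is the type of labels. -/
def OSt {Q C E : Type} (ρ : Q → Bool) (δ : C → Set (Q × E × Q)) (t : List C)
    (x : ℕ × Q) (w : E) (y : ℕ × Q) : Prop :=
  ∃ j a, t[j]? = some a ∧ (x.2, w, y.2) ∈ δ a ∧ x.1 = entp ρ j x.2 ∧ y.1 = extp ρ j y.2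

/-- Raw two-way transducers. -/
structure RM (Q C B : Type) where
  ρ : Q → Bool
  init : Q
  init_fwd : ρ init = true
  fin : Set Q
  δ : C → Set (Q × List B × Q)

/-- Underlying relation. -/
def RM.rel {Q C B : Type} (M : RM Q C B) (a : C) : Set (Q × Q) :=
  {p | ∃ w, (p.1, w, p.2) ∈ M.δ a}

/-- Realization. -/
def RM.Real {Q C B : Type} (M : RM Q C B) (t : List C) (o : List B) : Prop :=
  ∃ qf ∈ M.fin, LRun (OSt M.ρ M.δ t) (0, M.init) o (t.length, qf)

/-- Kinds of letters. -/
inductive Kd | L | M | R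

/-- Valid tapes. -/
def Valid {C : Type} (κ : C → Kd) (w : List C) : Prop :=
  ∃ l m r, w = l :: (m ++ [r]) ∧ κ l = Kd.L ∧ (∀ c ∈ m, κ c = Kd.M) ∧ κ r = Kd.R

/-- Relations realized by planar reversible raw machines on valid tapes. -/
def PR {C B : Type} (κ : C → Kd) (h : List C → List B → Prop) : Prop :=
  ∃ (Q : Type) (_ : Finite Q) (M : RM Q C B) (ht : Q → ℕ), Function.Injective ht ∧
    (∀ c, IsRev (M.rel c)) ∧ (∀ c, κ c = Kd.M → HPlanar M.ρ ht (M.rel c)) ∧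
    ∀ w, Valid κ w → ∀ o, M.Real w o ↔ h w o

/-- Precomposition by `g` preserves planar reversible realizability. -/
def Good {C C' : Type} (B : Type) (κ : C → Kd) (κ' : C' → Kd) (g : List C → List C') : Prop :=
  (∀ w, Valid κ w → Valid κ' (g w)) ∧
    ∀ h : List C' → List B → Prop, PR κ' h → PR κ (fun w => h (g w))

theorem Good.comp {C C' C'' B : Type} {κ : C → Kd} {κ' : C' → Kd} {κ'' : C'' → Kd}
    {g : List C → List C'} {g' : List C' → List C''} (h1 : Good B κ κ' g) (h2 : Good B κ' κ'' g') :
    Good B κ κ'' (fun w => g' (g w)) :=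
  ⟨fun w hw => h2.1 _ (h1.1 w hw), fun h hh => h1.2 _ (h2.2 h hh)⟩

theorem PR.congr {C B : Type} {κ : C → Kd} {h h' : List C → List B → Prop}
    (H : ∀ w, Valid κ w → ∀ o, h w o ↔ h' w o) (hp : PR κ h) : PR κ h' := by
  obtain ⟨Q, hQ, M, ht, h1, h2, h3, h4⟩ := hp
  exact ⟨Q, hQ, M, ht, h1, h2, h3, fun w hw o => (h4 w hw o).trans (H w hw o)⟩

theorem Good.congr {C C' B : Type} {κ : C → Kd} {κ' : C' → Kd} {g g' : List C → List C'}
    (H : ∀ w, Valid κ w → g w = g' w) (h1 : Good B κ κ' g) : Good B κ κ' g' :=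
  ⟨fun w hw => H w hw ▸ h1.1 w hw, fun h hh =>
    (h1.2 h hh).congr (fun w hw o => by rw [H w hw])⟩

theorem valid_map {C C' : Type} {κ : C → Kd} {κ' : C' → Kd} {φ : C → C'}
    (hφ : ∀ c, κ' (φ c) = κ c) {w : List C} (h : Valid κ w) : Valid κ' (w.map φ) := by
  obtain ⟨l, m, r, rfl, h1, h2, h3⟩ := h
  refine ⟨φ l, m.map φ, φ r, by simp, by rw [hφ, h1], ?_, by rw [hφ, h3]⟩
  intro c hc
  obtain ⟨d, hd, rfl⟩ := List.mem_map.1 hc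
  rw [hφ, h2 d hd]

theorem good_relabel {C C' B : Type} {κ : C → Kd} {κ' : C' → Kd} (φ : C → C')
    (hφ : ∀ c, κ' (φ c) = κ c) : Good B κ κ' (List.map φ) := by
  refine ⟨fun w hw => valid_map hφ hw, ?_⟩
  rintro h ⟨Q, hQ, M, ht, h1, h2, h3, h4⟩
  refine ⟨Q, hQ, ⟨M.ρ, M.init, M.init_fwd, M.fin, fun c => M.δ (φ c)⟩, ht, h1,
    fun c => h2 (φ c), fun c hc => h3 (φ c) (by rw [hφ, hc]), fun w hw o => ?_⟩
  refine Iff.trans ?_ (h4 _ (valid_map hφ hw) o)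
  have : OSt M.ρ (fun c => M.δ (φ c)) w = OSt M.ρ M.δ (w.map φ) := by
    funext x e y
    apply propext
    constructor
    · rintro ⟨j, a, hj, hh⟩
      exact ⟨j, φ a, by simp [hj], hh⟩
    · rintro ⟨j, a, hj, hh⟩
      simp only [List.getElem?_map, Option.map_eq_some_iff] at hj
      obtain ⟨b, hb, rfl⟩ := hj
      exact ⟨j, b, hb, hh⟩
  unfold RM.Real
  rw [← this]
  simp

theorem OSt.not_end {Q C E : Type} {ρ : Q → Bool} {δ : C → Set (Q × E × Q)} {t : List C} {q : Q}
    (hq : ρ q = true) {e : E} {y : ℕ × Q} : ¬ OSt ρ δ t (t.length, q) e y := by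
  rintro ⟨j, a, hj, -, hx, -⟩
  have := (List.getElem?_eq_some_iff.1 hj).1
  simp [entp, hq] at hx
  omega

theorem OSt.not_init {Q C E : Type} {ρ : Q → Bool} {δ : C → Set (Q × E × Q)} {t : List C} {q : Q}
    (hq : ρ q = true) {e : E} {y : ℕ × Q} : ¬ OSt ρ δ t y e (0, q) := by
  rintro ⟨j, a, hj, -, -, hx⟩
  simp [extp, hq] at hx

theorem OSt.target_end {Q C E : Type} {ρ : Q → Bool} {δ : C → Set (Q × E × Q)} {t : List C}
    {e : E} {x y : ℕ × Q} (h : OSt ρ δ t x e y) (hy : y.1 = t.length) : ρ y.2 = true := by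
  obtain ⟨j, a, hj, -, -, h2⟩ := h
  have := (List.getElem?_eq_some_iff.1 hj).1
  by_contra hc
  simp [extp, hc] at h2
  omega

end Raw

section Compose
variable {P S C C' B : Type}

/-- Extension of a transition table to silent letters. -/
def hat (δ : C' → Set (S × List B × S)) : Option C' → Set (S × List B × S)
  | none => {x | x.2.1 = [] ∧ x.1 = x.2.2}
  | some l => δ l

/-- Direction in the product. -/
def pdir (ρg : P → Bool) (ρs : S → Bool) (x : P × S) : Bool := ρg x.1 == ρs x.2

/-- Transition table of the product. -/
def pδ (ρs : S → Bool) (δg : C → Set (P × Option C' × P)) (δs : C' → Set (S × List B × S)) (c : C) :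
    Set ((P × S) × List B × (P × S)) :=
  {x | ∃ p1 e p2, (p1, e, p2) ∈ δg c ∧ (x.1.2, x.2.1, x.2.2.2) ∈ hat δs e ∧
    x.1.1 = (if ρs x.1.2 then p1 else p2) ∧ x.2.2.1 = (if ρs x.2.2.2 then p2 else p1)}

/-- Silent-letter labelled step of the first machine, with list labels. -/
def GSt (ρg : P → Bool) (δg : C → Set (P × Option C' × P)) (t : List C)
    (x : ℕ × P) (l : List C') (y : ℕ × P) : Prop :=
  ∃ e : Option C', l = e.toList ∧ OSt ρg δg t x e y

variable {ρg : P → Bool} {ρs : S → Bool} {δg : C → Set (P × Option C' × P)}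
  {δs : C' → Set (S × List B × S)}

theorem pstep_iff {t : List C} {x y : ℕ × (P × S)} {w : List B} :
    OSt (pdir ρg ρs) (pδ ρs δg δs) t x w y ↔
    ∃ X Y e, OSt ρg δg t X e Y ∧ (x.2.2, w, y.2.2) ∈ hat δs e ∧
      (x.1, x.2.1) = (if ρs x.2.2 then X else Y) ∧ (y.1, y.2.1) = (if ρs y.2.2 then Y else X) := by
  obtain ⟨i, p, s⟩ := x
  obtain ⟨i', p', s'⟩ := y
  constructor
  · rintro ⟨j, a, hj, ⟨p1, e, p2, hg, hs, e1, e2⟩, h1, h2⟩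
    dsimp only at *
    refine ⟨(entp ρg j p1, p1), (extp ρg j p2, p2), e, ⟨j, a, hj, hg, rfl, rfl⟩, hs, ?_, ?_⟩
    · cases h : ρs s <;> simp only [h, Bool.false_eq_true, if_true, if_false] at e1 <;>
        simp [h1, e1, entp, extp, pdir, h]
      cases h' : ρg p2 <;> simp
    · cases h : ρs s' <;> simp only [h, Bool.false_eq_true, if_true, if_false] at e2 <;>
        simp [h2, e2, entp, extp, pdir, h]
      cases h' : ρg p1 <;> simp
  · rintro ⟨⟨X, p1⟩, ⟨Y, p2⟩, e, ⟨j, a, hj, hg, hX, hY⟩, hs, e1, e2⟩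
    dsimp only at *
    refine ⟨j, a, hj, ⟨p1, e, p2, hg, hs, ?_, ?_⟩, ?_, ?_⟩
    · dsimp only; split at e1 <;> simp_all
    · dsimp only; split at e2 <;> simp_all
    · cases h : ρs s <;> simp_all [entp, extp, pdir]
      cases h' : ρg p2 <;> simp
    · cases h : ρs s' <;> simp_all [entp, extp, pdir]
      cases h' : ρg p1 <;> simp

/-- Transition tables that are partial injections with functional labels. -/
def GRev (d : Set (P × Option C' × P)) : Prop :=
  (∀ p e q e' q', (p, e, q) ∈ d → (p, e', q') ∈ d → e = e' ∧ q = q') ∧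
  (∀ p e q e' p', (p, e, q) ∈ d → (p', e', q) ∈ d → e = e' ∧ p = p')

theorem ost_det (hrev : ∀ c, GRev (δg c)) {t : List C} {x y z : ℕ × P} {e e' : Option C'}
    (h1 : OSt ρg δg t x e y) (h2 : OSt ρg δg t x e' z) : e = e' ∧ y = z := by
  obtain ⟨j, a, hj, hR, hx, hy⟩ := h1
  obtain ⟨j', a', hj', hR', hx', hz⟩ := h2
  have : j = j' := by
    rw [hx] at hx'; simp only [entp] at hx'; split at hx' <;> omega
  subst this
  rw [hj] at hj'
  obtain rfl : a = a' := by simpa using hj'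
  have := (hrev a).1 _ _ _ _ _ hR hR'
  refine ⟨this.1, Prod.ext ?_ this.2⟩
  rw [hy, hz, this.2]

theorem ost_codet (hrev : ∀ c, GRev (δg c)) {t : List C} {x y z : ℕ × P} {e e' : Option C'}
    (h1 : OSt ρg δg t y e x) (h2 : OSt ρg δg t z e' x) : e = e' ∧ y = z := by
  obtain ⟨j, a, hj, hR, hy, hx⟩ := h1
  obtain ⟨j', a', hj', hR', hz, hx'⟩ := h2
  have : j = j' := by
    rw [hx] at hx'; simp only [extp] at hx'; split at hx' <;> omega
  subst this
  rw [hj] at hj'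
  obtain rfl : a = a' := by simpa using hj'
  have := (hrev a).2 _ _ _ _ _ hR hR'
  refine ⟨this.1, Prod.ext ?_ this.2⟩
  rw [hy, hz, this.2]

/-- `X` lies on the run, having produced `k` letters. -/
def OnRun (ρg : P → Bool) (δg : C → Set (P × Option C' × P)) (t : List C) (X0 Xn : ℕ × P)
    (W : List C') (X : ℕ × P) (k : ℕ) : Prop :=
  ∃ o1 o2, LRun (GSt ρg δg t) X0 o1 X ∧ LRun (GSt ρg δg t) X o2 Xn ∧ o1 ++ o2 = W ∧ k = o1.length

theorem onRun_step (hrev : ∀ c, GRev (δg c)) {t : List C} {X0 Xn : ℕ × P}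
    (h0 : ρg X0.2 = true) (h0' : X0.1 = 0) (hn : ρg Xn.2 = true) (hn' : Xn.1 = t.length)
    {W : List C'} {x y : ℕ × (P × S)} {w : List B} {k : ℕ}
    (hx : OnRun ρg δg t X0 Xn W (x.1, x.2.1) k)
    (hst : OSt (pdir ρg ρs) (pδ ρs δg δs) t x w y) :
    ∃ k', OnRun ρg δg t X0 Xn W (y.1, y.2.1) k' ∧
      LRun (OSt ρs δs W) (k, x.2.2) w (k', y.2.2) := by
  rw [pstep_iff] at hst
  obtain ⟨X, Y, e, hXY, hs, e1, e2⟩ := hst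
  obtain ⟨o1, o2, r1, r2, hW, rfl⟩ := hx
  obtain ⟨i, p, s⟩ := x
  obtain ⟨i', p', s'⟩ := y
  dsimp only at *
  have key : ∃ a b, LRun (GSt ρg δg t) X0 a X ∧ LRun (GSt ρg δg t) Y b Xn ∧
      a ++ (e.toList ++ b) = W ∧ o1.length = if ρs s then a.length else (a ++ e.toList).length := by
    cases h : ρs s
    · rw [h] at e1
      simp only [Bool.false_eq_true, if_false] at e1 ⊢
      rw [e1] at r1 r2
      rcases r1.cases_tail with ⟨rfl, -⟩ | ⟨Z, u, v, hu, ⟨e', rfl, hv⟩, rfl⟩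
      · obtain ⟨a, b⟩ := X0; dsimp only at *; subst h0'
        exact absurd hXY (OSt.not_init h0)
      · obtain ⟨rfl, rfl⟩ := ost_codet hrev hXY hv
        exact ⟨u, o2, hu, r2, by simpa using hW, by simp⟩
    · rw [h] at e1
      simp only [if_true] at e1 ⊢
      rw [e1] at r1 r2
      rcases r2.cases_head with ⟨rfl, -⟩ | ⟨Z, u, v, ⟨e', rfl, hv⟩, hu, rfl⟩
      · obtain ⟨a, b⟩ := X; dsimp only at *; subst hn'
        exact absurd hXY (OSt.not_end hn)
      · obtain ⟨rfl, rfl⟩ := ost_det hrev hXY hv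
        exact ⟨o1, v, r1, hu, hW, rfl⟩
  obtain ⟨a, b, ha, hb, hab, hk⟩ := key
  have hg : GSt ρg δg t X e.toList Y := ⟨e, rfl, hXY⟩
  refine ⟨if ρs s' then (a ++ e.toList).length else a.length, ?_, ?_⟩
  · rw [e2]
    split
    · exact ⟨a ++ e.toList, b, ha.trans (.single hg), hb, by simpa using hab, rfl⟩
    · exact ⟨a, e.toList ++ b, ha, (LRun.single hg).trans hb, hab, rfl⟩
  · rw [hk]
    cases e with
    | none =>
      obtain ⟨h1, h2⟩ := hs
      dsimp only at h1 h2
      subst h1 h2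
      simp only [Option.toList_none, List.append_nil]
      exact .refl _
    | some l =>
      refine .single ⟨a.length, l, ?_, hs, ?_, ?_⟩
      · rw [← hab]; simp
      · dsimp only; rw [entp]; simp
      · dsimp only; rw [extp]; simp

theorem onRun_run (hrev : ∀ c, GRev (δg c)) {t : List C} {X0 Xn : ℕ × P}
    (h0 : ρg X0.2 = true) (h0' : X0.1 = 0) (hn : ρg Xn.2 = true) (hn' : Xn.1 = t.length)
    {W : List C'} {x y : ℕ × (P × S)} {w : List B}
    (hr : LRun (OSt (pdir ρg ρs) (pδ ρs δg δs) t) x w y) : ∀ k,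
    OnRun ρg δg t X0 Xn W (x.1, x.2.1) k →
    ∃ k', OnRun ρg δg t X0 Xn W (y.1, y.2.1) k' ∧
      LRun (OSt ρs δs W) (k, x.2.2) w (k', y.2.2) := by
  induction hr with
  | refl => intro k hk; exact ⟨k, hk, .refl _⟩
  | head hst _ ih =>
    intro k hk
    obtain ⟨k', h1, h2⟩ := onRun_step hrev h0 h0' hn hn' hk hst
    obtain ⟨k'', h3, h4⟩ := ih k' h1
    exact ⟨k'', h3, h2.trans h4⟩

theorem silent_fwd {t : List C} {X Y : ℕ × P} {s : S} (hs : ρs s = true)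
    (h : OSt ρg δg t X none Y) :
    OSt (pdir ρg ρs) (pδ ρs δg δs) t (X.1, X.2, s) [] (Y.1, Y.2, s) := by
  rw [pstep_iff]
  exact ⟨X, Y, none, h, ⟨rfl, rfl⟩, by simp [hs], by simp [hs]⟩

theorem silent_bwd {t : List C} {X Y : ℕ × P} {s : S} (hs : ρs s = false)
    (h : OSt ρg δg t X none Y) :
    OSt (pdir ρg ρs) (pδ ρs δg δs) t (Y.1, Y.2, s) [] (X.1, X.2, s) := by
  rw [pstep_iff]
  exact ⟨X, Y, none, h, ⟨rfl, rfl⟩, by simp [hs], by simp [hs]⟩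

theorem seek_fwd {t : List C} {X Xn : ℕ × P} {o : List C'} {s : S} (hs : ρs s = true)
    (h : LRun (GSt ρg δg t) X o Xn) : ∀ l o', o = l :: o' →
    ∃ X' Y, LRun (OSt (pdir ρg ρs) (pδ ρs δg δs) t) (X.1, X.2, s) [] (X'.1, X'.2, s) ∧
      LRun (GSt ρg δg t) X [] X' ∧ OSt ρg δg t X' (some l) Y ∧ LRun (GSt ρg δg t) Y o' Xn := by
  induction h with
  | refl => intro l o' h; cases h
  | @head X Y Z u v hg hr ih =>
    intro l o' ho
    obtain ⟨e, rfl, he⟩ := hg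
    cases e with
    | none =>
      obtain ⟨X', Y', h1, h2, h3, h4⟩ := ih l o' (by simpa using ho)
      exact ⟨X', Y', by simpa using (LRun.single (silent_fwd hs he)).trans h1,
        by simpa using (LRun.single (r := GSt ρg δg t) ⟨none, rfl, he⟩).trans h2, h3, h4⟩
    | some l' =>
      simp only [Option.toList_some, List.cons_append, List.nil_append, List.cons.injEq] at ho
      obtain ⟨rfl, rfl⟩ := ho
      exact ⟨X, Y, .refl _, .refl _, he, hr⟩

theorem seek_bwd {t : List C} {X X0 : ℕ × P} {o : List C'} {s : S} (hs : ρs s = false)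
    (h : LRunT (GSt ρg δg t) X0 o X) : ∀ l o', o = o' ++ [l] →
    ∃ X' Y, LRun (OSt (pdir ρg ρs) (pδ ρs δg δs) t) (X.1, X.2, s) [] (Y.1, Y.2, s) ∧
      LRun (GSt ρg δg t) Y [] X ∧ OSt ρg δg t X' (some l) Y ∧ LRun (GSt ρg δg t) X0 o' X' := by
  induction h with
  | refl => intro l o' h; simp at h
  | @tail Y Z u v hr hg ih =>
    intro l o' ho
    obtain ⟨e, rfl, he⟩ := hg
    cases e with
    | none =>
      obtain ⟨X', Y', h1, h2, h3, h4⟩ := ih l o' (by simpa using ho)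
      exact ⟨X', Y', by simpa using (LRun.single (silent_bwd hs he)).trans h1,
        by simpa using h2.trans (LRun.single (r := GSt ρg δg t) ⟨none, rfl, he⟩), h3, h4⟩
    | some l' =>
      simp only [Option.toList_some] at ho
      obtain ⟨rfl, h2⟩ := List.append_inj' ho rfl
      simp only [List.cons.injEq, and_true] at h2
      subst h2
      exact ⟨Y, Z, .refl _, .refl _, he, lrun_iff.2 hr⟩

theorem drain_fwd {t : List C} {X Xn : ℕ × P} {o : List C'} {s : S} (hs : ρs s = true)
    (h : LRun (GSt ρg δg t) X o Xn) (ho : o = []) :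
    LRun (OSt (pdir ρg ρs) (pδ ρs δg δs) t) (X.1, X.2, s) [] (Xn.1, Xn.2, s) := by
  induction h with
  | refl => exact .refl _
  | @head X Y Z u v hg hr ih =>
    obtain ⟨e, rfl, he⟩ := hg
    cases e with
    | none => simpa using (LRun.single (silent_fwd hs he)).trans (ih (by simpa using ho))
    | some l' => simp at ho

theorem sim_step {t : List C} {X0 Xn : ℕ × P} {W : List C'} {k k' : ℕ} {s s' : S} {w : List B}
    {X : ℕ × P} (hX : OnRun ρg δg t X0 Xn W X k) (hst : OSt ρs δs W (k, s) w (k', s')) :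
    ∃ Y, OnRun ρg δg t X0 Xn W Y k' ∧
      LRun (OSt (pdir ρg ρs) (pδ ρs δg δs) t) (X.1, X.2, s) w (Y.1, Y.2, s') := by
  obtain ⟨j, l, hj, hd, e1, e2⟩ := hst
  obtain ⟨o1, o2, r1, r2, rfl, rfl⟩ := hX
  dsimp only at *
  have key : ∃ a b X' Y', LRun (GSt ρg δg t) X0 a X' ∧ LRun (GSt ρg δg t) Y' b Xn ∧
      OSt ρg δg t X' (some l) Y' ∧ a ++ [l] ++ b = o1 ++ o2 ∧ a.length = j ∧
      LRun (OSt (pdir ρg ρs) (pδ ρs δg δs) t) (X.1, X.2, s) []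
        (if ρs s then (X'.1, X'.2, s) else (Y'.1, Y'.2, s)) := by
    cases h : ρs s
    · simp only [entp, h, Bool.false_eq_true, if_false] at e1 ⊢
      rw [List.getElem?_append_left (by omega)] at hj
      have ho : o1 = o1.take j ++ [l] := by
        have h1 := List.take_add_one (l := o1) (i := j)
        rw [hj] at h1
        simp only [Option.toList_some] at h1
        rw [← h1, List.take_of_length_le (by omega)]
      obtain ⟨X', Y, h1, h2, h3, h4⟩ := seek_bwd (δs := δs) h (lrun_iff.1 r1) l _ ho
      refine ⟨o1.take j, o2, X', Y, h4, by simpa using h2.trans r2, h3, by rw [← ho], ?_, h1⟩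
      simp; omega
    · simp only [entp, h, if_true] at e1 ⊢
      rw [List.getElem?_append_right (by omega)] at hj
      subst e1
      cases o2 with
      | nil => simp at hj
      | cons l' o' =>
        simp at hj
        subst hj
        obtain ⟨X', Y, h1, h2, h3, h4⟩ := seek_fwd (δs := δs) h r2 _ _ rfl
        exact ⟨o1, o', X', Y, by simpa using r1.trans h2, h4, h3, by simp, rfl, h1⟩
  obtain ⟨a, b, X', Y', ha, hb, hXY, hab, rfl, hrun⟩ := key
  have hg : GSt ρg δg t X' [l] Y' := ⟨some l, rfl, hXY⟩
  refine ⟨if ρs s' then Y' else X', ?_, ?_⟩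
  · rw [e2, extp]
    split
    · exact ⟨a ++ [l], b, ha.trans (.single hg), hb, hab, by simp⟩
    · exact ⟨a, [l] ++ b, ha, (LRun.single hg).trans hb, by simpa using hab, rfl⟩
  · refine LRun.trans hrun (LRun.single ?_)
    rw [pstep_iff]
    refine ⟨X', Y', some l, hXY, ?_, ?_, rfl⟩
    · split <;> exact hd
    · cases h : ρs s <;> simp [h]

theorem sim_run {t : List C} {X0 Xn : ℕ × P} {W : List C'} {x y : ℕ × S} {w : List B}
    (hr : LRun (OSt ρs δs W) x w y) : ∀ X, OnRun ρg δg t X0 Xn W X x.1 →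
    ∃ Y, OnRun ρg δg t X0 Xn W Y y.1 ∧
      LRun (OSt (pdir ρg ρs) (pδ ρs δg δs) t) (X.1, X.2, x.2) w (Y.1, Y.2, y.2) := by
  induction hr with
  | refl => intro X hX; exact ⟨X, hX, .refl _⟩
  | head hst _ ih =>
    intro X hX
    obtain ⟨Y, h1, h2⟩ := sim_step hX hst
    obtain ⟨Z, h3, h4⟩ := ih Y h1
    exact ⟨Z, h3, h2.trans h4⟩

end Compose
end Planar2DFT

namespace Planar2DFT
open Relation

section Geometry

/-- Non-crossing is invariant under cyclic rotation of blocks. -/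
theorem rot_core (N α β : ℤ) (hdis : α < β ∨ β + N ≤ α - N + 1)
    (b1 b2 b3 b4 : Bool) (n1 n2 n3 n4 : ℤ)
    (k1 : 0 ≤ n1 ∧ n1 < N) (k2 : 0 ≤ n2 ∧ n2 < N) (k3 : 0 ≤ n3 ∧ n3 < N) (k4 : 0 ≤ n4 ∧ n4 < N)
    (I V : Bool → ℤ → ℤ) (hI : I = fun b n => if b then β + n else α - n)
    (hV : V = fun b n => if b then n + 1 else -(n + 1))
    (o1 : I b1 n1 < I b2 n2) (o2 : I b2 n2 < I b3 n3) (o3 : I b3 n3 < I b4 n4) :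
    (V b1 n1 < V b2 n2 ∧ V b2 n2 < V b3 n3 ∧ V b3 n3 < V b4 n4) ∨
    (V b2 n2 < V b3 n3 ∧ V b3 n3 < V b4 n4 ∧ V b4 n4 < V b1 n1) ∨
    (V b3 n3 < V b4 n4 ∧ V b4 n4 < V b1 n1 ∧ V b1 n1 < V b2 n2) ∨
    (V b4 n4 < V b1 n1 ∧ V b1 n1 < V b2 n2 ∧ V b2 n2 < V b3 n3) := by
  subst hI hV
  cases b1 <;> cases b2 <;> cases b3 <;> cases b4 <;>
    simp only [Bool.false_eq_true, if_true, if_false] at o1 o2 o3 ⊢ <;> grind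

variable {P S C C' B : Type} {ρg : P → Bool} {ρs : S → Bool} {δg : C → Set (P × Option C' × P)}
  {δs : C' → Set (S × List B × S)}

/-- Height in the product. -/
def pht (ρg : P → Bool) (hg : P → ℕ) (hs : S → ℕ) (N : ℕ) (x : P × S) : ℕ :=
  hg x.1 * N + if ρg x.1 then hs x.2 else N - 1 - hs x.2

theorem pht_block {hg : P → ℕ} {hs : S → ℕ} {N : ℕ} (hN : ∀ s, hs s < N) (x : P × S) :
    hg x.1 * N ≤ pht ρg hg hs N x ∧ pht ρg hg hs N x < hg x.1 * N + N := by
  have := hN x.2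
  unfold pht
  split <;> omega

theorem pht_lt {hg : P → ℕ} {hs : S → ℕ} {N : ℕ} (hN : ∀ s, hs s < N) {x y : P × S}
    (h : hg x.1 < hg y.1) : pht ρg hg hs N x < pht ρg hg hs N y := by
  have h1 := (pht_block (ρg := ρg) (hg := hg) hN x).2
  have h2 := (pht_block (ρg := ρg) (hg := hg) hN y).1
  have h3 : (hg x.1 + 1) * N ≤ hg y.1 * N := Nat.mul_le_mul_right N h
  rw [Nat.add_mul, one_mul] at h3
  omega

theorem pht_inj {hg : P → ℕ} {hs : S → ℕ} {N : ℕ} (hN : ∀ s, hs s < N)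
    (ig : Function.Injective hg) (is : Function.Injective hs) :
    Function.Injective (pht ρg hg hs N) := by
  intro x y hxy
  have h1 : hg x.1 = hg y.1 := by
    rcases lt_trichotomy (hg x.1) (hg y.1) with h | h | h
    · have := pht_lt (ρg := ρg) hN h; omega
    · exact h
    · have := pht_lt (ρg := ρg) hN h; omega
  have h2 := ig h1
  refine Prod.ext h2 (is ?_)
  have := hN x.2
  have := hN y.2
  unfold pht at hxy
  rw [h2] at hxy
  split at hxy <;> omega

theorem block_le {hg : P → ℕ} {hs : S → ℕ} {N : ℕ} (hN : ∀ s, hs s < N)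
    {u v : (P × S) × Bool} (h : vpos (pht ρg hg hs N) u < vpos (pht ρg hg hs N) v) :
    vpos hg (u.1.1, u.2) ≤ vpos hg (v.1.1, v.2) := by
  obtain ⟨x, b⟩ := u
  obtain ⟨y, c⟩ := v
  by_contra hc
  have l1 := pht_lt (ρg := ρg) (hg := hg) (hs := hs) hN (x := x) (y := y)
  have l2 := pht_lt (ρg := ρg) (hg := hg) (hs := hs) hN (x := y) (y := x)
  cases b <;> cases c <;> simp only [vpos, Bool.false_eq_true, if_true, if_false] at h hc
  · have := l1 (by omega); omega
  · omega
  · omega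
  · have := l2 (by omega); omega

theorem vpos_inj {h : P → ℕ} (hi : Function.Injective h) {u v : P × Bool}
    (e : vpos h u = vpos h v) : u = v := by
  obtain ⟨x, b⟩ := u
  obtain ⟨y, c⟩ := v
  cases b <;> cases c <;> simp only [vpos, Bool.false_eq_true, if_true, if_false] at e
  · rw [hi (by omega : h x = h y)]
  · omega
  · omega
  · rw [hi (by omega : h x = h y)]

/-- Embedding of a profile of the second machine over an edge of the first. -/
def emb (ρg : P → Bool) (p1 p2 : P) (x : S × Bool) : (P × S) × Bool :=
  if x.2 then ((p2, x.1), ρg p2) else ((p1, x.1), !ρg p1)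

/-- Underlying relation of a labelled table. -/
def under {E : Type} (d : Set (P × E × P)) : Set (P × P) := {p | ∃ e, (p.1, e, p.2) ∈ d}

theorem uedge_lift {c : C} {u v : (P × S) × Bool}
    (h : UEdge (pdir ρg ρs) (under (pδ ρs δg δs c)) u v) :
    ∃ p1 e p2, (p1, e, p2) ∈ δg c ∧ ∃ x y, UEdge ρs (under (hat δs e)) x y ∧
      u = emb ρg p1 p2 x ∧ v = emb ρg p1 p2 y := by
  have main : ∀ u v, ProfileEdge (pdir ρg ρs) (under (pδ ρs δg δs c)) u v →
    ∃ p1 e p2, (p1, e, p2) ∈ δg c ∧ ∃ x y, ProfileEdge ρs (under (hat δs e)) x y ∧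
      u = emb ρg p1 p2 x ∧ v = emb ρg p1 p2 y := by
    rintro u v ⟨⟨⟨p, s⟩, ⟨p', s'⟩⟩, ⟨w, p1, e, p2, hg, hs, e1, e2⟩, rfl, rfl⟩
    dsimp only at *
    refine ⟨p1, e, p2, hg, (s, !ρs s), (s', ρs s'), ⟨(s, s'), ⟨w, hs⟩, rfl, rfl⟩, ?_, ?_⟩
    · cases h : ρs s <;> simp only [h, Bool.false_eq_true, if_true, if_false] at e1 <;>
        simp [emb, e1, h, pdir]
    · cases h : ρs s' <;> simp only [h, Bool.false_eq_true, if_true, if_false] at e2 <;>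
        simp [emb, e2, h, pdir]
  rcases h with h | h
  · obtain ⟨p1, e, p2, h1, x, y, h2, h3, h4⟩ := main _ _ h
    exact ⟨p1, e, p2, h1, x, y, .inl h2, h3, h4⟩
  · obtain ⟨p1, e, p2, h1, x, y, h2, h3, h4⟩ := main _ _ h
    exact ⟨p1, e, p2, h1, y, x, .inr h2, h4, h3⟩

/-- Block of an embedded vertex. -/
def gv (ρg : P → Bool) (p1 p2 : P) (b : Bool) : P × Bool := if b then (p2, ρg p2) else (p1, !ρg p1)

theorem emb_block (p1 p2 : P) (x : S × Bool) :
    (((emb ρg p1 p2 x).1.1, (emb ρg p1 p2 x).2) : P × Bool) = gv ρg p1 p2 x.2 := by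
  unfold emb gv; split <;> rfl

theorem hat_planar {hs : S → ℕ} {e : Option C'}
    (hpl : ∀ l, e = some l → HPlanar ρs hs (under (δs l))) :
    HPlanar ρs hs (under (hat δs e)) := by
  cases e with
  | some l => exact hpl l rfl
  | none =>
    rw [hplanar_iff]
    have key : ∀ u v, UEdge ρs (under (hat δs none)) u v → u.1 = v.1 ∧ v.2 = !u.2 := by
      rintro u v (⟨⟨a, b⟩, ⟨w, hw, h⟩, rfl, rfl⟩ | ⟨⟨a, b⟩, ⟨w, hw, h⟩, rfl, rfl⟩) <;>
        dsimp only at h <;> subst h <;> simp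
    intro u r v s h1 h2 h3 h4 h5
    obtain ⟨e1, e2⟩ := key _ _ h1
    obtain ⟨e3, e4⟩ := key _ _ h2
    obtain ⟨u, b⟩ := u
    obtain ⟨v, b'⟩ := v
    obtain ⟨r, c⟩ := r
    obtain ⟨s, c'⟩ := s
    dsimp only at *
    subst e1 e2 e3 e4
    cases b <;> cases c <;> simp [vpos] at h3 h4 h5 <;> omega

theorem prod_planar {hg : P → ℕ} {hs : S → ℕ} {N : ℕ} (hN : ∀ s, hs s < N)
    (ig : Function.Injective hg) {c : C} (hrev : GRev (δg c))
    (hplg : HPlanar ρg hg (under (δg c)))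
    (hpls : ∀ p l q, (p, some l, q) ∈ δg c → HPlanar ρs hs (under (δs l))) :
    HPlanar (pdir ρg ρs) (pht ρg hg hs N) (under (pδ ρs δg δs c)) := by
  rw [hplanar_iff]
  intro u r v s h1 h2 o1 o2 o3
  obtain ⟨p1, e, p2, hE, x, z, hxz, rfl, rfl⟩ := uedge_lift h1
  obtain ⟨p1', e', p2', hE', y, t, hyt, rfl, rfl⟩ := uedge_lift h2
  by_cases hp : p1 = p1'
  · subst hp
    obtain ⟨rfl, rfl⟩ := hrev.1 _ _ _ _ _ hE hE'
    have hS : HPlanar ρs hs (under (hat δs e)) := by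
      apply hat_planar
      rintro l rfl
      exact hpls _ _ _ hE
    rw [hplanar_iff] at hS
    -- positions
    set α : ℤ := if ρg p1 then -((hg p1 : ℤ) * N + 1) else (hg p1 : ℤ) * N + N with hα
    set β : ℤ := if ρg p2 then (hg p2 : ℤ) * N + 1 else -((hg p2 : ℤ) * N + N) with hβ
    have hpos : ∀ x : S × Bool, vpos (pht ρg hg hs N) (emb ρg p1 p2 x) =
        (fun (b : Bool) (n : ℤ) => if b then β + n else α - n) x.2 (hs x.1) := by
      rintro ⟨a, b⟩
      have := hN a
      cases b
      · cases hh : ρg p1 <;> simp [emb, vpos, pht, hh, hα]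
        · push_cast [Nat.sub_sub, Nat.cast_sub (show 1 + hs a ≤ N by omega)]; ring
        · ring
      · cases hh : ρg p2 <;> simp [emb, vpos, pht, hh, hβ]
        · push_cast [Nat.sub_sub, Nat.cast_sub (show 1 + hs a ≤ N by omega)]; ring
        · ring
    have hdis : α < β ∨ β + N ≤ α - N + 1 := by
      have hN0 : 0 < N := lt_of_le_of_lt (Nat.zero_le _) (hN x.1)
      have a1 : (0 : ℤ) ≤ (hg p1 : ℤ) * N := by positivity
      have a2 : (0 : ℤ) ≤ (hg p2 : ℤ) * N := by positivity
      have cmp : ∀ a b : ℕ, a < b → (a : ℤ) * N + N ≤ (b : ℤ) * N := by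
        intro a b hab
        have h3 : (a + 1) * N ≤ b * N := Nat.mul_le_mul_right N hab
        rw [Nat.add_mul, one_mul] at h3
        exact_mod_cast h3
      rcases lt_trichotomy (hg p1) (hg p2) with h | h | h
      · have := cmp _ _ h
        cases hh : ρg p1 <;> cases hh' : ρg p2 <;> simp [hα, hβ, hh, hh'] <;> omega
      · obtain rfl := ig h
        cases hh : ρg p1 <;> simp [hα, hβ, hh] <;> omega
      · have := cmp _ _ h
        cases hh : ρg p1 <;> cases hh' : ρg p2 <;> simp [hα, hβ, hh, hh'] <;> omega
    rw [hpos, hpos] at o1 o2 o3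
    have bd : ∀ a : S, 0 ≤ (hs a : ℤ) ∧ (hs a : ℤ) < N := fun a =>
      ⟨by positivity, by exact_mod_cast hN a⟩
    have := rot_core N α β hdis x.2 y.2 z.2 t.2 _ _ _ _ (bd x.1) (bd y.1) (bd z.1) (bd t.1)
      _ _ rfl rfl o1 o2 o3
    rcases this with ⟨a, b, c⟩ | ⟨a, b, c⟩ | ⟨a, b, c⟩ | ⟨a, b, c⟩
    · exact hS x y z t hxz hyt a b c
    · exact hS y z t x hyt hxz.symm a b c
    · exact hS z t x y hxz.symm hyt.symm a b c
    · exact hS t x y z hyt.symm hxz a b c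
  · have hp2 : p2 ≠ p2' := by
      rintro rfl
      exact hp (hrev.2 _ _ _ _ _ hE hE').2
    have hne : ∀ b b', gv ρg p1 p2 b ≠ gv ρg p1' p2' b' := by
      intro b b' h
      cases b <;> cases b' <;> simp [gv] at h
      · exact hp h.1
      · obtain ⟨rfl, h⟩ := h; simp at h
      · obtain ⟨rfl, h⟩ := h; simp at h
      · exact hp2 h.1
    have b1 := block_le hN o1
    have b2 := block_le hN o2
    have b3 := block_le hN o3
    rw [emb_block, emb_block] at b1 b2 b3
    have c1 := lt_of_le_of_ne b1 (fun h => hne _ _ (vpos_inj ig h))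
    have c2 := lt_of_le_of_ne b2 (fun h => hne _ _ (vpos_inj ig h).symm)
    have c3 := lt_of_le_of_ne b3 (fun h => hne _ _ (vpos_inj ig h))
    have ue : ∀ p1 p2 e, (p1, e, p2) ∈ δg c → ∀ b b' : Bool, b ≠ b' →
        UEdge ρg (under (δg c)) (gv ρg p1 p2 b) (gv ρg p1 p2 b') := by
      intro p1 p2 e he b b' hb
      cases b <;> cases b' <;> simp at hb
      · exact .inl ⟨(p1, p2), ⟨e, he⟩, rfl, rfl⟩
      · exact .inr ⟨(p1, p2), ⟨e, he⟩, rfl, rfl⟩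
    rw [hplanar_iff] at hplg
    refine hplg _ _ _ _ (ue _ _ _ hE x.2 z.2 ?_) (ue _ _ _ hE' y.2 t.2 ?_) c1 c2 c3
    · intro h; rw [h] at c1; exact lt_asymm c1 c2
    · intro h; rw [h] at c2; exact lt_asymm c2 c3

theorem prod_rev {c : C} (hrev : GRev (δg c)) (hs : ∀ l, IsRev (under (δs l))) :
    IsRev (under (pδ ρs δg δs c)) := by
  have hh : ∀ e, IsRev (under (hat δs e)) := by
    rintro (_ | l)
    · refine ⟨?_, ?_⟩
      · rintro q r r' ⟨w, -, h⟩ ⟨w', -, h'⟩; exact h.symm.trans h'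
      · rintro q r r' ⟨w, -, h⟩ ⟨w', -, h'⟩; exact h.trans h'.symm
    · exact hs l
  constructor
  · rintro ⟨p, s⟩ ⟨p', s'⟩ ⟨p'', s''⟩ ⟨w, p1, e, p2, hg, hs, e1, e2⟩ ⟨w', p1', e', p2', hg', hs', e1', e2'⟩
    dsimp only at *
    have : p1 = p1' ∧ e = e' ∧ p2 = p2' := by
      cases h : ρs s <;> simp only [h, Bool.false_eq_true, if_true, if_false] at e1 e1' <;>
        subst e1 <;> subst e1'
      · obtain ⟨h1, h2⟩ := hrev.2 _ _ _ _ _ hg hg'; exact ⟨h2, h1, rfl⟩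
      · obtain ⟨h1, h2⟩ := hrev.1 _ _ _ _ _ hg hg'; exact ⟨rfl, h1, h2⟩
    obtain ⟨rfl, rfl, rfl⟩ := this
    obtain rfl := (hh e).1 s s' s'' ⟨w, hs⟩ ⟨w', hs'⟩
    rw [e2, e2']
  · rintro ⟨p', s'⟩ ⟨p'', s''⟩ ⟨p, s⟩ ⟨w, p1, e, p2, hg, hs, e1, e2⟩ ⟨w', p1', e', p2', hg', hs', e1', e2'⟩
    dsimp only at *
    have : p1 = p1' ∧ e = e' ∧ p2 = p2' := by
      cases h : ρs s <;> simp only [h, Bool.false_eq_true, if_true, if_false] at e2 e2' <;>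
        subst e2 <;> subst e2'
      · obtain ⟨h1, h2⟩ := hrev.1 _ _ _ _ _ hg hg'; exact ⟨rfl, h1, h2⟩
      · obtain ⟨h1, h2⟩ := hrev.2 _ _ _ _ _ hg hg'; exact ⟨h2, h1, rfl⟩
    obtain ⟨rfl, rfl, rfl⟩ := this
    obtain rfl := (hh e).2 s' s'' s ⟨w, hs⟩ ⟨w', hs'⟩
    rw [e1, e1']

end Geometry

theorem good_machine {P C C' B : Type} [Finite P] {κ : C → Kd} {κ' : C' → Kd}
    {g : List C → List C'} (ρg : P → Bool) (ig : P) (hig : ρg ig = true) (fg : Set P)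
    (hfg : ∀ p ∈ fg, ρg p = true) (δg : C → Set (P × Option C' × P)) (hg : P → ℕ)
    (hginj : Function.Injective hg) (hrev : ∀ c, GRev (δg c))
    (hpl : ∀ c, κ c = Kd.M → HPlanar ρg hg (under (δg c)))
    (hmid : ∀ c p l q, κ c = Kd.M → (p, some l, q) ∈ δg c → κ' l = Kd.M)
    (hval : ∀ w, Valid κ w → Valid κ' (g w))
    (hcomp : ∀ w, Valid κ w → ∃ pf ∈ fg, LRun (GSt ρg δg w) (0, ig) (g w) (w.length, pf)) :
    Good B κ κ' g := by
  refine ⟨hval, ?_⟩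
  rintro h ⟨S, hS, M, hs, hsinj, hsrev, hspl, hreal⟩
  obtain ⟨N, hN⟩ : ∃ N, ∀ s, hs s < N := by
    obtain ⟨N, hN⟩ := (Set.finite_range hs).bddAbove
    exact ⟨N + 1, fun s => Nat.lt_succ_of_le (hN ⟨s, rfl⟩)⟩
  refine ⟨P × S, inferInstance, ⟨pdir ρg M.ρ, (ig, M.init), by simp [pdir, hig, M.init_fwd],
    {x | x.1 ∈ fg ∧ x.2 ∈ M.fin}, pδ M.ρ δg M.δ⟩, pht ρg hg hs N, pht_inj hN hginj hsinj,
    fun c => prod_rev (hrev c) hsrev, fun c hc => ?_, fun w hw o => ?_⟩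
  · exact prod_planar hN hginj (hrev c) (hpl c hc) (fun p l q hl => hspl l (hmid c p l q hc hl))
  · refine Iff.trans ?_ (hreal (g w) (hval w hw) o)
    obtain ⟨pf, hpf, hrun⟩ := hcomp w hw
    constructor
    · rintro ⟨⟨p, s⟩, ⟨hp, hsf⟩, hr⟩
      dsimp only at hp hsf hr
      obtain ⟨k', ⟨o1, o2, h1, h2, h3, rfl⟩, h5⟩ := onRun_run hrev (X0 := (0, ig)) (Xn := (w.length, pf)) hig rfl
        (hfg _ hpf) rfl (W := g w) hr 0 ⟨[], g w, .refl _, hrun, rfl, rfl⟩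
      refine ⟨s, hsf, ?_⟩
      dsimp only at h2 h5
      rcases h2.cases_head with ⟨-, rfl⟩ | ⟨y, v, w', ⟨e, -, he⟩, -⟩
      · rw [List.append_nil] at h3
        rw [← h3] at h5 ⊢
        exact h5
      · exact absurd he (OSt.not_end (hfg _ hp))
    · rintro ⟨sf, hsf, hr⟩
      refine ⟨(pf, sf), ⟨hpf, hsf⟩, ?_⟩
      obtain ⟨Y, ⟨o1, o2, h1, h2, h3, h4⟩, h5⟩ := sim_run (ρg := ρg) (δg := δg) (t := w) (X0 := (0, ig))
        (Xn := (w.length, pf)) hr (0, ig) ⟨[], g w, .refl _, hrun, rfl, rfl⟩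
      have ho2 : o2 = [] := by
        dsimp only at h4
        rw [← h3, List.length_append] at h4
        exact List.length_eq_zero_iff.1 (by omega)
      have hρ : M.ρ sf = true := by
        rcases hr.cases_tail with ⟨h, -⟩ | ⟨y, v, w', -, hst, -⟩
        · obtain ⟨l, m, r, hh, -⟩ := hval w hw
          rw [hh] at h; simp at h
        · exact hst.target_end rfl
      have := drain_fwd (ρs := M.ρ) (δs := M.δ) hρ h2 ho2
      simpa using h5.trans this

end Planar2DFT

namespace Planar2DFT
open Relation

/-- Annotate each letter with the current state of an automaton (before reading it). -/
def scan {X C : Type} (upd : X → C → X) : X → List C → List (C × X)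
  | _, [] => []
  | s, c :: w => (c, s) :: scan upd (upd s c) w

theorem scan_append {X C : Type} (upd : X → C → X) (s : X) (u v : List C) :
    scan upd s (u ++ v) = scan upd s u ++ scan upd (u.foldl upd s) v := by
  induction u generalizing s with
  | nil => rfl
  | cons a u ih => simp [scan, ih]

theorem scan_mem {X C : Type} {upd : X → C → X} {s : X} {u : List C} {c : C × X}
    (h : c ∈ scan upd s u) : c.1 ∈ u := by
  induction u generalizing s with
  | nil => simp [scan] at h
  | cons a u ih =>
    simp only [scan, List.mem_cons] at h ⊢
    rcases h with rfl | h
    · exact .inl rfl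
    · exact .inr (ih h)

theorem scan_valid {X C : Type} {κ : C → Kd} (upd : X → C → X) (s : X) {w : List C}
    (h : Valid κ w) : Valid (fun c : C × X => κ c.1) (scan upd s w) := by
  obtain ⟨l, m, r, rfl, h1, h2, h3⟩ := h
  refine ⟨(l, s), scan upd (upd s l) m, (r, m.foldl upd (upd s l)), ?_, h1, ?_, h3⟩
  · simp [scan, scan_append]
  · intro c hc
    exact h2 _ (scan_mem hc)

/-- States of the reset annotator. -/
inductive RP (X : Type) | fw (x : X) | bk (x : X) | nu

instance {X : Type} [Finite X] : Finite (RP X) := by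
  have : Function.Injective (fun p : RP X => match p with
    | .fw x => (some (x, true) : Option (X × Bool)) | .bk x => some (x, false) | .nu => none) := by
    intro a b h
    cases a <;> cases b <;> simp_all
  exact Finite.of_injective _ this

/-- Directions. -/
def RP.dir {X : Type} : RP X → Bool | .fw _ => true | .bk _ => false | .nu => true

/-- Transitions of the reset annotator. -/
inductive RA {X C : Type} (κ : C → Kd) (τ : C → Option X) (x0 : X) (c : C) :
    RP X → Option (C × X) → RP X → Prop
  | l1 : κ c = Kd.L → RA κ τ x0 c .nu (some (c, x0)) (.fw x0)
  | l2 : κ c = Kd.L → RA κ τ x0 c (.bk x0) none .nu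
  | r1 (x : X) : κ c = Kd.R → RA κ τ x0 c (.fw x) (some (c, x)) (.fw x)
  | n1 (x : X) : κ c = Kd.M → τ c = none → RA κ τ x0 c (.fw x) (some (c, x)) (.fw x)
  | n2 (x : X) : κ c = Kd.M → τ c = none → RA κ τ x0 c (.bk x) none (.bk x)
  | n3 : κ c = Kd.M → τ c = none → RA κ τ x0 c .nu none .nu
  | s1 (x y : X) : κ c = Kd.M → τ c = some y → RA κ τ x0 c (.fw x) (some (c, x)) (.bk x)
  | s2 (y : X) : κ c = Kd.M → τ c = some y → RA κ τ x0 c (.bk y) none .nu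
  | s3 (y : X) : κ c = Kd.M → τ c = some y → RA κ τ x0 c .nu none (.fw y)

/-- Heights. -/
def RP.ht {X : Type} (e : X → ℕ) (k : ℕ) : RP X → ℕ
  | .fw x => 2 * e x | .bk x => 2 * e x + 1 | .nu => 2 * k

theorem ra_planar {X C : Type} {κ : C → Kd} {τ : C → Option X} {x0 : X} {c : C}
    {e : X → ℕ} {k : ℕ} (hk : ∀ x, e x < k) (hc : κ c = Kd.M) :
    HPlanar RP.dir (RP.ht e k) {p | ∃ o, RA κ τ x0 c p.1 o p.2} := by
  rw [hplanar_iff]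
  rcases hτ : τ c with _ | y
  · have key : ∀ u v, UEdge RP.dir {p | ∃ o, RA κ τ x0 c p.1 o p.2} u v →
        vpos (RP.ht e k) u = - vpos (RP.ht e k) v := by
      have : ∀ u v, ProfileEdge RP.dir {p | ∃ o, RA κ τ x0 c p.1 o p.2} u v →
          vpos (RP.ht e k) u = - vpos (RP.ht e k) v := by
        rintro u v ⟨⟨p, q⟩, ⟨o, h⟩, rfl, rfl⟩
        cases h <;> simp_all [vpos, RP.dir, RP.ht]
      rintro u v (h | h)
      · exact this _ _ h
      · rw [this _ _ h]; simp
    intro u r v s h1 h2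
    have := key _ _ h1
    have := key _ _ h2
    omega
  · have key : ∀ u v, UEdge RP.dir {p | ∃ o, RA κ τ x0 c p.1 o p.2} u v →
        ∃ a b, ((vpos (RP.ht e k) u = a ∧ vpos (RP.ht e k) v = b) ∨
          (vpos (RP.ht e k) u = b ∧ vpos (RP.ht e k) v = a)) ∧
          ((∃ i : ℕ, i < k ∧ a = -(2 * (i : ℤ) + 1) ∧ b = -(2 * (i : ℤ) + 2)) ∨
            (a = 2 * (e y : ℤ) + 2 ∧ b = 2 * (k : ℤ) + 1) ∨
            (a = -(2 * (k : ℤ) + 1) ∧ b = 2 * (e y : ℤ) + 1)) := by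
      have : ∀ u v, ProfileEdge RP.dir {p | ∃ o, RA κ τ x0 c p.1 o p.2} u v →
          ((∃ i : ℕ, i < k ∧ vpos (RP.ht e k) u = -(2 * (i : ℤ) + 1) ∧
              vpos (RP.ht e k) v = -(2 * (i : ℤ) + 2)) ∨
            (vpos (RP.ht e k) u = 2 * (e y : ℤ) + 2 ∧ vpos (RP.ht e k) v = 2 * (k : ℤ) + 1) ∨
            (vpos (RP.ht e k) u = -(2 * (k : ℤ) + 1) ∧ vpos (RP.ht e k) v = 2 * (e y : ℤ) + 1)) := by
        rintro u v ⟨⟨p, q⟩, ⟨o, h⟩, rfl, rfl⟩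
        cases h with
        | l1 h => simp [h] at hc
        | l2 h => simp [h] at hc
        | r1 x h => simp [h] at hc
        | n1 x h h' => simp [h'] at hτ
        | n2 x h h' => simp [h'] at hτ
        | n3 h h' => simp [h'] at hτ
        | s1 x y' h h' =>
          refine .inl ⟨e x, hk x, ?_, ?_⟩ <;> simp [vpos, RP.dir, RP.ht] <;> omega
        | s2 y' h h' =>
          rw [h'] at hτ; cases hτ
          refine .inr (.inl ⟨?_, ?_⟩) <;> simp [vpos, RP.dir, RP.ht] <;> omega
        | s3 y' h h' =>
          rw [h'] at hτ; cases hτ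
          refine .inr (.inr ⟨?_, ?_⟩) <;> simp [vpos, RP.dir, RP.ht] <;> omega
      rintro u v (h | h)
      · exact ⟨_, _, .inl ⟨rfl, rfl⟩, this _ _ h⟩
      · exact ⟨_, _, .inr ⟨rfl, rfl⟩, this _ _ h⟩
    intro u r v s h1 h2 o1 o2 o3
    have := hk y
    obtain ⟨a, b, hab, h1⟩ := key _ _ h1
    obtain ⟨a', b', hab', h2⟩ := key _ _ h2
    rcases h1 with ⟨i, hi, rfl, rfl⟩ | ⟨rfl, rfl⟩ | ⟨rfl, rfl⟩ <;>
    rcases h2 with ⟨i', hi', rfl, rfl⟩ | ⟨rfl, rfl⟩ | ⟨rfl, rfl⟩ <;>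
    rcases hab with ⟨h1, h2⟩ | ⟨h1, h2⟩ <;> rcases hab' with ⟨h3, h4⟩ | ⟨h3, h4⟩ <;>
    rw [h1, h3] at o1 <;> rw [h3, h2] at o2 <;> rw [h2, h4] at o3 <;> omega

theorem gst_mk {P C C' : Type} {ρg : P → Bool} {δg : C → Set (P × Option C' × P)} {t : List C}
    {j : ℕ} {a : C} {p q : P} {e : Option C'} (hj : t[j]? = some a) (h : (p, e, q) ∈ δg a) :
    GSt ρg δg t (entp ρg j p, p) e.toList (extp ρg j q, q) :=
  ⟨e, rfl, j, a, hj, h, rfl, rfl⟩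

/-- The reset annotator. -/
theorem good_reset {X C B : Type} [Finite X] {κ : C → Kd} (τ : C → Option X) (x0 : X)
    (hL : ∀ c, κ c = Kd.L → τ c = some x0) :
    Good B κ (fun c : C × X => κ c.1) (scan (fun x c => (τ c).getD x) x0) := by
  obtain ⟨k, ⟨e⟩⟩ := Finite.exists_equiv_fin X
  let hgt := RP.ht (fun x => (e x : ℕ)) k
  have hk : ∀ x, (e x : ℕ) < k := fun x => (e x).2
  refine good_machine (P := RP X) RP.dir RP.nu rfl {p | ∃ x, p = RP.fw x}
    (by rintro _ ⟨x, rfl⟩; rfl) (fun c => {z | RA κ τ x0 c z.1 z.2.1 z.2.2}) hgt ?_ ?_ ?_ ?_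
    (fun w hw => scan_valid _ _ hw) ?_
  · intro a b hab
    have ei : ∀ x y, (e x : ℕ) = e y → x = y := fun x y h => e.injective (Fin.ext h)
    cases a with
    | fw x => cases b with
      | fw y => simp only [hgt, RP.ht] at hab; rw [ei x y (by omega)]
      | bk y => simp only [hgt, RP.ht] at hab; omega
      | nu => simp only [hgt, RP.ht] at hab; have := hk x; omega
    | bk x => cases b with
      | fw y => simp only [hgt, RP.ht] at hab; omega
      | bk y => simp only [hgt, RP.ht] at hab; rw [ei x y (by omega)]
      | nu => simp only [hgt, RP.ht] at hab; omega
    | nu => cases b with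
      | fw y => simp only [hgt, RP.ht] at hab; have := hk y; omega
      | bk y => simp only [hgt, RP.ht] at hab; omega
      | nu => rfl
  · intro c
    constructor
    · intro p o q o' q' h h'
      simp only [Set.mem_ofPred_eq] at h h'
      cases h <;> cases h' <;> simp_all
    · intro p o q o' q' h h'
      simp only [Set.mem_ofPred_eq] at h h'
      cases h <;> cases h' <;> simp_all
  · intro c hc
    exact ra_planar hk hc
  · intro c p l q hc h
    simp only [Set.mem_ofPred_eq] at h
    cases h <;> exact hc
  · rintro w ⟨l, m, r, rfl, hl, hm, hr⟩
    set t := l :: (m ++ [r]) with ht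
    set δg : C → Set (RP X × Option (C × X) × RP X) := fun c => {z | RA κ τ x0 c z.1 z.2.1 z.2.2} with hδ
    have key : ∀ (m2 p : List C) (x : X), t = p ++ (m2 ++ [r]) → (∀ c ∈ m2, κ c = Kd.M) →
        LRun (GSt RP.dir δg t) (p.length, .bk x) [] (p.length, .nu) →
        ∃ pf ∈ {p | ∃ x, p = RP.fw x}, LRun (GSt RP.dir δg t) (p.length, .fw x)
          (scan (fun x c => (τ c).getD x) x (m2 ++ [r])) (t.length, pf) := by
      intro m2
      induction m2 with
      | nil =>
        intro p x htp _ _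
        refine ⟨.fw x, ⟨x, rfl⟩, ?_⟩
        have hj : t[p.length]? = some r := by rw [htp]; simp
        have := gst_mk (ρg := RP.dir) (δg := δg) (p := .fw x) (q := .fw x) (e := some (r, x)) hj
          (RA.r1 x hr)
        have hlen : t.length = p.length + 1 := by rw [htp]; simp
        rw [hlen]
        simpa [scan, entp, extp, RP.dir] using LRun.single this
      | cons c m2 ih =>
        intro p x htp hM hb
        have hj : t[p.length]? = some c := by rw [htp]; simp
        have hc : κ c = Kd.M := hM c (by simp)
        have ih' := fun x => ih (p ++ [c]) x (by rw [htp]; simp) (fun d hd => hM d (by simp [hd]))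
        simp only [List.length_append, List.length_singleton] at ih'
        rcases hτ : τ c with _ | y
        · have g1 := gst_mk (ρg := RP.dir) (δg := δg) (p := .fw x) (q := .fw x) (e := some (c, x)) hj
            (RA.n1 x hc hτ)
          have g2 := gst_mk (ρg := RP.dir) (δg := δg) (p := .bk x) (q := .bk x) (e := none) hj
            (RA.n2 x hc hτ)
          have g3 := gst_mk (ρg := RP.dir) (δg := δg) (p := .nu) (q := .nu) (e := none) hj
            (RA.n3 hc hτ)
          simp only [entp, extp, RP.dir, if_true, Bool.false_eq_true, if_false, Option.toList] at g1 g2 g3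
          obtain ⟨pf, hpf, hh⟩ := ih' x (by
            simpa using ((LRun.single g2).trans hb).trans (LRun.single g3))
          refine ⟨pf, hpf, ?_⟩
          simpa [scan, hτ] using (LRun.single g1).trans hh
        · have g1 := gst_mk (ρg := RP.dir) (δg := δg) (p := .fw x) (q := .bk x) (e := some (c, x)) hj
            (RA.s1 x y hc hτ)
          have g2 := gst_mk (ρg := RP.dir) (δg := δg) (p := .bk y) (q := .nu) (e := none) hj
            (RA.s2 y hc hτ)
          have g3 := gst_mk (ρg := RP.dir) (δg := δg) (p := .nu) (q := .fw y) (e := none) hj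
            (RA.s3 y hc hτ)
          simp only [entp, extp, RP.dir, if_true, Bool.false_eq_true, if_false, Option.toList] at g1 g2 g3
          obtain ⟨pf, hpf, hh⟩ := ih' y (LRun.single g2)
          refine ⟨pf, hpf, ?_⟩
          simpa [scan, hτ] using (((LRun.single g1).trans hb).trans (LRun.single g3)).trans hh
    have hj : t[0]? = some l := by simp [ht]
    have g1 := gst_mk (ρg := RP.dir) (δg := δg) (p := .nu) (q := .fw x0) (e := some (l, x0)) hj
      (RA.l1 hl)
    have g2 := gst_mk (ρg := RP.dir) (δg := δg) (p := .bk x0) (q := .nu) (e := none) hj (RA.l2 hl)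
    simp only [entp, extp, RP.dir, if_true, Bool.false_eq_true, if_false, Option.toList] at g1 g2
    obtain ⟨pf, hpf, hh⟩ := key m [l] x0 (by simp [ht]) hm (LRun.single g2)
    refine ⟨pf, hpf, ?_⟩
    have := (LRun.single g1).trans hh
    simpa [ht, scan, hL l hl] using this

/-- Swap the kinds of the two end markers. -/
def Kd.swap : Kd → Kd | .L => .R | .M => .M | .R => .L

/-- Transitions of the reversal machine. -/
inductive RV {C : Type} (κ : C → Kd) (c : C) : Fin 3 → Option C → Fin 3 → Prop
  | l1 : κ c = Kd.L → RV κ c 0 none 0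
  | l2 : κ c = Kd.L → RV κ c 1 (some c) 2
  | m1 : κ c = Kd.M → RV κ c 0 none 0
  | m2 : κ c = Kd.M → RV κ c 1 (some c) 1
  | m3 : κ c = Kd.M → RV κ c 2 none 2
  | r1 : κ c = Kd.R → RV κ c 0 (some c) 1
  | r2 : κ c = Kd.R → RV κ c 2 none 2

theorem good_reverse {C B : Type} {κ : C → Kd} :
    Good B κ (fun c => (κ c).swap) List.reverse := by
  refine good_machine (P := Fin 3) (fun i => decide (i ≠ 1)) 0 rfl {2}
    (by rintro _ rfl; rfl) (fun c => {z | RV κ c z.1 z.2.1 z.2.2}) Fin.val Fin.val_injective ?_ ?_ ?_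
    ?_ ?_
  · intro c
    constructor
    · intro p o q o' q' h h'
      simp only [Set.mem_ofPred_eq] at h h'
      cases h <;> cases h' <;> simp_all
    · intro p o q o' q' h h'
      simp only [Set.mem_ofPred_eq] at h h'
      cases h <;> cases h' <;> simp_all
  · intro c hc
    rw [hplanar_iff]
    have key : ∀ u v, UEdge (fun i : Fin 3 => decide (i ≠ 1))
        (under {z | RV κ c z.1 z.2.1 z.2.2}) u v →
        vpos Fin.val u = - vpos Fin.val v := by
      have : ∀ u v, ProfileEdge (fun i : Fin 3 => decide (i ≠ 1))
          (under {z | RV κ c z.1 z.2.1 z.2.2}) u v →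
          vpos Fin.val u = - vpos Fin.val v := by
        rintro u v ⟨⟨p, q⟩, ⟨o, h⟩, rfl, rfl⟩
        simp only [Set.mem_ofPred_eq] at h
        cases h <;> simp_all [vpos]
      rintro u v (h | h)
      · exact this _ _ h
      · rw [this _ _ h]; simp
    intro u r v s h1 h2
    have := key _ _ h1
    have := key _ _ h2
    omega
  · intro c p l q hc h
    simp only [Set.mem_ofPred_eq] at h
    cases h <;> simp [hc, Kd.swap]
  · rintro w ⟨l, m, r, rfl, hl, hm, hr⟩
    exact ⟨r, m.reverse, l, by simp, by simp [hr, Kd.swap],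
      fun c hc => by simp [hm c (by simpa using hc), Kd.swap], by simp [hl, Kd.swap]⟩
  · rintro w ⟨l, m, r, rfl, hl, hm, hr⟩
    refine ⟨2, rfl, ?_⟩
    set t := l :: (m ++ [r]) with ht
    set ρg : Fin 3 → Bool := fun i => decide (i ≠ 1) with hρ
    set δg : C → Set (Fin 3 × Option C × Fin 3) := fun c => {z | RV κ c z.1 z.2.1 z.2.2} with hδ
    have fwd : ∀ (q : Fin 3), (q = 0 ∨ q = 2) → ∀ (m2 p : List C), t = p ++ (m2 ++ [r]) →
        (∀ c ∈ m2, κ c = Kd.M) →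
        LRun (GSt ρg δg t) (p.length, q) [] (p.length + m2.length, q) := by
      intro q hq m2
      induction m2 with
      | nil => intro p _ _; exact .refl _
      | cons c m2 ih =>
        intro p htp hM
        have hj : t[p.length]? = some c := by rw [htp]; simp
        have hc : κ c = Kd.M := hM c (by simp)
        have ih' := ih (p ++ [c]) (by rw [htp]; simp) (fun d hd => hM d (by simp [hd]))
        have g1 := gst_mk (ρg := ρg) (δg := δg) (p := q) (q := q) (e := none) hj
          (by rcases hq with rfl | rfl
              · exact RV.m1 hc
              · exact RV.m3 hc)
        have hρq : ρg q = true := by rcases hq with rfl | rfl <;> rfl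
        simp only [entp, extp, hρq, if_true, Option.toList] at g1
        have := (LRun.single g1).trans (by simpa using ih')
        simp only [List.length_cons, List.append_nil] at this ⊢
        convert this using 2
        omega
    have bwd : ∀ (m2 s p : List C), t = p ++ (m2 ++ s) →
        (∀ c ∈ m2, κ c = Kd.M) →
        LRun (GSt ρg δg t) (p.length + m2.length, 1) m2.reverse (p.length, 1) := by
      intro m2
      induction m2 with
      | nil => intro s p _ _; exact .refl _
      | cons c m2 ih =>
        intro s p htp hM
        have hj : t[p.length]? = some c := by rw [htp]; simp
        have hc : κ c = Kd.M := hM c (by simp)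
        have ih' := ih s (p ++ [c]) (by rw [htp]; simp) (fun d hd => hM d (by simp [hd]))
        have g1 := gst_mk (ρg := ρg) (δg := δg) (p := 1) (q := 1) (e := some c) hj (RV.m2 hc)
        simp only [entp, extp, hρ, ne_eq, not_true_eq_false, decide_false, Bool.false_eq_true,
          if_false, Option.toList] at g1
        rw [List.length_append] at ih'
        have := ih'.trans (LRun.single g1)
        simp only [List.length_cons, List.reverse_cons] at this ⊢
        convert this using 2
        simp; omega
    have hj0 : t[0]? = some l := by simp [ht]
    have hj1 : t[m.length + 1]? = some r := by simp [ht]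
    have a1 := gst_mk (ρg := ρg) (δg := δg) (p := 0) (q := 0) (e := none) hj0 (RV.l1 hl)
    have a2 := fwd 0 (.inl rfl) m [l] (by simp [ht]) hm
    have a3 := gst_mk (ρg := ρg) (δg := δg) (p := 0) (q := 1) (e := some r) hj1 (RV.r1 hr)
    have a4 := bwd m [r] [l] (by simp [ht]) hm
    have a5 := gst_mk (ρg := ρg) (δg := δg) (p := 1) (q := 2) (e := some l) hj0 (RV.l2 hl)
    have a6 := fwd 2 (.inr rfl) m [l] (by simp [ht]) hm
    have a7 := gst_mk (ρg := ρg) (δg := δg) (p := 2) (q := 2) (e := none) hj1 (RV.r2 hr)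
    have r0 : ρg 0 = true := rfl
    have r1 : ρg 1 = false := rfl
    have r2 : ρg 2 = true := rfl
    simp only [entp, extp, r0, r1, r2, Bool.false_eq_true, if_true, if_false, Option.toList,
      List.length_singleton, Nat.zero_add, Nat.add_comm 1] at a1 a2 a3 a4 a5 a6 a7
    have := (((((((LRun.single a1).trans a2).trans (LRun.single a3)).trans a4).trans
      (LRun.single a5)).trans a6).trans (LRun.single a7))
    simpa [ht] using this

end Planar2DFT

namespace Planar2DFT
open Relation

section LocalDivisor
variable {M : Type} [Monoid M]

/-- The local divisor of `M` at `v`. -/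
structure LD (v : M) where
  /-- underlying element -/
  el : M
  prop : (∃ a, el = v * a) ∧ (∃ b, el = b * v)

theorem LD.ext' {v : M} {x y : LD v} (h : x.el = y.el) : x = y := by
  cases x; cases y; cases h; rfl

/-- Multiplication of the local divisor. -/
noncomputable def LD.mulE {v : M} (x y : LD v) : LD v :=
  ⟨x.prop.2.choose * y.el, by
    obtain ⟨a, ha⟩ := y.prop.1
    obtain ⟨c, hc⟩ := x.prop.1
    refine ⟨c * a, ?_⟩
    have hb := x.prop.2.choose_spec
    rw [ha, ← mul_assoc, ← hb, ← mul_assoc, ← hc], by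
    obtain ⟨b, hb⟩ := y.prop.2
    exact ⟨x.prop.2.choose * b, by rw [mul_assoc, ← hb]⟩⟩

theorem LD.mulE_right {v : M} (x y : LD v) (a : M) (ha : y.el = v * a) :
    (LD.mulE x y).el = x.el * a := by
  have hb := x.prop.2.choose_spec
  show x.prop.2.choose * y.el = _
  rw [ha, ← mul_assoc, ← hb]

theorem LD.mulE_left {v : M} (x y : LD v) (b : M) (hb : x.el = b * v) :
    (LD.mulE x y).el = b * y.el := by
  obtain ⟨a, ha⟩ := y.prop.1
  rw [LD.mulE_right x y a ha, hb, ha, mul_assoc]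

noncomputable instance (v : M) : Monoid (LD v) where
  mul := LD.mulE
  one := ⟨v, ⟨1, by simp⟩, ⟨1, by simp⟩⟩
  mul_assoc x y z := by
    apply LD.ext'
    obtain ⟨a, ha⟩ := z.prop.1
    obtain ⟨b, hb⟩ := x.prop.2
    show (LD.mulE (LD.mulE x y) z).el = (LD.mulE x (LD.mulE y z)).el
    rw [LD.mulE_right _ z a ha, LD.mulE_left x _ b hb, LD.mulE_left x _ b hb, LD.mulE_right y z a ha,
      mul_assoc]
  one_mul x := by
    apply LD.ext'
    exact (LD.mulE_left _ x 1 (by simp; rfl)).trans (one_mul _)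
  mul_one x := by
    apply LD.ext'
    exact (LD.mulE_right x _ 1 (by simp; rfl)).trans (mul_one _)

theorem LD.one_val (v : M) : (1 : LD v).el = v := rfl

theorem LD.mul_left {v : M} (x y : LD v) (b : M) (hb : x.el = b * v) :
    (x * y).el = b * y.el := LD.mulE_left x y b hb

theorem LD.mul_right {v : M} (x y : LD v) (a : M) (ha : y.el = v * a) :
    (x * y).el = x.el * a := LD.mulE_right x y a ha

theorem LD.pow_val {v : M} (x : LD v) (b : M) (hb : x.el = b * v) (k : ℕ) :
    (x ^ k).el = b ^ k * v := by
  induction k with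
  | zero => simp [LD.one_val]
  | succ k ih => rw [pow_succ', LD.mul_left x _ b hb, ih, pow_succ', mul_assoc]

theorem LD.aperiodic {v : M} (h : ∃ n, ∀ x : M, x ^ (n + 1) = x ^ n) :
    ∃ n, ∀ x : LD v, x ^ (n + 1) = x ^ n := by
  obtain ⟨n, hn⟩ := h
  refine ⟨n, fun x => LD.ext' ?_⟩
  obtain ⟨b, hb⟩ := x.prop.2
  rw [LD.pow_val x b hb, LD.pow_val x b hb, hn]

instance [Finite M] (v : M) : Finite (LD v) := 
  Finite.of_injective LD.el (fun _ _ h => LD.ext' h)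

theorem LD.card_lt [Finite M] {v : M} (h : ∃ n, ∀ x : M, x ^ (n + 1) = x ^ n) (hv : v ≠ 1) :
    Nat.card (LD v) < Nat.card M := by
  have h1 : ∀ x : LD v, x.el = 1 → False := by
    rintro ⟨x, ⟨a, hxa⟩, _⟩ hx
    replace hx : v * a = 1 := hxa.symm.trans hx
    obtain ⟨n, hn⟩ := h
    apply hv
    have e := pow_mul_pow_eq_one n hx
    calc v = v * (v ^ n * a ^ n) := by rw [e, mul_one]
      _ = v ^ (n + 1) * a ^ n := by rw [← mul_assoc, pow_succ']
      _ = 1 := by rw [hn, e]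
  have := Fintype.ofFinite M
  have := Fintype.ofFinite (LD v)
  rw [Nat.card_eq_fintype_card, Nat.card_eq_fintype_card]
  refine Fintype.card_lt_of_injective_of_notMem LD.el (fun _ _ h => LD.ext' h) (b := 1) ?_
  rintro ⟨x, hx⟩
  exact h1 x hx

end LocalDivisor

/-- State update of the monoid annotator with resets. -/
def kstep {M C : Type} [Monoid M] (val : C → Option M) (m : M) (c : C) : M :=
  match val c with
  | none => 1
  | some v => m * v

open Classical in
theorem kr_scan {M C : Type} [Monoid M] (val : C → Option M) (v : M) 
    (val1 : C → Option M) (h1 : val1 = fun c => if val c = some v then none else val c)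
    (τ2 : C × M → Option Bool) (h2 : τ2 = fun x => if val x.1 = none then some false else
      if val x.1 = some v then some true else none)
    (τ3 : (C × M) × Bool → Option M) (h3 : τ3 = fun x => if val x.1.1 = none then some 1 else
      if val x.1.1 = some v ∧ x.2 = false then some x.1.2 else none)
    (val4 : ((C × M) × Bool) × M → Option (LD v))
    (h4 : val4 = fun x => if val x.1.1.1 = none then none else
      if val x.1.1.1 = some v ∧ x.1.2 = true then
        some ⟨v * x.1.1.2 * v, ⟨x.1.1.2 * v, by rw [mul_assoc]⟩, ⟨v * x.1.1.2, rfl⟩⟩ else some 1)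
    (φ : (((C × M) × Bool) × M) × LD v → C × M)
    (hφ : φ = fun x => (x.1.1.1.1, if x.1.1.2 then x.1.2 * x.2.el * x.1.1.1.2 else x.1.1.1.2))
    (w : List C) : ∀ (m : M) (b : Bool) (p : M) (z : LD v), (b = false → z = 1) →
      (scan (kstep val4) z (scan (fun x c => (τ3 c).getD x) p (scan (fun x c => (τ2 c).getD x) b
        (scan (kstep val1) m w)))).map φ =
      scan (kstep val) (if b then p * z.el * m else m) w := by
  induction w with
  | nil => intros; rfl
  | cons c w ih =>
    intro m b p z hz
    simp only [scan, List.map_cons]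
    congr 1
    · rw [hφ]
    · rw [ih]
      · congr 1
        rcases hv : val c with _ | u
        · simp [kstep, h1, h2, h3, h4, hv]
        · by_cases hu : u = v
          · subst hu
            cases b
            · simp [kstep, h1, h2, h3, h4, hv, hz rfl, LD.one_val]
            · simp only [kstep, h1, h2, h3, h4, hv]
              simp only [reduceCtorEq, if_false, if_true, Option.getD_some, true_and, and_false, Option.getD_none]
              rw [LD.mul_right _ _ (m * u) (by simp [mul_assoc])]
              simp [mul_assoc]
          · cases b <;> simp [kstep, h1, h2, h3, h4, hv, hu, mul_assoc]
      · intro hb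
        rcases hv : val c with _ | u
        · simp [kstep, h4, hv]
        · by_cases hu : u = v
          · simp [h2, hv, hu] at hb
          · simp [h2, hv, hu] at hb
            simp [kstep, h4, hv, hu, hz hb]

open Classical in
theorem good_kr_aux (B : Type) (n : ℕ) : ∀ (M : Type) [Monoid M] [Finite M],
    Nat.card M = n → (∃ n, ∀ x : M, x ^ (n + 1) = x ^ n) → ∀ (k : ℕ) (C : Type) (κ : C → Kd)
    (val : C → Option M), {v : M | v ≠ 1 ∧ ∃ c, val c = some v}.ncard = k →
    (∀ c, κ c = Kd.L → val c = none) →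
    Good B κ (fun c : C × M => κ c.1) (scan (kstep val) 1) := by
  induction n using Nat.strong_induction_on with
  | _ n IH =>
  intro M _ _ hcard hap k
  induction k using Nat.strong_induction_on with
  | _ k ih =>
  intro C κ val hk hL
  by_cases hex : ∃ v, v ≠ 1 ∧ ∃ c, val c = some v
  · obtain ⟨v, hv1, c0, hc0⟩ := hex
    let val1 : C → Option M := fun c => if val c = some v then none else val c
    let τ2 : C × M → Option Bool := fun x => if val x.1 = none then some false else
      if val x.1 = some v then some true else none
    let τ3 : (C × M) × Bool → Option M := fun x => if val x.1.1 = none then some 1 else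
      if val x.1.1 = some v ∧ x.2 = false then some x.1.2 else none
    let val4 : ((C × M) × Bool) × M → Option (LD v) := fun x => if val x.1.1.1 = none then none else
      if val x.1.1.1 = some v ∧ x.1.2 = true then
        some ⟨v * x.1.1.2 * v, ⟨x.1.1.2 * v, by rw [mul_assoc]⟩, ⟨v * x.1.1.2, rfl⟩⟩ else some 1
    let φ : (((C × M) × Bool) × M) × LD v → C × M :=
      fun x => (x.1.1.1.1, if x.1.1.2 then x.1.2 * x.2.el * x.1.1.1.2 else x.1.1.1.2)
    have g1 : Good B κ (fun c : C × M => κ c.1) (scan (kstep val1) 1) := by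
      refine ih _ ?_ C κ val1 rfl ?_
      · rw [← hk]
        refine Set.ncard_lt_ncard ?_ (Set.toFinite _)
        constructor
        · rintro u ⟨hu, c, hc⟩
          refine ⟨hu, c, ?_⟩
          simp only [val1] at hc
          split at hc
          · cases hc
          · exact hc
        · intro hh
          obtain ⟨-, c, hc⟩ := hh (show v ∈ {v : M | v ≠ 1 ∧ ∃ c, val c = some v} from ⟨hv1, c0, hc0⟩)
          simp only [val1] at hc
          split at hc
          · cases hc
          · contradiction
      · intro c hc
        simp [val1, hL c hc]
    have g2 : Good B (fun c : C × M => κ c.1) (fun c : (C × M) × Bool => κ c.1.1)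
        (scan (fun x c => (τ2 c).getD x) false) :=
      good_reset τ2 false (fun c hc => by simp [τ2, hL _ hc])
    have g3 : Good B (fun c : (C × M) × Bool => κ c.1.1) (fun c : ((C × M) × Bool) × M => κ c.1.1.1)
        (scan (fun x c => (τ3 c).getD x) 1) :=
      good_reset τ3 1 (fun c hc => by simp [τ3, hL _ hc])
    have g4 : Good B (fun c : ((C × M) × Bool) × M => κ c.1.1.1)
        (fun c : (((C × M) × Bool) × M) × LD v => κ c.1.1.1.1) (scan (kstep val4) 1) :=
      IH _ (by rw [← hcard]; exact LD.card_lt hap hv1) (LD v) rfl (LD.aperiodic hap) _ _ _ val4 rfl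
        (fun c hc => by simp [val4, hL _ hc])
    have g5 : Good B (fun c : (((C × M) × Bool) × M) × LD v => κ c.1.1.1.1)
      (fun c : C × M => κ c.1) (List.map φ) := good_relabel φ (fun c => rfl)
    refine Good.congr ?_ ((((g1.comp g2).comp g3).comp g4).comp g5)
    intro w _
    have := kr_scan val v val1 rfl τ2 rfl τ3 rfl val4 rfl φ rfl w 1 false 1 1 (fun _ => rfl)
    simpa using this
  · push Not at hex
    refine Good.congr ?_ (good_relabel (κ := κ) (κ' := fun c : C × M => κ c.1) (fun c => (c, 1))
      (fun _ => rfl))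
    intro w _
    rename_i hw
    clear hw
    induction w with
    | nil => rfl
    | cons c w ihw =>
      simp only [List.map_cons, scan]
      rw [ihw]
      congr 1
      congr 1
      rcases hv : val c with _ | u
      · simp [kstep, hv]
      · have : u = 1 := by
          by_contra hu
          exact hex u hu c hv
        simp [kstep, hv, this]

theorem good_kr {B M : Type} [Monoid M] [Finite M] (hap : ∃ n, ∀ x : M, x ^ (n + 1) = x ^ n)
    {C : Type} {κ : C → Kd} (val : C → Option M) (hL : ∀ c, κ c = Kd.L → val c = none) :
    Good B κ (fun c : C × M => κ c.1) (scan (kstep val) 1) :=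
  good_kr_aux B _ M rfl hap _ C κ val rfl hL

end Planar2DFT

namespace Planar2DFT
open Relation

theorem no_cycle {α : Type} {r : α → α → Prop} (hd : ∀ x y z, r x y → r x z → y = z) {x e : α}
    (hxe : ReflTransGen r x e) (he : ∀ y, ¬ r e y) : ¬ TransGen r x x := by
  induction hxe using ReflTransGen.head_induction_on with
  | refl =>
    intro h
    obtain ⟨y, hy, -⟩ := TransGen.head'_iff.1 h
    exact he y hy
  | head h _ ih =>
    intro hc
    obtain ⟨y, hy, hy'⟩ := TransGen.head'_iff.1 hc
    rw [hd _ _ _ hy h] at hy'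
    exact ih (TransGen.tail'_iff.2 ⟨_, hy', h⟩)

/-- A stacked family of edges is planar. -/
theorem stacked_planar {Q : Type} {ρ : Q → Bool} {h : Q → ℕ} {f : Set (Q × Q)}
    (H : ∀ p q p' q', (p, q) ∈ f → (p', q') ∈ f → (p = p' ∧ q = q') ∨
      (∀ u ∈ ({(p, !ρ p), (q, ρ q)} : Set (Q × Bool)),
        ∀ v ∈ ({(p', !ρ p'), (q', ρ q')} : Set (Q × Bool)), u.2 = v.2 → h u.1 < h v.1) ∨
      (∀ u ∈ ({(p, !ρ p), (q, ρ q)} : Set (Q × Bool)),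
        ∀ v ∈ ({(p', !ρ p'), (q', ρ q')} : Set (Q × Bool)), u.2 = v.2 → h v.1 < h u.1)) :
    HPlanar ρ h f := by
  rw [hplanar_iff]
  have key : ∀ u v, UEdge ρ f u v → ∃ p q, (p, q) ∈ f ∧
      u ∈ ({(p, !ρ p), (q, ρ q)} : Set (Q × Bool)) ∧ v ∈ ({(p, !ρ p), (q, ρ q)} : Set (Q × Bool)) ∧
      ((u = (p, !ρ p) ∧ v = (q, ρ q)) ∨ (v = (p, !ρ p) ∧ u = (q, ρ q))) := by
    rintro u v (⟨⟨p, q⟩, hf, rfl, rfl⟩ | ⟨⟨p, q⟩, hf, rfl, rfl⟩)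
    · exact ⟨p, q, hf, by simp, by simp, by simp⟩
    · exact ⟨p, q, hf, by simp, by simp, by simp⟩
  have vp : ∀ u v : Q × Bool, (u.2 = v.2 → h u.1 < h v.1) →
      (0 < vpos h u → 0 < vpos h v → vpos h u < vpos h v) ∧
      (vpos h u < 0 → vpos h v < 0 → vpos h v < vpos h u) := by
    rintro ⟨a, b⟩ ⟨c, d⟩ hh
    cases b <;> cases d <;> simp [vpos] at hh ⊢ <;> omega
  have nz : ∀ u : Q × Bool, vpos h u ≠ 0 := by
    rintro ⟨a, b⟩
    cases b <;> simp [vpos] <;> omega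
  intro u r v s h1 h2 o1 o2 o3
  obtain ⟨p, q, hf, hu, hv, e1⟩ := key _ _ h1
  obtain ⟨p', q', hf', hr, hs, e2⟩ := key _ _ h2
  have := nz u
  have := nz r
  have := nz v
  have := nz s
  rcases H p q p' q' hf hf' with ⟨rfl, rfl⟩ | hlt | hlt
  · rcases e1 with ⟨rfl, rfl⟩ | ⟨rfl, rfl⟩ <;> rcases e2 with ⟨rfl, rfl⟩ | ⟨rfl, rfl⟩ <;> omega
  · have a1 := vp _ _ (hlt u hu r hr)
    have a2 := vp _ _ (hlt u hu s hs)
    have a3 := vp _ _ (hlt v hv r hr)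
    have a4 := vp _ _ (hlt v hv s hs)
    omega
  · have a1 := vp _ _ (fun e => hlt u hu r hr e.symm)
    have a2 := vp _ _ (fun e => hlt u hu s hs e.symm)
    have a3 := vp _ _ (fun e => hlt v hv r hr e.symm)
    have a4 := vp _ _ (fun e => hlt v hv s hs e.symm)
    omega

section Smachine
variable {Q C B : Type} (T : RM Q C B)

/-- Configurations visited by the accepting run. -/
def Vis (t : List C) (x : ℕ × Q) : Prop :=
  Rch T.ρ T.rel t (0, T.init) x ∧ ∃ qf ∈ T.fin, T.ρ qf = true ∧ Rch T.ρ T.rel t x (t.length, qf)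

/-- Rank of a visit. -/
noncomputable def rk (t : List C) (x : ℕ × Q) : ℕ :=
  {q' | q' ≠ x.2 ∧ Vis T t (x.1, q') ∧ Rch T.ρ T.rel t (x.1, q') x}.ncard

variable {T}

theorem rch_congr {ρ : Q → Bool} {R : C → Set (Q × Q)} {u v u' v' : List C} {x y : Q × Fin 3}
    (hu : beh ρ R u = beh ρ R u') (hv : beh ρ R v = beh ρ R v')
    (hx0 : x.2 = 0 → ρ x.1 = true) (hx2 : x.2 = 2 → ρ x.1 = false)
    (hy0 : y.2 = 0 → ρ y.1 = false) (hy2 : y.2 = 2 → ρ y.1 = true) :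
    Rch ρ R (u ++ v) (gp u v x.2, x.1) (gp u v y.2, y.1) ↔
      Rch ρ R (u' ++ v') (gp u' v' x.2, x.1) (gp u' v' y.2, y.1) := by
  constructor
  · intro h
    have := rch_to_glue u v hx0 hx2 hy0 hy2 h
    rw [hu, hv] at this
    exact glue_to_rch u' v' this
  · intro h
    have := rch_to_glue u' v' hx0 hx2 hy0 hy2 h
    rw [← hu, ← hv] at this
    exact glue_to_rch u v this

theorem vis_congr {u v u' v' : List C} (hu : beh T.ρ T.rel u = beh T.ρ T.rel u')
    (hv : beh T.ρ T.rel v = beh T.ρ T.rel v') (q : Q) :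
    Vis T (u ++ v) (u.length, q) ↔ Vis T (u' ++ v') (u'.length, q) := by
  have h1 := rch_congr (x := (T.init, 0)) (y := (q, 1)) hu hv (by simp [T.init_fwd]) (by simp)
    (by simp) (by simp)
  have h2 : ∀ qf, T.ρ qf = true → _ := fun qf hqf =>
    rch_congr (x := (q, 1)) (y := (qf, 2)) hu hv (by simp) (by simp) (by simp) (by simp [hqf])
  simp only [gp] at h1 h2
  simp only [if_true, one_ne_zero, if_false, show (2 : Fin 3) ≠ 0 by decide,
    show (2 : Fin 3) ≠ 1 by decide] at h1 h2
  unfold Vis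
  simp only [List.length_append]
  constructor
  · rintro ⟨a, qf, b, c, d⟩
    exact ⟨h1.1 a, qf, b, c, (h2 qf c).1 d⟩
  · rintro ⟨a, qf, b, c, d⟩
    exact ⟨h1.2 a, qf, b, c, (h2 qf c).2 d⟩

theorem rk_congr {u v u' v' : List C} (hu : beh T.ρ T.rel u = beh T.ρ T.rel u')
    (hv : beh T.ρ T.rel v = beh T.ρ T.rel v') (q : Q) :
    rk T (u ++ v) (u.length, q) = rk T (u' ++ v') (u'.length, q) := by
  unfold rk
  congr 1
  ext q'
  have h1 := rch_congr (x := (q', 1)) (y := (q, 1)) hu hv (by simp) (by simp) (by simp) (by simp)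
  simp only [gp, one_ne_zero, if_false, if_true] at h1
  simp only [Set.mem_ofPred_eq]
  rw [vis_congr hu hv q', h1]

theorem cell_congr {u v u' v' : List C} (a : C) (hu : beh T.ρ T.rel u = beh T.ρ T.rel u')
    (hv : beh T.ρ T.rel v = beh T.ρ T.rel v') (q : Q) (b : Bool) :
    (Vis T (u ++ a :: v) (u.length + b.toNat, q) ↔ Vis T (u' ++ a :: v') (u'.length + b.toNat, q)) ∧
    rk T (u ++ a :: v) (u.length + b.toNat, q) = rk T (u' ++ a :: v') (u'.length + b.toNat, q) := by
  cases b
  · have : beh T.ρ T.rel (a :: v) = beh T.ρ T.rel (a :: v') := by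
      rw [← List.singleton_append, beh_append, hv, ← beh_append, List.singleton_append]
    exact ⟨vis_congr hu this q, rk_congr hu this q⟩
  · have : beh T.ρ T.rel (u ++ [a]) = beh T.ρ T.rel (u' ++ [a]) := by
      rw [beh_append, hu, ← beh_append]
    have h1 := vis_congr this hv q
    have h2 := rk_congr this hv q
    simp only [List.append_assoc, List.singleton_append, List.length_append, List.length_singleton] at h1 h2
    exact ⟨h1, h2⟩

theorem entp_eq (ρ : Q → Bool) (j : ℕ) (q : Q) : entp ρ j q = j + (!ρ q).toNat := by
  unfold entp; cases ρ q <;> rfl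

theorem extp_eq (ρ : Q → Bool) (j : ℕ) (q : Q) : extp ρ j q = j + (ρ q).toNat := by
  unfold extp; cases ρ q <;> rfl

theorem vis_nocycle (hd : ∀ a, IsDet (T.rel a)) {t : List C} {x : ℕ × Q} (hx : Vis T t x) : ¬ TransGen (St T.ρ T.rel t) x x := by
  obtain ⟨-, qf, -, hqf, hr⟩ := hx
  exact no_cycle (r := St T.ρ T.rel t) (fun _ _ _ h1 h2 => St.det (fun a _ => hd a) h1 h2) hr
    (fun _ => St.not_end hqf)

theorem vis_antisymm (hd : ∀ a, IsDet (T.rel a)) {t : List C} {x y : ℕ × Q} (hx : Vis T t x) (h1 : Rch T.ρ T.rel t x y)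
    (h2 : Rch T.ρ T.rel t y x) : x = y := by
  by_contra hne
  rcases ReflTransGen.cases_head h1 with h | ⟨z, hz, hzy⟩
  · exact hne h
  · exact vis_nocycle hd hx (TransGen.head'_iff.2 ⟨z, hz, hzy.trans h2⟩)

theorem vis_total (hd : ∀ a, IsDet (T.rel a)) {t : List C} {x y : ℕ × Q} (hx : Vis T t x) (hy : Vis T t y) :
    Rch T.ρ T.rel t x y ∨ Rch T.ρ T.rel t y x :=
  ReflTransGen.total_of_right_unique (fun _ _ _ h1 h2 => St.det (fun a _ => hd a) h1 h2) hx.1 hy.1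

theorem rk_lt [Finite Q] (hd : ∀ a, IsDet (T.rel a)) {t : List C} {b : ℕ} {q q' : Q} (hx : Vis T t (b, q)) (hy : Vis T t (b, q'))
    (h : Rch T.ρ T.rel t (b, q) (b, q')) (hne : q ≠ q') : rk T t (b, q) < rk T t (b, q') := by
  refine Set.ncard_lt_ncard ⟨?_, ?_⟩ (Set.toFinite _)
  · rintro p ⟨h1, h2, h3⟩
    refine ⟨?_, h2, h3.trans h⟩
    rintro rfl
    exact hne (congrArg Prod.snd (vis_antisymm hd hx h h3))
  · intro hh
    exact (hh (show q ∈ _ from ⟨hne, hx, h⟩)).1 rfl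

theorem rk_init (hd : ∀ a, IsDet (T.rel a)) {t : List C} : rk T t (0, T.init) = 0 := by
  unfold rk
  convert Set.ncard_empty Q
  ext p
  simp only [Set.mem_ofPred_eq, Set.mem_empty_iff_false, iff_false]
  rintro ⟨h1, h2, h3⟩
  exact h1 (congrArg Prod.snd (vis_antisymm hd h2 h3 h2.1))

variable (T) in
/-- The planar reversible machine working on annotated words. -/
noncomputable def Smach [Finite Q] : RM (Fin (Nat.card Q + 1) × Q) (C × Set (Q × Q) × Set (Q × Q)) B where
  ρ x := T.ρ x.2
  init := (0, T.init)
  init_fwd := T.init_fwd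
  fin := {x | x.2 ∈ T.fin}
  δ c := {z | (z.1.2, z.2.1, z.2.2.2) ∈ T.δ c.1 ∧ ∃ t1 t2, c.2.1 = beh T.ρ T.rel t1 ∧
    c.2.2 = beh T.ρ T.rel t2 ∧
    Vis T (t1 ++ c.1 :: t2) (entp T.ρ t1.length z.1.2, z.1.2) ∧
    Vis T (t1 ++ c.1 :: t2) (extp T.ρ t1.length z.2.2.2, z.2.2.2) ∧
    (z.1.1 : ℕ) = rk T (t1 ++ c.1 :: t2) (entp T.ρ t1.length z.1.2, z.1.2) ∧
    (z.2.2.1 : ℕ) = rk T (t1 ++ c.1 :: t2) (extp T.ρ t1.length z.2.2.2, z.2.2.2)}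

theorem smach_edges [Finite Q] {c : C × Set (Q × Q) × Set (Q × Q)}
    {x y x' y' : Fin (Nat.card Q + 1) × Q} (h : (x, y) ∈ (Smach T).rel c)
    (h' : (x', y') ∈ (Smach T).rel c) : ∃ t1 t2,
      ((x.2, y.2) ∈ T.rel c.1 ∧ Vis T (t1 ++ c.1 :: t2) (entp T.ρ t1.length x.2, x.2) ∧
        Vis T (t1 ++ c.1 :: t2) (extp T.ρ t1.length y.2, y.2) ∧
        (x.1 : ℕ) = rk T (t1 ++ c.1 :: t2) (entp T.ρ t1.length x.2, x.2) ∧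
        (y.1 : ℕ) = rk T (t1 ++ c.1 :: t2) (extp T.ρ t1.length y.2, y.2) ∧
        St T.ρ T.rel (t1 ++ c.1 :: t2) (entp T.ρ t1.length x.2, x.2) (extp T.ρ t1.length y.2, y.2)) ∧
      ((x'.2, y'.2) ∈ T.rel c.1 ∧ Vis T (t1 ++ c.1 :: t2) (entp T.ρ t1.length x'.2, x'.2) ∧
        Vis T (t1 ++ c.1 :: t2) (extp T.ρ t1.length y'.2, y'.2) ∧
        (x'.1 : ℕ) = rk T (t1 ++ c.1 :: t2) (entp T.ρ t1.length x'.2, x'.2) ∧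
        (y'.1 : ℕ) = rk T (t1 ++ c.1 :: t2) (extp T.ρ t1.length y'.2, y'.2) ∧
        St T.ρ T.rel (t1 ++ c.1 :: t2) (entp T.ρ t1.length x'.2, x'.2)
          (extp T.ρ t1.length y'.2, y'.2)) := by
  obtain ⟨w, h0, t1, t2, h1, h2, h3, h4, h5, h6⟩ := h
  obtain ⟨w', h0', t1', t2', h1', h2', h3', h4', h5', h6'⟩ := h'
  have e1 := h1'.symm.trans h1
  have e2 := h2'.symm.trans h2
  have c1 := cell_congr (T := T) c.1 e1 e2 x'.2 (!T.ρ x'.2)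
  have c2 := cell_congr (T := T) c.1 e1 e2 y'.2 (T.ρ y'.2)
  rw [← entp_eq, ← entp_eq] at c1
  rw [← extp_eq, ← extp_eq] at c2
  exact ⟨t1, t2, ⟨⟨w, h0⟩, h3, h4, h5, h6, t1.length, c.1, by simp, ⟨w, h0⟩, rfl, rfl⟩,
    ⟨⟨w', h0'⟩, c1.1.1 h3', c2.1.1 h4', h5'.trans c1.2, h6'.trans c2.2,
      t1.length, c.1, by simp, ⟨w', h0'⟩, rfl, rfl⟩⟩

theorem smach_rev [Finite Q] (hd : ∀ a, IsDet (T.rel a)) (c : C × Set (Q × Q) × Set (Q × Q)) :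
    IsRev ((Smach T).rel c) := by
  constructor
  · rintro x y y' h h'
    obtain ⟨t1, t2, ⟨h0, -, -, -, h4, -⟩, ⟨h0', -, -, -, h4', -⟩⟩ := smach_edges h h'
    have := hd _ _ _ _ h0 h0'
    rw [← this] at h4'
    exact Prod.ext (Fin.ext (h4.trans h4'.symm)) this
  · rintro x x' y h h'
    obtain ⟨t1, t2, ⟨h0, h1, vy, h3, -, hs⟩, ⟨h0', h1', -, h3', -, hs'⟩⟩ := smach_edges h h'
    have key : ∀ {x x' : Fin (Nat.card Q + 1) × Q},
        Vis T (t1 ++ c.1 :: t2) (entp T.ρ t1.length x.2, x.2) →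
        St T.ρ T.rel (t1 ++ c.1 :: t2) (entp T.ρ t1.length x.2, x.2) (extp T.ρ t1.length y.2, y.2) →
        St T.ρ T.rel (t1 ++ c.1 :: t2) (entp T.ρ t1.length x'.2, x'.2) (extp T.ρ t1.length y.2, y.2) →
        Rch T.ρ T.rel (t1 ++ c.1 :: t2) (entp T.ρ t1.length x.2, x.2) (entp T.ρ t1.length x'.2, x'.2) →
        x.2 = x'.2 := by
      intro x x' _ s1 s2 r
      rcases ReflTransGen.cases_head r with h | ⟨z, hz, hzy⟩
      · exact (Prod.mk.inj h).2
      · have := St.det (fun a _ => hd a) hz s1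
        subst this
        exact absurd (TransGen.tail'_iff.2 ⟨_, hzy, s2⟩) (vis_nocycle hd vy)
    have : x.2 = x'.2 := by
      rcases vis_total hd h1 h1' with h | h
      · exact key h1 hs hs' h
      · exact (key h1' hs' hs h).symm
    rw [← this] at h3'
    exact Prod.ext (Fin.ext (h3.trans h3'.symm)) this

/-- Height for the machine on annotated words. -/
def sht (e : Q → ℕ) (N : ℕ) (x : Fin (Nat.card Q + 1) × Q) : ℕ := (x.1 : ℕ) * N + e x.2

theorem sht_lt {e : Q → ℕ} {N : ℕ} (he : ∀ q, e q < N) {x y : Fin (Nat.card Q + 1) × Q}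
    (h : (x.1 : ℕ) < y.1) : sht e N x < sht e N y := by
  have h3 : ((x.1 : ℕ) + 1) * N ≤ y.1 * N := Nat.mul_le_mul_right N h
  rw [Nat.add_mul, one_mul] at h3
  have := he x.2
  unfold sht
  omega

theorem sht_inj {e : Q → ℕ} {N : ℕ} (he : ∀ q, e q < N) (hi : Function.Injective e) :
    Function.Injective (sht e N) := by
  intro x y h
  have h1 : (x.1 : ℕ) = y.1 := by
    rcases lt_trichotomy (x.1 : ℕ) y.1 with h' | h' | h'
    · have := sht_lt he h'; omega
    · exact h'
    · have := sht_lt he h'; omega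
  refine Prod.ext (Fin.ext h1) (hi ?_)
  unfold sht at h
  rw [h1] at h
  omega

theorem smach_planar [Finite Q] (hd : ∀ a, IsDet (T.rel a)) {e : Q → ℕ} {N : ℕ}
    (he : ∀ q, e q < N) (c : C × Set (Q × Q) × Set (Q × Q)) :
    HPlanar (Smach T).ρ (sht e N) ((Smach T).rel c) := by
  apply stacked_planar
  -- two distinct edges, the first one earlier
  have key : ∀ (x y x' y' : Fin (Nat.card Q + 1) × Q) (t1 t2 : List C),
      Vis T (t1 ++ c.1 :: t2) (entp T.ρ t1.length x.2, x.2) →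
      Vis T (t1 ++ c.1 :: t2) (extp T.ρ t1.length y.2, y.2) →
      (x.1 : ℕ) = rk T (t1 ++ c.1 :: t2) (entp T.ρ t1.length x.2, x.2) →
      (y.1 : ℕ) = rk T (t1 ++ c.1 :: t2) (extp T.ρ t1.length y.2, y.2) →
      St T.ρ T.rel (t1 ++ c.1 :: t2) (entp T.ρ t1.length x.2, x.2) (extp T.ρ t1.length y.2, y.2) →
      Vis T (t1 ++ c.1 :: t2) (entp T.ρ t1.length x'.2, x'.2) →
      Vis T (t1 ++ c.1 :: t2) (extp T.ρ t1.length y'.2, y'.2) →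
      (x'.1 : ℕ) = rk T (t1 ++ c.1 :: t2) (entp T.ρ t1.length x'.2, x'.2) →
      (y'.1 : ℕ) = rk T (t1 ++ c.1 :: t2) (extp T.ρ t1.length y'.2, y'.2) →
      St T.ρ T.rel (t1 ++ c.1 :: t2) (entp T.ρ t1.length x'.2, x'.2) (extp T.ρ t1.length y'.2, y'.2) →
      x.2 ≠ x'.2 →
      Rch T.ρ T.rel (t1 ++ c.1 :: t2) (entp T.ρ t1.length x.2, x.2) (entp T.ρ t1.length x'.2, x'.2) →
      ∀ u ∈ ({(x, !(Smach T).ρ x), (y, (Smach T).ρ y)} : Set (_ × Bool)),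
        ∀ v ∈ ({(x', !(Smach T).ρ x'), (y', (Smach T).ρ y')} : Set (_ × Bool)),
          u.2 = v.2 → sht e N u.1 < sht e N v.1 := by
    intro x y x' y' t1 t2 hx hy ix iy hs hx' hy' ix' iy' hs' hne hr
    have hr' : Rch T.ρ T.rel (t1 ++ c.1 :: t2) (extp T.ρ t1.length y.2, y.2)
        (entp T.ρ t1.length x'.2, x'.2) := by
      rcases ReflTransGen.cases_head hr with h | ⟨z, hz, hzy⟩
      · exact absurd (Prod.mk.inj h).2 hne
      · rw [← St.det (fun a _ => hd a) hz hs]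
        exact hzy
    have cmp : ∀ (u v : Fin (Nat.card Q + 1) × Q) (b : Bool),
        Vis T (t1 ++ c.1 :: t2) (t1.length + b.toNat, u.2) →
        Vis T (t1 ++ c.1 :: t2) (t1.length + b.toNat, v.2) →
        (u.1 : ℕ) = rk T (t1 ++ c.1 :: t2) (t1.length + b.toNat, u.2) →
        (v.1 : ℕ) = rk T (t1 ++ c.1 :: t2) (t1.length + b.toNat, v.2) →
        TransGen (St T.ρ T.rel (t1 ++ c.1 :: t2)) (t1.length + b.toNat, u.2)
          (t1.length + b.toNat, v.2) → sht e N u < sht e N v := by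
      intro u v b h1 h2 h3 h4 h5
      apply sht_lt he
      rw [h3, h4]
      apply rk_lt hd h1 h2 h5.to_reflTransGen
      intro heq
      rw [← heq] at h5
      exact vis_nocycle hd h1 h5
    have tg1 := TransGen.tail'_iff.2 ⟨_, hr, hs'⟩
    have tg2 := TransGen.tail'_iff.2 ⟨_, hr', hs'⟩
    have tg0 := TransGen.head'_iff.2 ⟨_, hs, hr'⟩
    simp only [entp_eq, extp_eq] at *
    rintro u (rfl | rfl) v (rfl | rfl) huv
    · have huv' : (!T.ρ x.2) = (!T.ρ x'.2) := huv
      rw [← huv'] at hx' ix' tg0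
      exact cmp x x' _ hx hx' ix ix' tg0
    · have huv' : (!T.ρ x.2) = (T.ρ y'.2) := huv
      rw [← huv'] at hy' iy' tg1
      exact cmp x y' _ hx hy' ix iy' tg1
    · have huv' : (T.ρ y.2) = (!T.ρ x'.2) := huv
      rw [← huv'] at hx' ix' hr'
      refine cmp y x' _ hy hx' iy ix' ?_
      rcases reflTransGen_iff_eq_or_transGen.1 hr' with h | h
      · exfalso
        have h2 : x'.2 = y.2 := (Prod.mk.inj h).2
        rw [h2] at huv'
        cases hh : T.ρ y.2 <;> simp [hh] at huv'
      · exact h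
    · have huv' : (T.ρ y.2) = (T.ρ y'.2) := huv
      rw [← huv'] at hy' iy' tg2
      exact cmp y y' _ hy hy' iy iy' tg2
  intro x y x' y' h h'
  obtain ⟨t1, t2, ⟨h0, h1, h2, h3, h4, hs⟩, ⟨h0', h1', h2', h3', h4', hs'⟩⟩ := smach_edges h h'
  by_cases hne : x.2 = x'.2
  · left
    have e1 : x = x' := by
      rw [← hne] at h3'
      exact Prod.ext (Fin.ext (h3.trans h3'.symm)) hne
    subst e1
    exact ⟨rfl, (smach_rev hd c).1 _ _ _ h h'⟩
  · right
    rcases vis_total hd h1 h1' with hr | hr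
    · left
      exact key x y x' y' t1 t2 h1 h2 h3 h4 hs h1' h2' h3' h4' hs' hne hr
    · right
      intro u hu v hv huv
      exact key x' y' x y t1 t2 h1' h2' h3' h4' hs' h1 h2 h3 h4 hs (Ne.symm hne) hr v hv u hu huv.symm

/-- Tape decorated with behaviours of both sides. -/
def annG (ρ : Q → Bool) (R : C → Set (Q × Q)) : List C → List C → List (C × Set (Q × Q) × Set (Q × Q))
  | _, [] => []
  | p, a :: t => (a, beh ρ R p, beh ρ R t) :: annG ρ R (p ++ [a]) t

theorem annG_length {ρ : Q → Bool} {R : C → Set (Q × Q)} (p t : List C) :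
    (annG ρ R p t).length = t.length := by
  induction t generalizing p with
  | nil => rfl
  | cons a t ih => simp [annG, ih]

theorem annG_get {ρ : Q → Bool} {R : C → Set (Q × Q)} (p t1 : List C) (a : C) (t2 : List C) :
    (annG ρ R p (t1 ++ a :: t2))[t1.length]? = some (a, beh ρ R (p ++ t1), beh ρ R t2) := by
  induction t1 generalizing p with
  | nil => simp [annG]
  | cons b t1 ih => simp [annG, ih]

theorem split_at {t : List C} {j : ℕ} {a : C} (h : t[j]? = some a) :
    ∃ t1 t2, t = t1 ++ a :: t2 ∧ t1.length = j := by
  obtain ⟨hj, rfl⟩ := List.getElem?_eq_some_iff.1 h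
  exact ⟨t.take j, t.drop (j + 1), by simp, by simp; omega⟩

theorem OSt.st {t : List C} {x y : ℕ × Q} {w : List B} (h : OSt T.ρ T.δ t x w y) :
    St T.ρ T.rel t x y := by
  obtain ⟨j, a, h1, h2, h3, h4⟩ := h
  exact ⟨j, a, h1, ⟨w, h2⟩, h3, h4⟩

theorem LRun.rch {t : List C} {x y : ℕ × Q} {w : List B} (h : LRun (OSt T.ρ T.δ t) x w y) :
    Rch T.ρ T.rel t x y := by
  induction h with
  | refl => exact .refl
  | head h _ ih => exact .head h.st ih

theorem rk_lt_card [Finite Q] (t : List C) (x : ℕ × Q) : rk T t x < Nat.card Q + 1 := by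
  have := Set.ncard_le_card {q' | q' ≠ x.2 ∧ Vis T t (x.1, q') ∧ Rch T.ρ T.rel t (x.1, q') x}
  unfold rk
  omega

theorem smach_real [Finite Q] (hd : ∀ a, IsDet (T.rel a)) (t : List C) (o : List B) :
    (Smach T).Real (annG T.ρ T.rel [] t) o ↔ T.Real t o := by
  constructor
  · rintro ⟨⟨i, qf⟩, hqf, hr⟩
    refine ⟨qf, hqf, ?_⟩
    rw [annG_length] at hr
    have : ∀ x y w, LRun (OSt (Smach T).ρ (Smach T).δ (annG T.ρ T.rel [] t)) x w y →
        LRun (OSt T.ρ T.δ t) (x.1, x.2.2) w (y.1, y.2.2) := by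
      intro x y w h
      induction h with
      | refl => exact .refl _
      | head h _ ih =>
        refine .head ?_ ih
        obtain ⟨j, a, h1, h2, h3, h4⟩ := h
        have hj : j < t.length := by
          have := (List.getElem?_eq_some_iff.1 h1).1
          rwa [annG_length] at this
        obtain ⟨t1, t2, ht, hl⟩ := split_at (List.getElem?_eq_getElem hj)
        have hg := annG_get (ρ := T.ρ) (R := T.rel) [] t1 t[j] t2
        rw [← ht, hl, h1] at hg
        cases hg
        exact ⟨j, t[j], List.getElem?_eq_getElem hj, h2.1, h3, h4⟩
    exact this _ _ _ hr
  · rintro ⟨qf, hqf, hr⟩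
    refine ⟨(⟨rk T t (t.length, qf), rk_lt_card _ _⟩, qf), hqf, ?_⟩
    rw [annG_length]
    have hρ : T.ρ qf = true := by
      rcases hr.cases_tail with ⟨h, -⟩ | ⟨y, v, w', -, hst, -⟩
      · rw [← (Prod.mk.inj h).2]; exact T.init_fwd
      · exact hst.target_end rfl
    have : ∀ x y w, LRun (OSt T.ρ T.δ t) x w y → Rch T.ρ T.rel t (0, T.init) x →
        y = (t.length, qf) →
        LRun (OSt (Smach T).ρ (Smach T).δ (annG T.ρ T.rel [] t))
          (x.1, (⟨rk T t x, rk_lt_card _ _⟩, x.2)) w (y.1, (⟨rk T t y, rk_lt_card _ _⟩, y.2)) := by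
      intro x y w h
      induction h with
      | refl => intros; exact .refl _
      | @head x y z u v h hrest ih =>
        rintro hx rfl
        have hst := h.st
        refine .head ?_ (ih (hx.tail hst) rfl)
        have vx : Vis T t x := ⟨hx, qf, hqf, hρ, .head hst hrest.rch⟩
        have vy : Vis T t y := ⟨hx.tail hst, qf, hqf, hρ, hrest.rch⟩
        obtain ⟨j, a, h1, h2, h3, h4⟩ := h
        obtain ⟨t1, t2, ht, hl⟩ := split_at h1
        have hg := annG_get (ρ := T.ρ) (R := T.rel) [] t1 a t2
        rw [← ht, hl] at hg
        obtain ⟨n, q⟩ := x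
        obtain ⟨n', q'⟩ := y
        dsimp only at h2 h3 h4
        subst h3 h4 hl
        refine ⟨t1.length, _, hg, ⟨h2, t1, t2, rfl, rfl, ?_⟩, rfl, rfl⟩
        dsimp only
        rw [← ht]
        exact ⟨vx, vy, rfl, rfl⟩
    have := this _ _ _ hr .refl rfl
    have h0 : (⟨rk T t (0, T.init), rk_lt_card _ _⟩ : Fin (Nat.card Q + 1)) = 0 := by
      apply Fin.ext
      simp [rk_init hd]
    rw [h0] at this
    exact this

theorem smach_pr [Finite Q] (hd : ∀ a, IsDet (T.rel a)) (κ : C × Set (Q × Q) × Set (Q × Q) → Kd) :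
    PR κ (fun w o => (Smach T).Real w o) := by
  obtain ⟨k, ⟨e⟩⟩ := Finite.exists_equiv_fin Q
  exact ⟨_, inferInstance, Smach T, sht (fun q => (e q : ℕ)) k,
    sht_inj (fun q => (e q).2) (fun a b h => e.injective (Fin.ext h)), smach_rev hd,
    fun c _ => smach_planar hd (fun q => (e q).2) c, fun w _ o => Iff.rfl⟩

end Smachine
end Planar2DFT

namespace Planar2DFT
open Relation

section Monoid
variable {Q A B : Type} (T : TwoWayTransducer Q A B)

/-- The behaviour monoid as a type. -/
structure BM where
  /-- underlying transition -/
  el : Set (Q × Q)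
  prop : ∃ w : List A, el = beh T.ρ T.rel (w.map Tape.sym)

variable {T}

theorem BM.ext' {x y : BM T} (h : x.el = y.el) : x = y := by
  cases x; cases y; cases h; rfl

variable (T) in
/-- The behaviour of a word. -/
def BM.of (w : List A) : BM T := ⟨beh T.ρ T.rel (w.map Tape.sym), w, rfl⟩

theorem BM.exists_of (x : BM T) : ∃ w, x = BM.of T w := by
  obtain ⟨w, hw⟩ := x.prop
  exact ⟨w, BM.ext' hw⟩

/-- Multiplication. -/
def BM.mulE (x y : BM T) : BM T := ⟨glue T.ρ x.el y.el, by
  obtain ⟨u, hu⟩ := x.prop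
  obtain ⟨v, hv⟩ := y.prop
  exact ⟨u ++ v, by rw [hu, hv, List.map_append, beh_append]⟩⟩

theorem BM.mulE_of (u v : List A) : BM.mulE (BM.of T u) (BM.of T v) = BM.of T (u ++ v) := by
  apply BM.ext'
  simp [BM.mulE, BM.of, beh_append]

instance : Monoid (BM T) where
  mul := BM.mulE
  one := BM.of T []
  mul_assoc x y z := by
    obtain ⟨u, rfl⟩ := x.exists_of
    obtain ⟨v, rfl⟩ := y.exists_of
    obtain ⟨w, rfl⟩ := z.exists_of
    show BM.mulE (BM.mulE _ _) _ = BM.mulE _ (BM.mulE _ _)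
    simp only [BM.mulE_of, List.append_assoc]
  one_mul x := by
    obtain ⟨u, rfl⟩ := x.exists_of
    exact BM.mulE_of [] u
  mul_one x := by
    obtain ⟨u, rfl⟩ := x.exists_of
    show BM.mulE (BM.of T u) (BM.of T []) = _
    rw [BM.mulE_of, List.append_nil]

theorem BM.mul_of (u v : List A) : BM.of T u * BM.of T v = BM.of T (u ++ v) := BM.mulE_of u v

theorem BM.one_of : (1 : BM T) = BM.of T [] := rfl

theorem BM.pow_el (x : BM T) (k : ℕ) : (x ^ k).el = glpow T.ρ x.el k := by
  induction k with
  | zero => rw [pow_zero, BM.one_of]; simp [BM.of, glpow, beh_nil]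
  | succ k ih =>
    rw [pow_succ, glpow, ← ih]
    rfl

instance [Finite Q] : Finite (BM T) := Finite.of_injective BM.el (fun _ _ h => BM.ext' h)

theorem BM.inBehav (x : BM T) : InBehav T x.el := by
  obtain ⟨w, hw⟩ := x.prop
  rw [hw]
  clear hw
  induction w with
  | nil => rw [List.map_nil, beh_nil]; exact .one
  | cons a w ih =>
    rw [List.map_cons, ← List.singleton_append, beh_append, beh_single]
    exact .mul (.gen a) ih

theorem BM.aperiodic (h : ApBehav T) : ∃ n, ∀ x : BM T, x ^ (n + 1) = x ^ n := by
  obtain ⟨n, hn⟩ := h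
  refine ⟨n, fun x => BM.ext' ?_⟩
  rw [BM.pow_el, BM.pow_el, hn _ x.inBehav]

/-- Kinds of tape letters. -/
def kT : Tape A → Kd
  | .lend => .L
  | .sym _ => .M
  | .rend => .R

theorem kT_valid {w : List (Tape A)} : Valid kT w ↔ ∃ u, w = tapeOf u := by
  constructor
  · rintro ⟨l, m, r, rfl, hl, hm, hr⟩
    have hl' : l = .lend := by cases l <;> simp [kT] at hl ⊢
    have hr' : r = .rend := by cases r <;> simp [kT] at hr ⊢
    subst hl' hr'
    have : ∃ u : List A, m = u.map Tape.sym := by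
      clear hl hr
      induction m with
      | nil => exact ⟨[], rfl⟩
      | cons c m ih =>
        obtain ⟨u, rfl⟩ := ih (fun d hd => hm d (by simp [hd]))
        have := hm c (by simp)
        cases c with
        | lend => simp [kT] at this
        | rend => simp [kT] at this
        | sym a => exact ⟨a :: u, rfl⟩
    obtain ⟨u, rfl⟩ := this
    exact ⟨u, rfl⟩
  · rintro ⟨u, rfl⟩
    refine ⟨.lend, u.map Tape.sym, .rend, rfl, rfl, ?_, rfl⟩
    intro c hc
    obtain ⟨a, -, rfl⟩ := List.mem_map.1 hc
    rfl

variable (T) in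
/-- Values for the left scan. -/
def valL : Tape A → Option (BM T)
  | .lend => none
  | .sym a => some (BM.of T [a])
  | .rend => some 1

variable (T) in
/-- Values for the right scan. -/
def valR : Tape A × BM T → Option (BM T)ᵐᵒᵖ
  | (.rend, _) => none
  | (.sym a, _) => some (MulOpposite.op (BM.of T [a]))
  | (.lend, _) => some 1

variable (T) in
/-- Final relabelling. -/
def phiA : (Tape A × BM T) × (BM T)ᵐᵒᵖ → Tape A × Set (Q × Q) × Set (Q × Q)
  | ((.lend, _), n) => (.lend, idRel Q, glue T.ρ n.unop.el (T.rel .rend))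
  | ((.sym a, m), n) => (.sym a, glue T.ρ (T.rel .lend) m.el, glue T.ρ n.unop.el (T.rel .rend))
  | ((.rend, m), _) => (.rend, glue T.ρ (T.rel .lend) m.el, idRel Q)

theorem rscan_cons {X C : Type} (upd : X → C → X) (s : X) (c : C) (w : List C) :
    (scan upd s (c :: w).reverse).reverse =
      (c, w.reverse.foldl upd s) :: (scan upd s w.reverse).reverse := by
  simp [scan_append, scan]

theorem fold_op (u : List A) (s : BM T) :
    (scan (kstep (valL T)) s (u.map Tape.sym ++ [.rend])).reverse.foldl (kstep (valR T)) 1 =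
      MulOpposite.op (BM.of T u) := by
  induction u generalizing s with
  | nil =>
    simp [scan, kstep, valR, ← BM.one_of]
  | cons a u ih =>
    simp only [List.map_cons, List.cons_append, scan, List.reverse_cons, List.foldl_append, ih]
    simp [kstep, valR, ← MulOpposite.op_mul, BM.mul_of]

theorem ann_tail (u v : List A) :
    (scan (kstep (valR T)) 1 (scan (kstep (valL T)) (BM.of T v)
      (u.map Tape.sym ++ [.rend])).reverse).reverse.map (phiA T) =
    annG T.ρ T.rel (.lend :: v.map Tape.sym) (u.map Tape.sym ++ [.rend]) := by
  induction u generalizing v with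
  | nil =>
    simp [scan, phiA, annG, beh_nil, BM.of]
    rw [← List.singleton_append (l := v.map Tape.sym), beh_append, beh_single]
  | cons a u ih =>
    have hs : kstep (valL T) (BM.of T v) (.sym a) = BM.of T (v ++ [a]) := by
      simp [kstep, valL, BM.mul_of]
    simp only [List.map_cons, List.cons_append, scan, hs]
    rw [rscan_cons, List.map_cons, ih, fold_op]
    rw [annG]
    congr 1
    · rw [← List.singleton_append (l := v.map Tape.sym), beh_append, beh_append, beh_single, beh_single]
      rfl
    · simp

theorem ann_correct (u : List A) :
    (scan (kstep (valR T)) 1 (scan (kstep (valL T)) 1 (tapeOf u)).reverse).reverse.map (phiA T) =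
    annG T.ρ T.rel [] (tapeOf u) := by
  have hs : kstep (valL T) 1 .lend = BM.of T [] := rfl
  simp only [tapeOf, scan, hs]
  rw [rscan_cons, List.map_cons, ann_tail, fold_op, annG, beh_append, beh_single, beh_nil]
  rfl

theorem Kd.swap_swap (k : Kd) : k.swap.swap = k := by cases k <;> rfl

theorem good_ann [Finite Q] (h : ApBehav T) :
    Good B (kT (A := A)) (fun c : Tape A × Set (Q × Q) × Set (Q × Q) => kT c.1)
      (annG T.ρ T.rel []) := by
  obtain ⟨n, hn⟩ := BM.aperiodic h
  have g1 : Good B (kT (A := A)) (fun c : Tape A × BM T => kT c.1) (scan (kstep (valL T)) 1) :=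
    good_kr ⟨n, hn⟩ (valL T) (fun c hc => by cases c <;> simp [kT] at hc; rfl)
  have g2 : Good B (fun c : Tape A × BM T => kT c.1) (fun c : Tape A × BM T => (kT c.1).swap)
    List.reverse := good_reverse
  have hn' : ∀ x : (BM T)ᵐᵒᵖ, x ^ (n + 1) = x ^ n := by
    intro x
    apply MulOpposite.unop_injective
    rw [MulOpposite.unop_pow, MulOpposite.unop_pow, hn]
  have : Finite (BM T)ᵐᵒᵖ := Finite.of_injective MulOpposite.unop MulOpposite.unop_injective
  have g3 : Good B (fun c : Tape A × BM T => (kT c.1).swap)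
      (fun c : (Tape A × BM T) × (BM T)ᵐᵒᵖ => (kT c.1.1).swap) (scan (kstep (valR T)) 1) :=
    good_kr ⟨n, hn'⟩ (valR T) (fun c hc => by
      obtain ⟨c, m⟩ := c
      cases c <;> simp [kT, Kd.swap] at hc; rfl)
  have g4 : Good B (fun c : (Tape A × BM T) × (BM T)ᵐᵒᵖ => (kT c.1.1).swap)
    (fun c : (Tape A × BM T) × (BM T)ᵐᵒᵖ => (kT c.1.1).swap.swap) List.reverse := good_reverse
  have g5 : Good B (fun c : (Tape A × BM T) × (BM T)ᵐᵒᵖ => (kT c.1.1).swap.swap)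
      (fun c : Tape A × Set (Q × Q) × Set (Q × Q) => kT c.1) (List.map (phiA T)) :=
    good_relabel _ (by
      rintro ⟨⟨c, m⟩, m'⟩
      rw [Kd.swap_swap]
      cases c <;> rfl)
  refine Good.congr ?_ ((((g1.comp g2).comp g3).comp g4).comp g5)
  intro w hw
  obtain ⟨u, rfl⟩ := kT_valid.1 hw
  exact ann_correct u

/-- A transducer as a raw machine. -/
def toRM (T : TwoWayTransducer Q A B) : RM Q (Tape A) B :=
  ⟨T.ρ, T.init, T.init_fwd, T.final, T.δ⟩

theorem step_to_ost {c c' : Config Q A} {w : List B} (h : T.Step c w c') :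
    c'.1 ++ c'.2.2 = c.1 ++ c.2.2 ∧
      OSt T.ρ T.δ (c.1 ++ c.2.2) (c.1.length, c.2.1) w (c'.1.length, c'.2.1) := by
  obtain ⟨a, u, v, q, r, hδ, ⟨hq, hr, rfl, rfl⟩ | ⟨hq, hr, rfl, rfl⟩ | ⟨hq, hr, rfl, rfl⟩ |
    ⟨hq, hr, rfl, rfl⟩⟩ := h
  all_goals
    refine ⟨by simp, u.length, a, by simp, hδ, ?_, ?_⟩ <;> simp [entp, extp, hq, hr]

theorem ost_to_step {t : List (Tape A)} {x y : ℕ × Q} {w : List B} (h : OSt T.ρ T.δ t x w y) :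
    T.Step (t.take x.1, x.2, t.drop x.1) w (t.take y.1, y.2, t.drop y.1) := by
  obtain ⟨n, q⟩ := x
  obtain ⟨n', q'⟩ := y
  obtain ⟨j, a, hj, hδ, hx, hy⟩ := h
  obtain ⟨t1, t2, rfl, rfl⟩ := split_at hj
  dsimp only at hx hy hδ ⊢
  subst hx hy
  have e1 : (t1 ++ a :: t2).take (t1.length + 1) = t1 ++ [a] := by
    rw [List.take_append]; simp
  have e2 : (t1 ++ a :: t2).drop (t1.length + 1) = t2 := by
    rw [List.drop_append]; simp
  refine ⟨a, t1, t2, q, q', hδ, ?_⟩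
  rcases Bool.eq_false_or_eq_true (T.ρ q) with hq | hq <;>
    rcases Bool.eq_false_or_eq_true (T.ρ q') with hq' | hq' <;>
    simp [entp, extp, hq, hq', e1, e2]

theorem run_to_lrun {c c' : Config Q A} {w : List B} (h : T.Run c w c') :
    c'.1 ++ c'.2.2 = c.1 ++ c.2.2 ∧
      LRunT (OSt T.ρ T.δ (c.1 ++ c.2.2)) (c.1.length, c.2.1) w (c'.1.length, c'.2.1) := by
  induction h with
  | refl => exact ⟨rfl, .refl _⟩
  | step _ hs ih =>
    obtain ⟨h1, h2⟩ := step_to_ost hs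
    rw [ih.1] at h1 h2
    exact ⟨h1, .tail ih.2 h2⟩

theorem lrun_to_run {t : List (Tape A)} {x y : ℕ × Q} {w : List B}
    (h : LRunT (OSt T.ρ T.δ t) x w y) :
    T.Run (t.take x.1, x.2, t.drop x.1) w (t.take y.1, y.2, t.drop y.1) := by
  induction h with
  | refl => exact .refl _
  | tail _ hs ih => exact .step ih (ost_to_step hs)

theorem realizes_iff (u : List A) (o : List B) :
    T.Realizes u o ↔ (toRM T).Real (tapeOf u) o := by
  constructor
  · rintro ⟨qf, hqf, h⟩
    refine ⟨qf, hqf, lrun_iff.2 ?_⟩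
    have := (run_to_lrun h).2
    simpa [toRM] using this
  · rintro ⟨qf, hqf, h⟩
    refine ⟨qf, hqf, ?_⟩
    have := lrun_to_run (T := T) (lrun_iff.1 h)
    simpa [toRM] using this

end Monoid

/-- Transport of a raw machine to a transducer. -/
def fromRM {Q Q' A B : Type} (M : RM Q (Tape A) B) (e : Q ≃ Q') : TwoWayTransducer Q' A B where
  ρ i := M.ρ (e.symm i)
  init := e M.init
  init_fwd := by simp [M.init_fwd]
  final := {i | e.symm i ∈ M.fin}
  δ a := {z | (e.symm z.1, z.2.1, e.symm z.2.2) ∈ M.δ a}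

theorem fromRM_real {Q Q' A B : Type} (M : RM Q (Tape A) B) (e : Q ≃ Q') (t : List (Tape A))
    (o : List B) : (toRM (fromRM M e)).Real t o ↔ M.Real t o := by
  have h1 : ∀ x y w, LRun (OSt (toRM (fromRM M e)).ρ (toRM (fromRM M e)).δ t) x w y →
      LRun (OSt M.ρ M.δ t) (x.1, e.symm x.2) w (y.1, e.symm y.2) := by
    intro x y w h
    induction h with
    | refl => exact .refl _
    | head h _ ih =>
      refine .head ?_ ih
      obtain ⟨j, a, h1, h2, h3, h4⟩ := h
      exact ⟨j, a, h1, h2, h3, h4⟩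
  have h2 : ∀ x y w, LRun (OSt M.ρ M.δ t) x w y →
      LRun (OSt (toRM (fromRM M e)).ρ (toRM (fromRM M e)).δ t) (x.1, e x.2) w (y.1, e y.2) := by
    intro x y w h
    induction h with
    | refl => exact .refl _
    | head h _ ih =>
      refine .head ?_ ih
      obtain ⟨j, a, h1, h2, h3, h4⟩ := h
      refine ⟨j, a, h1, ?_, ?_, ?_⟩
      · show (e.symm _, _, e.symm _) ∈ M.δ a
        simpa using h2
      · simpa [entp, toRM, fromRM] using h3
      · simpa [extp, toRM, fromRM] using h4
  constructor
  · rintro ⟨qf, hqf, h⟩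
    refine ⟨e.symm qf, hqf, ?_⟩
    have := h1 _ _ _ h
    simpa [toRM, fromRM] using this
  · rintro ⟨qf, hqf, h⟩
    refine ⟨e qf, ?_, h2 _ _ _ h⟩
    show e.symm _ ∈ M.fin
    simpa using hqf

theorem pr_to_transducer {A B : Type} {h : List (Tape A) → List B → Prop}
    (hp : PR (kT (A := A)) h) : ∃ (n : ℕ) (T : TwoWayTransducer (Fin n) A B),
      T.Planar ∧ T.Reversible ∧ ∀ u o, T.Realizes u o ↔ h (tapeOf u) o := by
  obtain ⟨Q, hQ, M, ht, hinj, hrev, hpl, hreal⟩ := hp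
  obtain ⟨n, ⟨e⟩⟩ := Finite.exists_equiv_fin Q
  have hrel : ∀ a (p q : Fin n), (p, q) ∈ (fromRM M e).rel a ↔ (e.symm p, e.symm q) ∈ M.rel a :=
    fun a p q => Iff.rfl
  refine ⟨n, fromRM M e, ⟨fun a b => ht (e.symm a) < ht (e.symm b), ?_, ?_⟩, ?_, ?_⟩
  · let f : (fun a b : Fin n => ht (e.symm a) < ht (e.symm b)) ↪r ((· < ·) : ℕ → ℕ → Prop) :=
      ⟨⟨fun a => ht (e.symm a), hinj.comp e.symm.injective⟩, Iff.rfl⟩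
    exact f.isStrictTotalOrder
  · rintro a ⟨u, r, v, s, h1, h2, h3, h4, h5⟩
    have hh := hpl (.sym a) rfl
    have pe : ∀ u v : Fin n × Bool, ProfileEdge (fromRM M e).ρ ((fromRM M e).rel (.sym a)) u v →
        ProfileEdge M.ρ (M.rel (.sym a)) (e.symm u.1, u.2) (e.symm v.1, v.2) := by
      rintro u v ⟨⟨p, q⟩, hf, rfl, rfl⟩
      exact ⟨(e.symm p, e.symm q), hf, rfl, rfl⟩
    exact hh ⟨(e.symm u.1, u.2), (e.symm r.1, r.2), (e.symm v.1, v.2), (e.symm s.1, s.2), h1, h2, h3,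
      h4.imp (pe _ _) (pe _ _), h5.imp (pe _ _) (pe _ _)⟩
  · intro a
    refine ⟨fun q r r' h1 h2 => e.symm.injective ((hrev a).1 _ _ _ ((hrel a _ _).1 h1) ((hrel a _ _).1 h2)),
      fun q q' r h1 h2 => e.symm.injective ((hrev a).2 _ _ _ ((hrel a _ _).1 h1) ((hrel a _ _).1 h2))⟩
  · intro u o
    rw [realizes_iff, fromRM_real]
    exact hreal _ (kT_valid.2 ⟨u, rfl⟩) o

theorem fo_to_rev {A B : Type} {f : List A → Option (List B)} (h : IsFOTransduction f) :
    ∃ (n : ℕ) (T : TwoWayTransducer (Fin n) A B), T.Planar ∧ T.Reversible ∧ T.Computes f := by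
  obtain ⟨n, T, hd, hap, hc⟩ := h
  have hd' : ∀ a, IsDet ((toRM T).rel a) := hd
  have p1 := (good_ann (B := B) hap).2 _ (smach_pr (T := toRM T) hd' (fun c => kT c.1))
  obtain ⟨m, T', h1, h2, h3⟩ := pr_to_transducer p1
  refine ⟨m, T', h1, h2, fun u v => ?_⟩
  rw [hc u v, realizes_iff, h3]
  exact (smach_real hd' (tapeOf u) v).symm

theorem main_thm {A B : Type} [Fintype A] [Fintype B]
    (f : List A → Option (List B)) :
    (IsFOTransduction f ↔
      ∃ (n : ℕ) (T : TwoWayTransducer (Fin n) A B),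
        T.Planar ∧ T.Deterministic ∧ T.Computes f) ∧
    (IsFOTransduction f ↔
      ∃ (n : ℕ) (T : TwoWayTransducer (Fin n) A B),
        T.Planar ∧ T.Reversible ∧ T.Computes f) := by
  have h21 : (∃ (n : ℕ) (T : TwoWayTransducer (Fin n) A B),
      T.Planar ∧ T.Deterministic ∧ T.Computes f) → IsFOTransduction f := by
    rintro ⟨n, T, hp, hd, hc⟩
    exact ⟨n, T, hd, planar_det_ap T hp hd, hc⟩
  have h32 : (∃ (n : ℕ) (T : TwoWayTransducer (Fin n) A B),
      T.Planar ∧ T.Reversible ∧ T.Computes f) → ∃ (n : ℕ) (T : TwoWayTransducer (Fin n) A B),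
      T.Planar ∧ T.Deterministic ∧ T.Computes f := by
    rintro ⟨n, T, hp, hr, hc⟩
    exact ⟨n, T, hp, fun a => (hr a).1, hc⟩
  exact ⟨⟨fun h => h32 (fo_to_rev h), h21⟩, ⟨fo_to_rev, fun h => h21 (h32 h)⟩⟩

end Planar2DFT

namespace Planar2DFT

/-- For a partial function `f : Σ* ⇀ Γ*` over finite alphabets,
the following are equivalent: `f` is a first-order transduction; `f` is
computed by some planar deterministic two-way finite transducer; `f` is
computed by some planar reversible two-way finite transducer. -/
theorem planar_det_rev_fo_transduction {A B : Type} [Fintype A] [Fintype B]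
    (f : List A → Option (List B)) :
    (IsFOTransduction f ↔
      ∃ (n : ℕ) (T : TwoWayTransducer (Fin n) A B),
        T.Planar ∧ T.Deterministic ∧ T.Computes f) ∧
    (IsFOTransduction f ↔
      ∃ (n : ℕ) (T : TwoWayTransducer (Fin n) A B),
        T.Planar ∧ T.Reversible ∧ T.Computes f) := by
  exact main_thm f

end Planar2DFT
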